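/- Let f : ℕ → ℂ with |f(n)| ≤ 1 for all n, let α ∈ ℂ with |α| ≤ 1, and let c₁, c₂ > 0. Suppose that for Re s > 1: Σ_{n≥1} f(n) n^{−s} = exp(α·log ζ(s))·H(s), where log ζ(s) = Σ_{p prime} Σ_{m≥1} 1/(m·p^{ms}), and where H(s) is analytic in the region {σ > 1 − c₁/log T, |t| ≤ T} for every sufficiently large T and satisfies |H(s)| ≤ (log T)^{c₂} in this region. Then Σ_{n≤x} f(n) = (H(1)/Γ(α))·x·(log x)^{α−1} + O(x·(log x)^{Re α − 2}), where (log x)^{α−1} = exp((α−1)·log log x) and the implied constant depends only on c₁, c₂. -/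

import Mathlib

/-- The series `Σ_{p prime} Σ_{m ≥ 1} 1/(m·p^{ms})`, which equals `log ζ(s)` for `Re s > 1`. -/
noncomputable def logZetaSeries (s : ℂ) : ℂ :=
  ∑' (q : Nat.Primes) (m : ℕ), 1 / ((m + 1) * ((q : ℕ) : ℂ) ^ (((m : ℂ) + 1) * s))

namespace CSD
open Complex Set Filter Topology

/-- Euler-Maclaurin remainder term. -/
noncomputable def emTerm (n : ℕ) (s : ℂ) : ℂ :=
  (s - 1) * ((n : ℂ) + 1) ^ (-s) + ((n : ℂ) + 1) ^ (1 - s) - (n : ℂ) ^ (1 - s)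

lemma hasDerivAt_cpow_real {u : ℝ} (hu : 0 < u) (c : ℂ) :
    HasDerivAt (fun v : ℝ => (v : ℂ) ^ c) (c * (u : ℂ) ^ (c - 1)) u := by
  have h1 : HasDerivAt (fun z : ℂ => z ^ c) (c * (u : ℂ) ^ (c - 1)) (u : ℂ) := by
    have := (hasDerivAt_id (u : ℂ)).cpow_const (c := c) (by simp [slitPlane, hu])
    simpa using this
  exact h1.comp_ofReal

lemma cpow_sub_bound {n : ℕ} (hn : 1 ≤ n) {s : ℂ} (hs : 0 < s.re) {u v : ℝ}
    (hu : u ∈ Icc (n : ℝ) (n + 1)) (hv : v ∈ Icc (n : ℝ) (n + 1)) :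
    ‖(u : ℂ) ^ (-s) - (v : ℂ) ^ (-s)‖ ≤ ‖s‖ * (n : ℝ) ^ (-s.re - 1) := by
  have hn0 : (0 : ℝ) < n := by exact_mod_cast hn
  have := Convex.norm_image_sub_le_of_norm_hasDerivWithin_le (𝕜 := ℝ)
    (f := fun w : ℝ => (w : ℂ) ^ (-s)) (f' := fun w : ℝ => (-s) * (w : ℂ) ^ (-s - 1))
    (s := Icc (n : ℝ) (n + 1)) (x := v) (y := u) (C := ‖s‖ * (n : ℝ) ^ (-s.re - 1))
    (fun w hw => (hasDerivAt_cpow_real (hn0.trans_le hw.1) (-s)).hasDerivWithinAt)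
    (fun w hw => by
      have hw0 := hn0.trans_le hw.1
      rw [norm_mul, norm_neg, norm_cpow_eq_rpow_re_of_pos hw0]
      gcongr ‖s‖ * ?_
      simp only [sub_re, neg_re, one_re]
      exact Real.rpow_le_rpow_of_nonpos hn0 hw.1 (by linarith))
    (convex_Icc _ _) hv hu
  refine this.trans ?_
  have h1 : ‖u - v‖ ≤ 1 := by
    rw [Real.norm_eq_abs, abs_le]; constructor <;> linarith [hu.1, hu.2, hv.1, hv.2]
  exact mul_le_of_le_one_right (by positivity) h1

lemma emTerm_bound {n : ℕ} (hn : 1 ≤ n) {s : ℂ} (hs : 0 < s.re) :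
    ‖emTerm n s‖ ≤ ‖s - 1‖ * ‖s‖ * (n : ℝ) ^ (-s.re - 1) := by
  have hn0 : (0 : ℝ) < n := by exact_mod_cast hn
  have := Convex.norm_image_sub_le_of_norm_hasDerivWithin_le (𝕜 := ℝ)
    (f := fun w : ℝ => (w : ℂ) * ((s - 1) * ((n + 1 : ℝ) : ℂ) ^ (-s)) + (w : ℂ) ^ (1 - s))
    (f' := fun w : ℝ => (s - 1) * (((n + 1 : ℝ) : ℂ) ^ (-s) - (w : ℂ) ^ (-s)))
    (s := Icc (n : ℝ) (n + 1)) (x := n) (y := n + 1)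
    (C := ‖s - 1‖ * (‖s‖ * (n : ℝ) ^ (-s.re - 1)))
    (fun w hw => by
      have h1 := hasDerivAt_cpow_real (hn0.trans_le hw.1) (1 - s)
      have h2 := (hasDerivAt_id (w : ℝ)).ofReal_comp.mul_const ((s - 1) * ((n + 1 : ℝ) : ℂ) ^ (-s))
      have h3 := h2.add h1
      refine (h3.congr_deriv ?_).hasDerivWithinAt
      have : (1 : ℂ) - s - 1 = -s := by ring
      rw [this]; push_cast; ring)
    (fun w hw => by
      rw [norm_mul]
      gcongr
      exact cpow_sub_bound hn hs ⟨by linarith, le_rfl⟩ hw)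
    (convex_Icc _ _) ⟨le_rfl, by linarith⟩ ⟨by linarith, le_rfl⟩
  have h2 : ‖((n + 1 : ℝ) - n : ℝ)‖ = 1 := by simp
  rw [h2, mul_one] at this
  rw [mul_assoc ‖s - 1‖]
  refine le_trans (le_of_eq ?_) this
  congr 1
  unfold emTerm
  push_cast
  ring

lemma emTerm_differentiable {n : ℕ} (hn : 1 ≤ n) : Differentiable ℂ (emTerm n) := by
  have h1 : ((n : ℂ) + 1) ≠ 0 := by exact_mod_cast Nat.succ_ne_zero n
  have h2 : (n : ℂ) ≠ 0 := by exact_mod_cast (by omega : n ≠ 0)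
  unfold emTerm
  intro s
  refine (DifferentiableAt.add (DifferentiableAt.mul (by fun_prop) ?_) ?_).sub ?_
  · exact DifferentiableAt.const_cpow (by fun_prop) (Or.inl h1)
  · exact DifferentiableAt.const_cpow (by fun_prop) (Or.inl h1)
  · exact DifferentiableAt.const_cpow (by fun_prop) (Or.inl h2)

lemma zeta1_eq (s : ℂ) (hs : s ≠ 1) : riemannZeta₁ s = (s - 1) * riemannZeta s := by
  have := sub_ne_zero.2 hs
  rw [riemannZeta_eq_inv_sub_mul hs, mul_inv_cancel_left₀ this]

lemma em_formula_gt {s : ℂ} (hs : 1 < s.re) (N : ℕ) (hN : 1 ≤ N) :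
    HasSum (fun n => emTerm (n + N) s) (riemannZeta₁ s - ((s - 1) * ∑ n ∈ Finset.range N, ((n : ℂ) + 1) ^ (-s)
      + (N : ℂ) ^ (1 - s))) := by
  have hs1 : s ≠ 1 := by rintro rfl; simp at hs
  have h1 : HasSum (fun n : ℕ => ((n : ℂ) + 1) ^ (-s)) (riemannZeta s) := by
    rw [zeta_eq_tsum_one_div_nat_add_one_cpow hs]
    have : Summable (fun n : ℕ => 1 / ((n : ℂ) + 1) ^ s) := by
      have := (summable_nat_add_iff 1).2 (Complex.summable_one_div_nat_cpow.2 hs)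
      simpa using this
    convert this.hasSum using 2 with n
    rw [cpow_neg, one_div]
  have h2 := ((hasSum_nat_add_iff' N).2 h1).mul_left (s - 1)
  have h3 : Tendsto (fun n : ℕ => ((n : ℂ)) ^ (1 - s)) atTop (𝓝 0) := by
    rw [tendsto_zero_iff_norm_tendsto_zero]
    have : Tendsto (fun n : ℕ => (n : ℝ) ^ (-(s.re - 1))) atTop (𝓝 0) :=
      (tendsto_rpow_neg_atTop (by linarith)).comp tendsto_natCast_atTop_atTop
    refine this.congr' ?_
    filter_upwards [eventually_ge_atTop 1] with n hn
    have := norm_cpow_eq_rpow_re_of_pos (x := n) (by exact_mod_cast hn) (1 - s)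
    simp only [ofReal_natCast] at this
    rw [this]; congr 1; simp
  have hsm : Summable (fun n => emTerm (n + N) s) := by
    have hb : Summable (fun n : ℕ => ‖s - 1‖ * ‖s‖ * ((n + N : ℕ) : ℝ) ^ (-s.re - 1)) := by
      apply Summable.mul_left
      exact (summable_nat_add_iff N).2 (Real.summable_nat_rpow.2 (by linarith))
    exact Summable.of_norm_bounded hb (fun n => emTerm_bound (by omega) (by linarith))
  rw [hsm.hasSum_iff_tendsto_nat]
  have h4 := h2.tendsto_sum_nat
  have h5 : Tendsto (fun n : ℕ => ((n + N : ℕ) : ℂ) ^ (1 - s) - (N : ℂ) ^ (1 - s)) atTop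
      (𝓝 (0 - (N : ℂ) ^ (1 - s))) :=
    (((tendsto_add_atTop_iff_nat N).2 h3)).sub_const _
  have h6 := h4.add h5
  rw [zeta1_eq s hs1]
  convert h6 using 2 with n
  · have := Finset.sum_range_sub (fun i : ℕ => ((i + N : ℕ) : ℂ) ^ (1 - s)) n
    simp only [zero_add] at this
    rw [← this, ← Finset.sum_add_distrib]
    refine Finset.sum_congr rfl fun i _ => ?_
    unfold emTerm
    push_cast
    ring_nf
  · ring

lemma em_formula {s : ℂ} (hs : 1 / 2 < s.re) (N : ℕ) (hN : 1 ≤ N) :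
    riemannZeta₁ s = (s - 1) * ∑ n ∈ Finset.range N, ((n : ℂ) + 1) ^ (-s)
      + (N : ℂ) ^ (1 - s) + ∑' n, emTerm (n + N) s := by
  set R : ℝ := ‖s‖ + 4
  set U : Set ℂ := {z | 1 / 2 < z.re} ∩ Metric.ball 0 R
  have hUo : IsOpen U := (isOpen_lt continuous_const continuous_re).inter Metric.isOpen_ball
  have hUc : Convex ℝ U := (convex_halfSpace_re_gt _).inter (convex_ball _ _)
  have hsU : s ∈ U := ⟨hs, by simp [R]⟩
  have h3U : (3 : ℂ) ∈ U := ⟨by norm_num, by simp [R]; linarith [norm_nonneg s]⟩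
  have hd1 : DifferentiableOn ℂ (fun z => ∑' n, emTerm (n + N) z) U := by
    refine differentiableOn_tsum_of_summable_norm
      (u := fun n : ℕ => (R + 1) * R * ((n + N : ℕ) : ℝ) ^ (-(3/2) : ℝ)) ?_
      (fun n => (emTerm_differentiable (by omega)).differentiableOn) hUo ?_
    · apply Summable.mul_left
      exact (summable_nat_add_iff N).2 (Real.summable_nat_rpow.2 (by norm_num))
    · rintro n z ⟨hz1, hz2⟩
      have hz1 : 1 / 2 < z.re := hz1
      refine (emTerm_bound (by omega) (by linarith)).trans ?_
      have hz3 : ‖z‖ ≤ R := (mem_ball_zero_iff.1 hz2).le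
      have : ‖z - 1‖ ≤ R + 1 := (norm_sub_le _ _).trans (by simpa using hz3)
      have hb : (1 : ℝ) ≤ ((n + N : ℕ) : ℝ) := by exact_mod_cast (by omega : 1 ≤ n + N)
      gcongr
      linarith
  have hd2 : DifferentiableOn ℂ (fun z => (z - 1) * ∑ n ∈ Finset.range N, ((n : ℂ) + 1) ^ (-z)
      + (N : ℂ) ^ (1 - z) + ∑' n, emTerm (n + N) z) U := by
    refine DifferentiableOn.add (Differentiable.differentiableOn ?_) hd1
    have h2 : (N : ℂ) ≠ 0 := by exact_mod_cast (by omega : N ≠ 0)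
    refine Differentiable.add (Differentiable.mul (by fun_prop) (Differentiable.fun_sum fun n _ => ?_)) ?_
    · have h1 : ((n : ℂ) + 1) ≠ 0 := by exact_mod_cast Nat.succ_ne_zero n
      intro z; exact DifferentiableAt.const_cpow (by fun_prop) (Or.inl h1)
    · intro z; exact DifferentiableAt.const_cpow (by fun_prop) (Or.inl h2)
  have := AnalyticOnNhd.eqOn_of_preconnected_of_eventuallyEq
    (differentiable_riemannZeta₁.differentiableOn.analyticOnNhd hUo) (hd2.analyticOnNhd hUo)
    hUc.isPreconnected h3U ?_
  · exact this hsU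
  · have : {z : ℂ | 1 < z.re} ∈ 𝓝 (3 : ℂ) :=
      (isOpen_lt continuous_const continuous_re).mem_nhds (by norm_num)
    filter_upwards [this] with z hz
    rw [(em_formula_gt hz N hN).tsum_eq]; ring

/-- Polynomial bound for zeta slightly to the left of the one line. -/
lemma zeta_bound {a : ℝ} (ha : 0 < a) (ha' : a ≤ 1 / 4) : ∃ C : ℝ, 0 < C ∧ ∀ s : ℂ, 1 - a ≤ s.re → s.re ≤ 4 →
    1 ≤ |s.im| → ‖riemannZeta s‖ ≤ C * |s.im| ^ (2 * a) := by
  set Q : ℝ := ∑' n : ℕ, ((n + 1 : ℕ) : ℝ) ^ (-1 - a)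
  have hQs : Summable (fun n : ℕ => ((n + 1 : ℕ) : ℝ) ^ (-1 - a)) :=
    (summable_nat_add_iff 1).2 (Real.summable_nat_rpow.2 (by linarith))
  have hQ : 0 ≤ Q := tsum_nonneg fun n => by positivity
  refine ⟨7 * Q + 1, by positivity, fun s hs1 hs4 ht => ?_⟩
  have hs : s ≠ 1 := by rintro rfl; simp at ht; linarith
  set t := |s.im|
  set N := ⌊t⌋₊
  have hN : 1 ≤ N := Nat.le_floor (by simpa using ht)
  have hNt : (N : ℝ) ≤ t := Nat.floor_le (by positivity)
  have htN : t < N + 1 := Nat.lt_floor_add_one t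
  have hN' : (1 : ℝ) ≤ N := by exact_mod_cast hN
  have hs0 : 0 < ‖s - 1‖ := norm_pos_iff.2 (sub_ne_zero.2 hs)
  have hst : 1 ≤ ‖s - 1‖ := ht.trans (by simpa using abs_im_le_norm (s - 1))
  have hsn : ‖s‖ ≤ 6 * N := by
    have := norm_le_abs_re_add_abs_im s
    have h2 : |s.re| ≤ 4 := abs_le.2 ⟨by linarith, hs4⟩
    have h3 : |s.im| = t := rfl
    linarith
  have key : ‖s - 1‖ * ‖riemannZeta s‖ ≤ ‖s - 1‖ * (Q * (N:ℝ) ^ (2 * a)) + (N:ℝ) ^ (2 * a) +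
      ‖s - 1‖ * ‖s‖ * ((N:ℝ) ^ (2 * a - 1) * Q) := by
    rw [← norm_mul, ← zeta1_eq s hs, em_formula (by linarith) N hN]
    refine (norm_add_le _ _).trans (add_le_add ((norm_add_le _ _).trans (add_le_add ?_ ?_)) ?_)
    · rw [norm_mul]
      gcongr
      refine (norm_sum_le _ _).trans ?_
      calc ∑ i ∈ Finset.range N, ‖((i : ℂ) + 1) ^ (-s)‖
          ≤ ∑ i ∈ Finset.range N, ((i + 1 : ℕ) : ℝ) ^ (-1 - a) * (N:ℝ) ^ (2 * a) := by
            refine Finset.sum_le_sum fun i hi => ?_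
            have hi' : ((i + 1 : ℕ) : ℝ) ≤ N := by exact_mod_cast Finset.mem_range.1 hi
            have h0 : (0 : ℝ) < ((i + 1 : ℕ) : ℝ) := by positivity
            have := norm_cpow_eq_rpow_re_of_pos h0 (-s)
            push_cast at this ⊢
            rw [this]
            calc ((i : ℝ) + 1) ^ (-s).re ≤ ((i : ℝ) + 1) ^ (-1 - a + 2 * a) := by
                  apply Real.rpow_le_rpow_of_exponent_le
                  · linarith [(Nat.cast_nonneg i : (0:ℝ) ≤ i)]
                  · simp; linarith
              _ = ((i : ℝ) + 1) ^ (-1 - a) * ((i : ℝ) + 1) ^ (2 * a) :=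
                  Real.rpow_add (by positivity) _ _
              _ ≤ _ := by gcongr; push_cast at hi'; exact hi'
        _ = (∑ i ∈ Finset.range N, ((i + 1 : ℕ) : ℝ) ^ (-1 - a)) * (N:ℝ) ^ (2 * a) := by
            rw [Finset.sum_mul]
        _ ≤ _ := by
            gcongr
            exact hQs.sum_le_tsum _ (fun i _ => by positivity)
    · have := norm_cpow_eq_rpow_re_of_pos (x := N) (by linarith) (1 - s)
      simp only [ofReal_natCast] at this
      rw [this]
      apply Real.rpow_le_rpow_of_exponent_le hN'
      simp; linarith
    · have hb : Summable (fun n : ℕ => ‖s - 1‖ * ‖s‖ * ((N:ℝ) ^ (2 * a - 1) * ((n + N : ℕ) : ℝ) ^ (-1 - a))) := by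
        apply Summable.mul_left
        apply Summable.mul_left
        exact (summable_nat_add_iff N).2 (Real.summable_nat_rpow.2 (by linarith))
      have hle : ∀ n : ℕ, ‖emTerm (n + N) s‖ ≤ ‖s - 1‖ * ‖s‖ * ((N:ℝ) ^ (2 * a - 1) * ((n + N : ℕ) : ℝ) ^ (-1 - a)) := by
        intro n
        refine (emTerm_bound (by omega) (by linarith)).trans ?_
        have h1 : (N : ℝ) ≤ ((n + N : ℕ) : ℝ) := by exact_mod_cast (by omega)
        gcongr
        calc ((n + N : ℕ) : ℝ) ^ (-s.re - 1) ≤ ((n + N : ℕ) : ℝ) ^ ((2 * a - 1) + (-1 - a)) := by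
              apply Real.rpow_le_rpow_of_exponent_le (by linarith); linarith
          _ = ((n + N : ℕ) : ℝ) ^ (2 * a - 1) * ((n + N : ℕ) : ℝ) ^ (-1 - a) :=
              Real.rpow_add (by linarith) _ _
          _ ≤ _ := by
              refine mul_le_mul_of_nonneg_right ?_ (by positivity)
              exact Real.rpow_le_rpow_of_nonpos (by linarith) h1 (by linarith)
      refine (tsum_of_norm_bounded hb.hasSum hle).trans ?_
      rw [tsum_mul_left, tsum_mul_left]
      gcongr
      have e := hQs.sum_add_tsum_nat_add (N - 1)
      have e2 : ∑' n : ℕ, ((n + N : ℕ) : ℝ) ^ (-1 - a) = ∑' n : ℕ, ((n + (N - 1) + 1 : ℕ) : ℝ) ^ (-1 - a) := by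
        congr 1; ext n; congr 2; omega
      rw [e2]
      have : 0 ≤ ∑ i ∈ Finset.range (N - 1), ((i + 1 : ℕ) : ℝ) ^ (-1 - a) :=
        Finset.sum_nonneg fun i _ => by positivity
      linarith
  have hNa : ‖s‖ * ((N:ℝ) ^ (2 * a - 1) * Q) ≤ 6 * Q * (N:ℝ) ^ (2 * a) := by
    calc ‖s‖ * ((N:ℝ) ^ (2 * a - 1) * Q) ≤ 6 * N * ((N:ℝ) ^ (2 * a - 1) * Q) := by gcongr
      _ = 6 * Q * (N:ℝ) ^ (2 * a) := by
        rw [Real.rpow_sub_one (by linarith)]; field_simp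
  have hP : (N:ℝ) ^ (2 * a) ≤ ‖s - 1‖ * (N:ℝ) ^ (2 * a) := le_mul_of_one_le_left (by positivity) hst
  have : ‖s - 1‖ * ‖riemannZeta s‖ ≤ ‖s - 1‖ * ((7 * Q + 1) * (N:ℝ) ^ (2 * a)) := by
    have := mul_le_mul_of_nonneg_left hNa hs0.le
    nlinarith
  have h2 := le_of_mul_le_mul_left this hs0
  refine h2.trans ?_
  gcongr

end CSD

namespace CSD
open Complex Set Filter Topology

lemma zeta_341 {x : ℝ} (hx : 0 < x) (y : ℝ) :
    1 ≤ ‖riemannZeta (1 + x)‖ ^ 3 * ‖riemannZeta (1 + x + I * y)‖ ^ 4 *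
      ‖riemannZeta (1 + x + 2 * I * y)‖ := by
  have h := DirichletCharacter.norm_LFunction_product_ge_one (N := 1) (χ := 1) hx y
  have e : ∀ s, DirichletCharacter.LFunction (1 : DirichletCharacter ℂ 1) s = riemannZeta s := by
    intro s; rw [DirichletCharacter.LFunction_modOne_eq]
  simp only [DirichletCharacter.LFunctionTrivChar, one_pow, e, norm_mul, norm_pow] at h
  exact h

lemma zeta_real_bound : ∃ C : ℝ, 1 ≤ C ∧ ∀ x : ℝ, 0 < x → x ≤ 3 → ‖riemannZeta (1 + x)‖ ≤ C / x := by
  obtain ⟨C, hC⟩ := (isCompact_Icc (a := (0 : ℝ)) (b := 3)).exists_bound_of_continuousOn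
    (f := fun x : ℝ => riemannZeta₁ (1 + x))
    (differentiable_riemannZeta₁.continuous.comp (by fun_prop)).continuousOn
  refine ⟨max C 1, le_max_right _ _, fun x hx hx3 => ?_⟩
  have hx0 : (x : ℂ) ≠ 0 := by exact_mod_cast hx.ne'
  have h1 := hC x ⟨hx.le, hx3⟩
  rw [zeta1_eq _ (by simpa using hx.ne')] at h1
  simp only [add_sub_cancel_left, norm_mul, norm_real, Real.norm_eq_abs, abs_of_pos hx] at h1
  rw [le_div_iff₀ hx, mul_comm]
  exact h1.trans (le_max_left _ _)

lemma zeta_deriv_bound {a : ℝ} (ha : 0 < a) (ha' : a ≤ 1 / 4) : ∃ C : ℝ, 0 < C ∧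
    ∀ s : ℂ, 1 - a / 2 ≤ s.re → s.re ≤ 7 / 2 →
    2 ≤ |s.im| → ‖deriv riemannZeta s‖ ≤ C * (|s.im| + 3) ^ (2 * a) := by
  obtain ⟨C, hC, h⟩ := zeta_bound ha ha'
  refine ⟨C / (a / 2), by positivity, fun s h1 h2 h3 => ?_⟩
  have key : ∀ z ∈ Metric.closedBall s (a / 2), 1 - a ≤ z.re ∧ z.re ≤ 4 ∧ 1 ≤ |z.im| ∧ |z.im| ≤ |s.im| + 3 := by
    intro z hz
    rw [mem_closedBall_iff_norm] at hz
    have hr := (abs_re_le_norm (z - s)).trans hz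
    have hi := (abs_im_le_norm (z - s)).trans hz
    rw [sub_re, abs_le] at hr
    rw [sub_im] at hi
    have e1 := abs_sub_abs_le_abs_sub z.im s.im
    have e2 := abs_sub_abs_le_abs_sub s.im z.im
    rw [abs_sub_comm] at e2
    refine ⟨by linarith [hr.1], by linarith [hr.2], by linarith, by linarith⟩
  have := norm_deriv_le_of_forall_mem_sphere_norm_le (f := riemannZeta) (c := s) (R := a / 2)
    (C := C * (|s.im| + 3) ^ (2 * a)) (by positivity) ?_ ?_
  · calc _ ≤ _ := this
      _ = _ := by ring
  · apply DifferentiableOn.diffContOnCl_ball (U := {1}ᶜ) differentiableOn_riemannZeta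
    intro z hz
    have := (key z hz).2.2.1
    rintro rfl
    simp at this
    linarith
  · intro z hz
    obtain ⟨k1, k2, k3, k4⟩ := key z (Metric.sphere_subset_closedBall hz)
    refine (h z k1 k2 k3).trans ?_
    gcongr

lemma zfr_far {η : ℝ} (hη : 0 < η) (hη1 : η ≤ 1) : ∃ c : ℝ, 0 < c ∧ ∃ C : ℝ, 0 < C ∧ ∀ s : ℂ,
    2 ≤ |s.im| → 1 - c * (|s.im| + 3) ^ (-η) ≤ s.re → s.re ≤ 3 →
    riemannZeta s ≠ 0 ∧ ‖deriv riemannZeta s / riemannZeta s‖ ≤ C * (|s.im| + 3) ^ η := by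
  set a : ℝ := η / 10 with ha
  set b : ℝ := 2 * a with hb
  have ha0 : 0 < a := by positivity
  have ha1 : a ≤ 1 / 4 := by linarith
  obtain ⟨C, hC, hz⟩ := zeta_bound ha0 ha1
  obtain ⟨C1, hC1, hd⟩ := zeta_deriv_bound ha0 ha1
  obtain ⟨C2, hC2, hr⟩ := zeta_real_bound
  set c4 : ℝ := 1 / (C2 ^ 3 * (2 * C)) with hc4
  have hc40 : 0 < c4 := by positivity
  set κ : ℝ := min (c4 / (4 * C1) ^ 4) (a / 2) with hκ
  have hκ0 : 0 < κ := by positivity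
  have hκ1 : κ * (4 * C1) ^ 4 ≤ c4 := by
    rw [← le_div_iff₀ (by positivity)]; exact min_le_left _ _
  have hκ2 : κ ≤ a / 2 := min_le_right _ _
  refine ⟨κ, hκ0, 1 / (2 * κ), by positivity, fun s ht h1 h3 => ?_⟩
  set τ : ℝ := |s.im| + 3 with hτ
  have hτ1 : 1 ≤ τ := by linarith [abs_nonneg s.im]
  have hτ0 : 0 < τ := by linarith
  set y : ℝ := κ * τ ^ (-η) with hy
  have hy0 : 0 < y := by positivity
  have hyκ : y ≤ κ := mul_le_of_le_one_right hκ0.le (Real.rpow_le_one_of_one_le_of_nonpos hτ1 (by linarith))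
  -- lower bound to the right
  have low : ∀ x : ℝ, y ≤ x → x ≤ 2 → 4 * C1 * κ * τ ^ (-4 * b) ≤ ‖riemannZeta (1 + x + I * s.im)‖ := by
    intro x hx hx2
    have hx0 : 0 < x := hy0.trans_le hx
    have h5 := zeta_341 hx0 s.im
    have h6 := hr x hx0 (by linarith)
    have h7 : ‖riemannZeta (1 + x + 2 * I * s.im)‖ ≤ 2 * C * τ ^ b := by
      have := hz (1 + x + 2 * I * s.im) (by simp; linarith) (by simp; linarith)
        (by simp [abs_mul]; linarith)
      refine this.trans ?_
      have e : |(1 + x + 2 * I * s.im : ℂ).im| = 2 * |s.im| := by simp [abs_mul]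
      rw [e, Real.mul_rpow (by norm_num) (by positivity)]
      have e2 : (2 : ℝ) ^ (2 * a) ≤ 2 ^ (1 : ℝ) := Real.rpow_le_rpow_of_exponent_le (by norm_num) (by linarith)
      have e3 : |s.im| ^ (2 * a) ≤ τ ^ b := by
        rw [hb]; gcongr; linarith
      rw [Real.rpow_one] at e2
      calc C * ((2 : ℝ) ^ (2 * a) * |s.im| ^ (2 * a)) ≤ C * (2 * τ ^ b) := by gcongr
        _ = _ := by ring
    have h8 : 1 ≤ (C2 / x) ^ 3 * ‖riemannZeta (1 + x + I * s.im)‖ ^ 4 * (2 * C * τ ^ b) := by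
      refine h5.trans ?_
      gcongr
    have h9 : c4 * x ^ 3 * τ ^ (-b) ≤ ‖riemannZeta (1 + x + I * s.im)‖ ^ 4 := by
      have e : c4 * x ^ 3 * τ ^ (-b) * ((C2 / x) ^ 3 * (2 * C * τ ^ b)) = 1 := by
        rw [hc4, Real.rpow_neg hτ0.le]
        have : τ ^ b ≠ 0 := by positivity
        field_simp
      have hp : 0 < (C2 / x) ^ 3 * (2 * C * τ ^ b) := by positivity
      refine le_of_mul_le_mul_right ?_ hp
      rw [e]; linarith
    refine le_of_pow_le_pow_left₀ (n := 4) (by norm_num) (norm_nonneg _) (le_trans ?_ h9)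
    calc (4 * C1 * κ * τ ^ (-4 * b)) ^ 4 = (κ * (4 * C1) ^ 4) * κ ^ 3 * (τ ^ (-4 * b)) ^ 4 := by ring
      _ ≤ c4 * κ ^ 3 * (τ ^ (-4 * b)) ^ 4 := by gcongr
      _ = c4 * y ^ 3 * τ ^ (-b) := by
        rw [hy, mul_pow, ← Real.rpow_natCast (τ ^ (-η)) 3, ← Real.rpow_natCast (τ ^ (-4 * b)) 4,
          ← Real.rpow_mul hτ0.le, ← Real.rpow_mul hτ0.le]
        have : τ ^ (-4 * b * (4 : ℕ)) = τ ^ (-η * (3 : ℕ)) * τ ^ (-b) := by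
          rw [← Real.rpow_add hτ0]; congr 1; push_cast; rw [hb, ha]; ring
        rw [this]; ring
      _ ≤ c4 * x ^ 3 * τ ^ (-b) := by gcongr
  have low2 : 2 * C1 * κ * τ ^ (-4 * b) ≤ ‖riemannZeta s‖ := by
    have es : s = 1 + ((s.re - 1 : ℝ) : ℂ) + I * s.im := by
      apply Complex.ext <;> simp
    rcases le_or_gt y (s.re - 1) with hc | hc
    · have := low _ hc (by linarith)
      rw [← es] at this
      have : 0 ≤ C1 * κ * τ ^ (-4 * b) := by positivity
      linarith
    · set p : ℂ := 1 + y + I * s.im with hp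
      have hpl := low y le_rfl (by linarith)
      rw [← hp] at hpl
      have hpre : p.re = 1 + y := by simp [hp]
      have hpim : p.im = s.im := by simp [hp]
      have mv := Convex.norm_image_sub_le_of_norm_deriv_le (𝕜 := ℂ) (f := riemannZeta)
        (s := segment ℝ s p) (x := s) (y := p) (C := C1 * τ ^ b) ?_ ?_ (convex_segment _ _)
        (left_mem_segment _ _ _) (right_mem_segment _ _ _)
      · have hps : ‖p - s‖ ≤ 2 * y := by
          have : p - s = ((1 + y - s.re : ℝ) : ℂ) := by
            apply Complex.ext <;> simp [hpre, hpim]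
          rw [this, norm_real, Real.norm_eq_abs, abs_of_nonneg (by linarith)]; linarith
        have e1 : C1 * τ ^ b * ‖p - s‖ ≤ 2 * C1 * κ * τ ^ (-4 * b) := by
          calc C1 * τ ^ b * ‖p - s‖ ≤ C1 * τ ^ b * (2 * y) := by gcongr
            _ = 2 * C1 * κ * (τ ^ b * τ ^ (-η)) := by rw [hy]; ring
            _ = _ := by
              rw [← Real.rpow_add hτ0]; congr 2; rw [hb, ha]; ring
        have e2 := norm_sub_norm_le (riemannZeta p) (riemannZeta s)
        linarith
      all_goals
        intro z hz
        have hzr : 1 - a / 2 ≤ z.re ∧ z.re ≤ 7 / 2 ∧ z.im = s.im := by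
          obtain ⟨u, v, hu, hv, huv, rfl⟩ := hz
          have hu' : u = 1 - v := by linarith
          refine ⟨?_, ?_, ?_⟩
          · simp [hpre]; subst hu'; nlinarith
          · simp [hpre]; subst hu'; nlinarith
          · simp [hpim, ← add_mul, huv]
      · apply differentiableAt_riemannZeta
        rintro rfl
        have h0 : s.im = 0 := by simpa using hzr.2.2.symm
        rw [h0, abs_zero] at ht; linarith
      · have := hd z hzr.1 hzr.2.1 (by rw [hzr.2.2]; exact ht)
        rw [hzr.2.2] at this; exact this
  have hpos : 0 < 2 * C1 * κ * τ ^ (-4 * b) := by positivity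
  refine ⟨norm_pos_iff.1 (hpos.trans_le low2), ?_⟩
  rw [norm_div, div_le_iff₀ (hpos.trans_le low2)]
  have hd' := hd s (by linarith) (by linarith) ht
  calc ‖deriv riemannZeta s‖ ≤ C1 * τ ^ b := hd'
    _ = 1 / (2 * κ) * τ ^ η * (2 * C1 * κ * τ ^ (-4 * b)) := by
      have : τ ^ b = τ ^ η * τ ^ (-4 * b) := by
        rw [← Real.rpow_add hτ0]; congr 1; rw [hb, ha]; ring
      rw [this]; field_simp
    _ ≤ _ := by gcongr

lemma zeta1_ne_zero {s : ℂ} (hs : 1 ≤ s.re) : riemannZeta₁ s ≠ 0 := by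
  rcases eq_or_ne s 1 with rfl | h
  · simp
  · rw [zeta1_eq s h]
    exact mul_ne_zero (sub_ne_zero.2 h) (riemannZeta_ne_zero_of_one_le_re hs)

lemma zfr_near : ∃ c : ℝ, 0 < c ∧ ∃ C : ℝ, 0 < C ∧ ∀ s : ℂ,
    |s.im| ≤ 2 → 1 - c ≤ s.re → s.re ≤ 3 →
    riemannZeta₁ s ≠ 0 ∧ ‖deriv riemannZeta₁ s / riemannZeta₁ s‖ ≤ C := by
  set K : Set ℂ := Icc (1 : ℝ) 3 ×ℂ Icc (-2 : ℝ) 2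
  have hK : IsCompact K := isCompact_Icc.reProdIm isCompact_Icc
  have hU : IsOpen {s : ℂ | riemannZeta₁ s ≠ 0} :=
    isOpen_ne_fun differentiable_riemannZeta₁.continuous continuous_const
  obtain ⟨c, hc, hcK⟩ := hK.exists_cthickening_subset_open hU
    (fun s hs => zeta1_ne_zero hs.1.1)
  have hcont : ContinuousOn (fun s => deriv riemannZeta₁ s / riemannZeta₁ s) (Metric.cthickening c K) := by
    refine ContinuousOn.div ?_ differentiable_riemannZeta₁.continuous.continuousOn (fun s hs => hcK hs)
    have : AnalyticOnNhd ℂ riemannZeta₁ univ :=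
      differentiable_riemannZeta₁.differentiableOn.analyticOnNhd isOpen_univ
    exact (this.deriv.continuousOn).mono (subset_univ _)
  obtain ⟨C, hC⟩ := hK.cthickening.exists_bound_of_continuousOn hcont
  refine ⟨c, hc, max C 1, by positivity, fun s h1 h2 h3 => ?_⟩
  have hmem : s ∈ Metric.cthickening c K := by
    refine Metric.mem_cthickening_of_dist_le s ⟨max s.re 1, s.im⟩ c K ⟨⟨le_max_right _ _, max_le h3 (by norm_num)⟩, abs_le.1 h1⟩ ?_
    rw [dist_eq_norm]
    have : s - ⟨max s.re 1, s.im⟩ = ((s.re - max s.re 1 : ℝ) : ℂ) := by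
      apply Complex.ext <;> simp
    rw [this, norm_real, Real.norm_eq_abs, abs_le]
    rcases max_cases s.re 1 with h | h <;> rw [h.1] <;> constructor <;> linarith [h.2]
  exact ⟨hcK hmem, (hC s hmem).trans (le_max_left _ _)⟩

/-- Zero free region with logarithmic derivative bound. -/
lemma zfr {η : ℝ} (hη : 0 < η) (hη1 : η ≤ 1) : ∃ c : ℝ, 0 < c ∧ c ≤ 1 ∧ ∃ C : ℝ, 1 ≤ C ∧ ∀ s : ℂ,
    1 - c * (|s.im| + 3) ^ (-η) ≤ s.re → s.re ≤ 3 →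
    riemannZeta₁ s ≠ 0 ∧ ‖deriv riemannZeta₁ s / riemannZeta₁ s‖ ≤ C * (|s.im| + 3) ^ η := by
  obtain ⟨c, hc, C, hC, h⟩ := zfr_far hη hη1
  obtain ⟨c', hc', C', hC', h'⟩ := zfr_near
  refine ⟨min 1 (min c c'), by positivity, min_le_left _ _, max (C + 1) C', by
    exact le_trans (by linarith) (le_max_left _ _), fun s h1 h3 => ?_⟩
  have hτ1 : 1 ≤ |s.im| + 3 := by linarith [abs_nonneg s.im]
  have hτη : 1 ≤ (|s.im| + 3) ^ η := Real.one_le_rpow hτ1 hη.le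
  have hτm : (|s.im| + 3) ^ (-η) ≤ 1 := Real.rpow_le_one_of_one_le_of_nonpos hτ1 (by linarith)
  have hτm0 : 0 < (|s.im| + 3) ^ (-η) := by positivity
  have hm1 : min 1 (min c c') ≤ c := (min_le_right _ _).trans (min_le_left _ _)
  have hm2 : min 1 (min c c') ≤ c' := (min_le_right _ _).trans (min_le_right _ _)
  have hm0 : 0 < min 1 (min c c') := by positivity
  rcases le_total 2 |s.im| with ht | ht
  · obtain ⟨h5, h6⟩ := h s ht (by nlinarith) h3
    have hs1 : s ≠ 1 := by rintro rfl; simp at ht; linarith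
    have hs2 : s - 1 ≠ 0 := sub_ne_zero.2 hs1
    refine ⟨by rw [zeta1_eq s hs1]; exact mul_ne_zero hs2 h5, ?_⟩
    have e : deriv riemannZeta₁ s / riemannZeta₁ s = deriv riemannZeta s / riemannZeta s + 1 / (s - 1) := by
      have hev : riemannZeta₁ =ᶠ[𝓝 s] fun z => (z - 1) * riemannZeta z := by
        filter_upwards [isOpen_ne.mem_nhds hs1] with z hz using zeta1_eq z hz
      rw [hev.deriv_eq, zeta1_eq s hs1]
      have hd := ((hasDerivAt_id s).sub_const 1).mul (differentiableAt_riemannZeta hs1).hasDerivAt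
      have hd2 : deriv (fun z => (z - 1) * riemannZeta z) s = 1 * riemannZeta s + (s - 1) * deriv riemannZeta s :=
        hd.deriv
      rw [hd2]; field_simp; ring
    rw [e]
    have hs3 : ‖1 / (s - 1)‖ ≤ 1 := by
      rw [norm_div, norm_one, div_le_one (norm_pos_iff.2 hs2)]
      have := abs_im_le_norm (s - 1)
      simp at this; linarith
    calc _ ≤ ‖deriv riemannZeta s / riemannZeta s‖ + ‖1 / (s - 1)‖ := norm_add_le _ _
      _ ≤ C * (|s.im| + 3) ^ η + 1 * (|s.im| + 3) ^ η := by linarith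
      _ = (C + 1) * (|s.im| + 3) ^ η := by ring
      _ ≤ _ := by gcongr; exact le_max_left _ _
  · obtain ⟨h5, h6⟩ := h' s ht (by nlinarith) h3
    refine ⟨h5, h6.trans ?_⟩
    calc C' ≤ C' * (|s.im| + 3) ^ η := le_mul_of_one_le_right hC'.le hτη
      _ ≤ _ := by gcongr; exact le_max_right _ _

end CSD

namespace CSD
open Complex Set Filter Topology

lemma hasSum_neg_log {z : ℂ} (hz : ‖z‖ < 1) :
    HasSum (fun m : ℕ => z ^ (m + 1) / ((m : ℂ) + 1)) (-Complex.log (1 - z)) := by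
  have := (hasSum_nat_add_iff' 1).2 (Complex.hasSum_taylorSeries_neg_log hz)
  simpa using this

lemma prime_norm (q : Nat.Primes) (s : ℂ) : ‖((q : ℕ) : ℂ) ^ (-s)‖ = ((q : ℕ) : ℝ) ^ (-s.re) := by
  have h : (0 : ℝ) < ((q : ℕ) : ℝ) := by exact_mod_cast q.2.pos
  have := norm_cpow_eq_rpow_re_of_pos h (-s)
  simpa using this

lemma prime_half (q : Nat.Primes) {σ : ℝ} (hs : 1 < σ) : ((q : ℕ) : ℝ) ^ (-σ) ≤ 1 / 2 := by
  have h : (2 : ℝ) ≤ ((q : ℕ) : ℝ) := by exact_mod_cast q.2.two_le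
  calc ((q : ℕ) : ℝ) ^ (-σ) ≤ ((q : ℕ) : ℝ) ^ (-1 : ℝ) :=
        Real.rpow_le_rpow_of_exponent_le (by linarith) (by linarith)
    _ ≤ (2 : ℝ) ^ (-1 : ℝ) := Real.rpow_le_rpow_of_nonpos (by norm_num) h (by norm_num)
    _ = 1 / 2 := by norm_num [Real.rpow_neg_one]

lemma prime_summable {σ : ℝ} (hs : 1 < σ) : Summable (fun q : Nat.Primes => ((q : ℕ) : ℝ) ^ (-σ)) := by
  have := (Real.summable_nat_rpow (p := -σ)).2 (by linarith)
  exact this.comp_injective Nat.Primes.coe_nat_injective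

lemma logZeta_eq {s : ℂ} (hs : 1 < s.re) :
    logZetaSeries s = ∑' q : Nat.Primes, -Complex.log (1 - ((q : ℕ) : ℂ) ^ (-s)) := by
  unfold logZetaSeries
  congr 1; ext q
  have h1 : ‖((q : ℕ) : ℂ) ^ (-s)‖ < 1 := by
    rw [prime_norm]; linarith [prime_half q hs]
  rw [← (hasSum_neg_log h1).tsum_eq]
  congr 1; ext m
  have : (((q : ℕ) : ℂ) ^ (-s)) ^ (m + 1) = (((q : ℕ) : ℂ) ^ (((m : ℂ) + 1) * s))⁻¹ := by
    rw [← cpow_neg, ← cpow_nat_mul]; congr 1; push_cast; ring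
  rw [this]
  field_simp

lemma exp_logZeta {s : ℂ} (hs : 1 < s.re) : exp (logZetaSeries s) = riemannZeta s := by
  rw [logZeta_eq hs, riemannZeta_eulerProduct_exp_log hs]

lemma norm_log_bound (q : Nat.Primes) {s : ℂ} (hs : 1 < s.re) :
    ‖-Complex.log (1 - ((q : ℕ) : ℂ) ^ (-s))‖ ≤ 3 / 2 * ((q : ℕ) : ℝ) ^ (-s.re) := by
  rw [norm_neg, sub_eq_add_neg]
  have := Complex.norm_log_one_add_half_le_self (z := -((q : ℕ) : ℂ) ^ (-s))
    (by rw [norm_neg, prime_norm]; exact prime_half q hs)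
  rwa [norm_neg, prime_norm] at this

lemma logZeta_diff {s : ℂ} (hs : 1 < s.re) : DifferentiableAt ℂ logZetaSeries s := by
  set p := (1 + s.re) / 2 with hp
  have hp1 : 1 < p := by linarith
  set U : Set ℂ := {z | p < z.re}
  have hU : IsOpen U := isOpen_lt continuous_const continuous_re
  have hd : DifferentiableOn ℂ (fun z => ∑' q : Nat.Primes, -Complex.log (1 - ((q : ℕ) : ℂ) ^ (-z))) U := by
    refine differentiableOn_tsum_of_summable_norm (u := fun q : Nat.Primes => 3 / 2 * ((q : ℕ) : ℝ) ^ (-p))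
      ((prime_summable hp1).mul_left _) ?_ hU ?_
    · intro q z hz
      have hz : p < z.re := hz
      have hq0 : ((q : ℕ) : ℂ) ≠ 0 := by exact_mod_cast q.2.ne_zero
      apply DifferentiableAt.differentiableWithinAt
      refine DifferentiableAt.neg (DifferentiableAt.clog ?_ ?_)
      · exact (differentiableAt_const _).sub (DifferentiableAt.const_cpow (by fun_prop) (Or.inl hq0))
      · have h1 : ‖((q : ℕ) : ℂ) ^ (-z)‖ ≤ 1 / 2 := by
          rw [prime_norm]; exact prime_half q (by linarith)
        left
        have := (abs_re_le_norm (((q : ℕ) : ℂ) ^ (-z))).trans h1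
        rw [abs_le] at this
        rw [sub_re, one_re]; linarith [this.2]
    · intro q z hz
      have hz : p < z.re := hz
      refine (norm_log_bound q (by linarith)).trans ?_
      have h : (2 : ℝ) ≤ ((q : ℕ) : ℝ) := by exact_mod_cast q.2.two_le
      gcongr
      linarith
  have hsU : s ∈ U := by show p < s.re; linarith
  refine ((hd.differentiableAt (hU.mem_nhds hsU))).congr_of_eventuallyEq ?_
  filter_upwards [hU.mem_nhds hsU] with z hz
  exact logZeta_eq (hp1.trans hz)

/-- real version -/
noncomputable def logZR (σ : ℝ) : ℝ := ∑' q : Nat.Primes, -Real.log (1 - ((q : ℕ) : ℝ) ^ (-σ))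

lemma logZeta_real {σ : ℝ} (hs : 1 < σ) : logZetaSeries σ = logZR σ := by
  rw [logZeta_eq (by simpa using hs), logZR, ofReal_tsum]
  congr 1; ext q
  have h1 := prime_half q hs
  have h0 : (0 : ℝ) ≤ ((q : ℕ) : ℝ) := Nat.cast_nonneg _
  rw [ofReal_neg, ofReal_log (by linarith), ofReal_sub, ofReal_cpow h0]
  simp

lemma zeta_real_exp {σ : ℝ} (hs : 1 < σ) : riemannZeta σ = ((Real.exp (logZR σ) : ℝ) : ℂ) := by
  rw [← exp_logZeta (by simpa using hs), logZeta_real hs, ofReal_exp]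

lemma norm_logZeta_le {s : ℂ} (hs : 1 < s.re) : ‖logZetaSeries s‖ ≤ logZR s.re := by
  rw [logZeta_eq hs, logZR]
  have key : ∀ q : Nat.Primes, ‖-Complex.log (1 - ((q : ℕ) : ℂ) ^ (-s))‖ ≤
      -Real.log (1 - ((q : ℕ) : ℝ) ^ (-s.re)) := by
    intro q
    have h1 : ‖((q : ℕ) : ℂ) ^ (-s)‖ < 1 := by
      rw [prime_norm]; linarith [prime_half q hs]
    have hr : HasSum (fun m : ℕ => ‖((q : ℕ) : ℂ) ^ (-s)‖ ^ (m + 1) / ((m : ℝ) + 1))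
        (-Real.log (1 - ‖((q : ℕ) : ℂ) ^ (-s)‖)) :=
      Real.hasSum_pow_div_log_of_abs_lt_one (by simpa using h1)
    rw [← prime_norm, ← (hasSum_neg_log h1).tsum_eq]
    refine tsum_of_norm_bounded hr fun m => le_of_eq ?_
    rw [norm_div, norm_pow]
    congr 1
    have : ((m : ℂ) + 1) = ((m + 1 : ℝ) : ℂ) := by push_cast; rfl
    rw [this, norm_real, Real.norm_eq_abs, abs_of_nonneg (by positivity)]
  have hsum : Summable (fun q : Nat.Primes => -Real.log (1 - ((q : ℕ) : ℝ) ^ (-s.re))) := by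
    refine Summable.of_nonneg_of_le (fun q => (norm_nonneg _).trans (key q)) (fun q => ?_)
      ((prime_summable hs).mul_left (3 / 2))
    have := norm_log_bound q (s := (s.re : ℂ)) (by simpa using hs)
    refine le_trans (le_of_eq ?_) (by simpa using this)
    have h1 := prime_half q hs
    have h0 : (0 : ℝ) ≤ ((q : ℕ) : ℝ) := Nat.cast_nonneg _
    have e : -Complex.log (1 - ((q : ℕ) : ℂ) ^ (-(s.re : ℂ))) = ((-Real.log (1 - ((q : ℕ) : ℝ) ^ (-s.re)) : ℝ) : ℂ) := by
      rw [ofReal_neg, ofReal_log (by linarith), ofReal_sub, ofReal_cpow h0]; simp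
    have e2 : ‖Complex.log (1 - ((q : ℕ) : ℂ) ^ (-(s.re : ℂ)))‖ = -Real.log (1 - ((q : ℕ) : ℝ) ^ (-s.re)) := by
      rw [← norm_neg, e, norm_real, Real.norm_eq_abs, abs_of_nonneg ((norm_nonneg _).trans (key q))]
    exact e2.symm
  exact tsum_of_norm_bounded hsum.hasSum key

lemma norm_exp_logZeta_le : ∃ C : ℝ, 1 ≤ C ∧ ∀ (s α : ℂ), 1 < s.re → s.re ≤ 3 → ‖α‖ ≤ 1 →
    ‖exp (α * logZetaSeries s)‖ ≤ C / (s.re - 1) := by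
  obtain ⟨C, hC1, hC⟩ := zeta_real_bound
  refine ⟨C, hC1, fun s α hs hs3 hα => ?_⟩
  have h1 := hC (s.re - 1) (by linarith) (by linarith)
  have e : (1 : ℂ) + ((s.re - 1 : ℝ) : ℂ) = (s.re : ℂ) := by push_cast; ring
  rw [e, zeta_real_exp hs, norm_real, Real.norm_eq_abs, Real.abs_exp] at h1
  refine (norm_exp_le_exp_norm _).trans (le_trans (Real.exp_le_exp.2 ?_) h1)
  rw [norm_mul]
  calc ‖α‖ * ‖logZetaSeries s‖ ≤ 1 * ‖logZetaSeries s‖ := by gcongr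
    _ ≤ _ := by rw [one_mul]; exact norm_logZeta_le hs

/-- The regularised logarithm. -/
noncomputable def MM (s : ℂ) : ℂ := logZetaSeries s + Complex.log (s - 1)

lemma slit_of_re {s : ℂ} (hs : 1 < s.re) : s - 1 ∈ slitPlane := by
  left; rw [sub_re, one_re]; linarith

lemma exp_MM {s : ℂ} (hs : 1 < s.re) : exp (MM s) = riemannZeta₁ s := by
  have h1 : s ≠ 1 := by rintro rfl; simp at hs
  rw [MM, exp_add, exp_logZeta hs, exp_log (sub_ne_zero.2 h1), zeta1_eq s h1, mul_comm]

lemma MM_diff {s : ℂ} (hs : 1 < s.re) : DifferentiableAt ℂ MM s :=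
  (logZeta_diff hs).add ((differentiableAt_id.sub_const 1).clog (slit_of_re hs))

lemma MM_deriv {s : ℂ} (hs : 1 < s.re) :
    HasDerivAt MM (deriv riemannZeta₁ s / riemannZeta₁ s) s := by
  have h := (MM_diff hs).hasDerivAt
  have h2 := h.cexp
  have hev : (fun z => exp (MM z)) =ᶠ[𝓝 s] riemannZeta₁ := by
    filter_upwards [(isOpen_lt continuous_const continuous_re).mem_nhds hs] with z hz
    exact exp_MM hz
  have h3 := h2.deriv
  rw [hev.deriv_eq, exp_MM hs] at h3
  have hne : riemannZeta₁ s ≠ 0 := zeta1_ne_zero hs.le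
  rw [h3, mul_div_cancel_left₀ _ hne]
  exact h

lemma MM_tendsto : Tendsto (fun σ : ℝ => MM σ) (𝓝[>] 1) (𝓝 0) := by
  have h1 : Tendsto (fun σ : ℝ => ((Real.log ‖riemannZeta₁ σ‖ : ℝ) : ℂ)) (𝓝[>] 1) (𝓝 0) := by
    have hc : ContinuousAt (fun σ : ℝ => ((Real.log ‖riemannZeta₁ σ‖ : ℝ) : ℂ)) 1 := by
      have hZ : Continuous (fun σ : ℝ => ‖riemannZeta₁ σ‖) :=
        (differentiable_riemannZeta₁.continuous.comp continuous_ofReal).norm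
      exact continuous_ofReal.continuousAt.comp (hZ.continuousAt.log (by simp))
    have := hc.tendsto.mono_left (nhdsWithin_le_nhds (s := Ioi (1:ℝ)))
    simpa using this
  refine h1.congr' ?_
  filter_upwards [self_mem_nhdsWithin] with σ hσ
  have hσ : 1 < σ := hσ
  have h2 : (σ : ℂ) ≠ 1 := by exact_mod_cast hσ.ne'
  rw [MM, logZeta_real hσ, zeta1_eq _ h2, zeta_real_exp hσ]
  have e : ((σ : ℂ) - 1) = ((σ - 1 : ℝ) : ℂ) := by push_cast; rfl
  rw [e, ← ofReal_mul, norm_real, Real.norm_eq_abs, abs_of_pos (by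
    have := Real.exp_pos (logZR σ); have : 0 < σ - 1 := by linarith
    positivity), Real.log_mul (by linarith) (Real.exp_pos _).ne', Real.log_exp, ← ofReal_log (by linarith)]
  push_cast; ring

end CSD

namespace CSD
open Complex Set Filter Topology

/-- Local primitives extending a function known on `Re > 1`. -/
lemma local_prim {L L' : ℂ → ℂ} {s0 : ℂ} {r B : ℝ} (hr : 0 < r) (hs0 : 1 < s0.re)
    (hL : ∀ z : ℂ, 1 < z.re → HasDerivAt L (L' z) z)
    (hd : DifferentiableOn ℂ L' (Metric.ball s0 r))
    (hB : ∀ z ∈ Metric.ball s0 r, ‖L' z‖ ≤ B) :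
    ∃ P : ℂ → ℂ, (∀ z ∈ Metric.ball s0 r, HasDerivAt P (L' z) z) ∧
      (∀ z ∈ Metric.ball s0 r, 1 < z.re → P z = L z) ∧
      ∀ z ∈ Metric.ball s0 r, ‖P z - L s0‖ ≤ B * ‖z - s0‖ := by
  obtain ⟨P, hP0, hP⟩ := hd.isExactOn_ball.with_val_at s0 (L s0)
  have hs0b : s0 ∈ Metric.ball s0 r := Metric.mem_ball_self hr
  refine ⟨P, hP, ?_, ?_⟩
  · intro z hz hz1
    have hconv : Convex ℝ (Metric.ball s0 r ∩ {z : ℂ | 1 < z.re}) :=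
      (convex_ball s0 r).inter (convex_halfSpace_re_gt 1)
    have := hconv.norm_image_sub_le_of_norm_hasDerivWithin_le (f := fun z => P z - L z)
      (f' := fun z => L' z - L' z) (C := 0)
      (fun w hw => ((hP w hw.1).sub (hL w hw.2)).hasDerivWithinAt)
      (fun w _ => by simp) (x := s0) (y := z) ⟨hs0b, hs0⟩ ⟨hz, hz1⟩
    have h2 : ‖(P z - L z) - (P s0 - L s0)‖ ≤ 0 := by simpa using this
    have h3 := norm_le_zero_iff.1 h2
    rw [hP0, sub_self, sub_zero] at h3
    exact sub_eq_zero.1 h3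
  · intro z hz
    have := (convex_ball s0 r).norm_image_sub_le_of_norm_hasDerivWithin_le (f := P)
      (f' := L') (C := B) (fun w hw => (hP w hw).hasDerivWithinAt) hB hs0b hz
    rwa [hP0] at this

/-- The shifted height. -/
noncomputable def tau (s : ℂ) : ℝ := |s.im| + 3

lemma tau_ge (s : ℂ) : 3 ≤ tau s := by unfold tau; have := abs_nonneg s.im; linarith
lemma tau_pos (s : ℂ) : 0 < tau s := by have := tau_ge s; linarith

lemma tau_le {z s : ℂ} (h : ‖z - s‖ ≤ 1) : tau z ≤ 2 * tau s := by
  have h1 : |(z - s).im| ≤ 1 := (abs_im_le_norm _).trans h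
  have h2 : |z.im| ≤ |s.im| + 1 := by
    have : z.im = s.im + (z - s).im := by simp
    rw [this]; exact (abs_add_le _ _).trans (by linarith)
  unfold tau; have := abs_nonneg s.im; linarith

lemma tau_rpow_le {z s : ℂ} (h : ‖z - s‖ ≤ 1) {a : ℝ} (ha : 0 ≤ a) (ha1 : a ≤ 1) :
    tau z ^ a ≤ 2 * tau s ^ a := by
  calc tau z ^ a ≤ (2 * tau s) ^ a := Real.rpow_le_rpow (tau_pos z).le (tau_le h) ha
    _ = 2 ^ a * tau s ^ a := Real.mul_rpow (by norm_num) (tau_pos s).le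
    _ ≤ 2 * tau s ^ a := by
        gcongr
        · exact Real.rpow_nonneg (tau_pos s).le _
        · exact (Real.rpow_le_rpow_of_exponent_le (by norm_num) ha1).trans (by norm_num)

lemma tau_rpow_neg {z s : ℂ} (h : ‖z - s‖ ≤ 1) {a : ℝ} (ha : 0 ≤ a) (ha1 : a ≤ 1) :
    (1 / 2) * tau s ^ (-a) ≤ tau z ^ (-a) := by
  have h1 := tau_rpow_le h ha ha1
  rw [Real.rpow_neg (tau_pos z).le, Real.rpow_neg (tau_pos s).le]
  have p1 : 0 < tau z ^ a := Real.rpow_pos_of_pos (tau_pos z) _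
  have p2 : 0 < tau s ^ a := Real.rpow_pos_of_pos (tau_pos s) _
  rw [← one_div, ← one_div, div_mul_div_comm, div_le_div_iff₀ (by positivity) p1]
  linarith

lemma tau_rpow_neg_le_one (s : ℂ) {a : ℝ} (ha : 0 ≤ a) : tau s ^ (-a) ≤ 1 :=
  Real.rpow_le_one_of_one_le_of_nonpos (by have := tau_ge s; linarith) (by linarith)

lemma one_le_tau_rpow (s : ℂ) {a : ℝ} (ha : 0 ≤ a) : 1 ≤ tau s ^ a :=
  Real.one_le_rpow (by have := tau_ge s; linarith) ha

/-- A height-dependent analyticity and growth condition. -/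
def Good (η c C : ℝ) (H : ℂ → ℂ) : Prop :=
  ∀ s : ℂ, 1 - c * tau s ^ (-η) < s.re → DifferentiableAt ℂ H s ∧ ‖H s‖ ≤ C * tau s ^ η

lemma Good.mono {η c C c' : ℝ} {H : ℂ → ℂ} (h : Good η c C H) (hc : c' ≤ c) :
    Good η c' C H := fun s hs => h s (by
      have : c' * tau s ^ (-η) ≤ c * tau s ^ (-η) := by
        gcongr; exact Real.rpow_nonneg (tau_pos s).le _
      linarith)

lemma good_of_hyp (c₁ c₂ T₀ η : ℝ) (hc₁ : 0 < c₁) (hc₂ : 0 < c₂) (hT₀ : 3 ≤ T₀) (hη : 0 < η) :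
    ∃ c, 0 < c ∧ ∃ C, 1 ≤ C ∧ ∀ H : ℂ → ℂ,
      (∀ T : ℝ, T₀ ≤ T →
          DifferentiableOn ℂ H {s : ℂ | 1 - c₁ / Real.log T < s.re ∧ |s.im| ≤ T} ∧
          ∀ s : ℂ, 1 - c₁ / Real.log T < s.re → |s.im| ≤ T → ‖H s‖ ≤ (Real.log T) ^ c₂) →
      Good η c C H := by
  have hT0 : 0 < T₀ := by linarith
  set A : ℝ := T₀ ^ η / η with hA
  have hApos : 0 < A := by positivity
  set B : ℝ := T₀ ^ η * (c₂ / η) ^ c₂ with hB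
  refine ⟨c₁ / A, by positivity, max 1 B, le_max_left _ _, ?_⟩
  intro H hH s hs
  set T : ℝ := |s.im| + 1 + T₀ with hT
  have hat := abs_nonneg s.im
  have hTT : T ≤ T₀ * tau s := by unfold tau; rw [hT]; nlinarith
  have hT4 : 4 ≤ T := by rw [hT]; linarith
  have hlogpos : 0 < Real.log T := Real.log_pos (by linarith)
  have hl1 : Real.log T ≤ A * tau s ^ η := by
    calc Real.log T ≤ T ^ η / η := Real.log_le_rpow_div (by linarith) hη
      _ ≤ (T₀ * tau s) ^ η / η := by gcongr
      _ = A * tau s ^ η := by rw [Real.mul_rpow hT0.le (tau_pos s).le, hA]; ring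
  have hl2 : Real.log T ^ c₂ ≤ B * tau s ^ η := by
    have hq : 0 < η / c₂ := by positivity
    calc Real.log T ^ c₂ ≤ (T ^ (η / c₂) / (η / c₂)) ^ c₂ := by
          gcongr; exact Real.log_le_rpow_div (by linarith) hq
      _ = T ^ η * (c₂ / η) ^ c₂ := by
          rw [div_eq_mul_inv, inv_div, Real.mul_rpow (by positivity) (by positivity),
            ← Real.rpow_mul (by linarith)]
          congr 2; field_simp
      _ ≤ (T₀ * tau s) ^ η * (c₂ / η) ^ c₂ := by gcongr
      _ = B * tau s ^ η := by rw [Real.mul_rpow hT0.le (tau_pos s).le, hB]; ring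
  have ht : 0 < tau s ^ η := Real.rpow_pos_of_pos (tau_pos s) _
  have hre : 1 - c₁ / Real.log T < s.re := by
    have : c₁ / A * tau s ^ (-η) ≤ c₁ / Real.log T := by
      rw [Real.rpow_neg (tau_pos s).le, ← div_eq_mul_inv, div_div]
      gcongr
    linarith
  have him : |s.im| < T := by rw [hT]; linarith
  obtain ⟨hd, hb⟩ := hH T (by rw [hT]; linarith)
  refine ⟨?_, ?_⟩
  · apply hd.differentiableAt
    have ho : IsOpen {s : ℂ | 1 - c₁ / Real.log T < s.re ∧ |s.im| < T} :=
      (isOpen_lt continuous_const continuous_re).inter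
        (isOpen_lt (continuous_abs.comp continuous_im) continuous_const)
    exact Filter.mem_of_superset (ho.mem_nhds ⟨hre, him⟩) (fun z hz => ⟨hz.1, hz.2.le⟩)
  · refine (hb s hre him.le).trans (hl2.trans ?_)
    gcongr; exact le_max_right _ _

/-- The exponent used throughout. -/
noncomputable def et : ℝ := 1 / 20

lemma et_pos : 0 < et := by norm_num [et]
lemma et_le : et ≤ 1 := by norm_num [et]

/-- Points of a small ball lie in the thin region. -/
lemma ball_region {c r : ℝ} {s0 z : ℂ} (hc1 : c ≤ 1)
    (hs0 : 1 < s0.re) (hr : r ≤ c / 2 * tau s0 ^ (-et)) (hz : z ∈ Metric.ball s0 r) :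
    ‖z - s0‖ < 1 / 2 ∧ 1 - c * tau z ^ (-et) < z.re := by
  have hzn : ‖z - s0‖ < r := by rwa [Metric.mem_ball, dist_eq_norm] at hz
  have h1 := tau_rpow_neg_le_one s0 et_pos.le
  have hp : 0 < tau s0 ^ (-et) := Real.rpow_pos_of_pos (tau_pos s0) _
  have hrpos : 0 < r := (norm_nonneg _).trans_lt hzn
  have hcpos : 0 < c := by
    by_contra h; push Not at h; nlinarith
  have hz1 : ‖z - s0‖ < 1 / 2 := by nlinarith
  have h2 := tau_rpow_neg (by linarith : ‖z - s0‖ ≤ 1) et_pos.le et_le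
  refine ⟨hz1, ?_⟩
  have h3 : |(z - s0).re| ≤ ‖z - s0‖ := abs_re_le_norm _
  have h4 := (abs_le.1 h3).1
  simp only [sub_re] at h4
  nlinarith

lemma slit_near {v w : ℂ} (hw : 0 < w.re) (h : ‖v - w‖ < ‖w‖) : v ∈ slitPlane := by
  rw [mem_slitPlane_iff]
  by_contra hc
  push Not at hc
  have h1 : ‖v - w‖ ^ 2 < ‖w‖ ^ 2 := by gcongr
  rw [← normSq_eq_norm_sq, ← normSq_eq_norm_sq, normSq_apply, normSq_apply] at h1
  simp only [sub_re, sub_im, hc.2] at h1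
  nlinarith [hc.1, hc.2]

end CSD

namespace CSD
open Complex Set Filter Topology

lemma cpow_bound {v w β : ℂ} (hw : w ≠ 0) (h : ‖v - w‖ ≤ ‖w‖ / 2) (hβ : ‖β‖ ≤ 3) :
    ‖v ^ β‖ ≤ 8 * Real.exp (3 * Real.pi) * ‖w‖ ^ β.re := by
  have hwp : 0 < ‖w‖ := norm_pos_iff.2 hw
  have hv1 : ‖w‖ / 2 ≤ ‖v‖ := by
    have := norm_sub_norm_le w v
    rw [norm_sub_rev] at this; linarith
  have hv2 : ‖v‖ ≤ 2 * ‖w‖ := by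
    have := norm_sub_norm_le v w
    linarith
  have hvp : 0 < ‖v‖ := by linarith
  have hre := (abs_re_le_norm β).trans hβ
  have him := (abs_im_le_norm β).trans hβ
  have h1 : ‖v‖ ^ β.re ≤ 8 * ‖w‖ ^ β.re := by
    rcases le_total 0 β.re with h0 | h0
    · calc ‖v‖ ^ β.re ≤ (2 * ‖w‖) ^ β.re := Real.rpow_le_rpow hvp.le hv2 h0
        _ = 2 ^ β.re * ‖w‖ ^ β.re := Real.mul_rpow (by norm_num) hwp.le
        _ ≤ 8 * ‖w‖ ^ β.re := by
          gcongr
          calc (2:ℝ) ^ β.re ≤ 2 ^ (3:ℝ) :=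
                Real.rpow_le_rpow_of_exponent_le (by norm_num) (abs_le.1 hre).2
            _ = 8 := by norm_num
    · calc ‖v‖ ^ β.re ≤ (‖w‖ / 2) ^ β.re := Real.rpow_le_rpow_of_nonpos (by linarith) hv1 h0
        _ = 2 ^ (-β.re) * ‖w‖ ^ β.re := by
          rw [Real.div_rpow hwp.le (by norm_num), Real.rpow_neg (by norm_num)]; field_simp
        _ ≤ 8 * ‖w‖ ^ β.re := by
          gcongr
          calc (2:ℝ) ^ (-β.re) ≤ 2 ^ (3:ℝ) :=
                Real.rpow_le_rpow_of_exponent_le (by norm_num) (by linarith [(abs_le.1 hre).1])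
            _ = 8 := by norm_num
  have h2 : (Real.exp (arg v * β.im))⁻¹ ≤ Real.exp (3 * Real.pi) := by
    rw [← Real.exp_neg]
    gcongr
    have : |arg v * β.im| ≤ Real.pi * 3 := by
      rw [abs_mul]
      exact mul_le_mul (abs_arg_le_pi v) him (abs_nonneg _) Real.pi_pos.le
    linarith [(abs_le.1 this).1]
  calc ‖v ^ β‖ ≤ ‖v‖ ^ β.re / Real.exp (arg v * β.im) := norm_cpow_le _ _
    _ = ‖v‖ ^ β.re * (Real.exp (arg v * β.im))⁻¹ := by rw [div_eq_mul_inv]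
    _ ≤ (8 * ‖w‖ ^ β.re) * Real.exp (3 * Real.pi) := by gcongr
    _ = _ := by ring

lemma norm_exp_sub_one_le' (w : ℂ) : ‖exp w - 1‖ ≤ ‖w‖ * Real.exp ‖w‖ := by
  have := Complex.norm_exp_sub_sum_le_norm_mul_exp w 1
  simpa using this

lemma zfr_tau : ∃ c, 0 < c ∧ c ≤ 1 ∧ ∃ C, 1 ≤ C ∧ ∀ s : ℂ, 1 - c * tau s ^ (-et) ≤ s.re →
    s.re ≤ 3 → riemannZeta₁ s ≠ 0 ∧
      ‖deriv riemannZeta₁ s / riemannZeta₁ s‖ ≤ C * tau s ^ et := zfr et_pos et_le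

lemma MM_near : ∃ K, 1 ≤ K ∧ ∀ s : ℂ, 1 < s.re → s.re ≤ 2 → |s.im| ≤ 1 →
    ‖MM s‖ ≤ K * ‖s - 1‖ := by
  obtain ⟨c, hc, hc1, C, hC, hz⟩ := zfr_tau
  refine ⟨C * 4, by linarith, ?_⟩
  intro s h1 h2 h3
  let S : Set ℂ := {z : ℂ | 1 < z.re} ∩ ({z : ℂ | z.re ≤ 2} ∩ ({z : ℂ | z.im ≤ 1} ∩ {z : ℂ | -1 ≤ z.im}))
  have hconv : Convex ℝ S :=
    (convex_halfSpace_re_gt 1).inter ((convex_halfSpace_re_le 2).inter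
      ((convex_halfSpace_im_le 1).inter (convex_halfSpace_im_ge (-1))))
  have hb : ∀ z ∈ S, ‖deriv riemannZeta₁ z / riemannZeta₁ z‖ ≤ C * 4 := by
    intro z hzS
    have hp : 0 < tau z ^ (-et) := Real.rpow_pos_of_pos (tau_pos z) _
    have hz1 : 1 < z.re := hzS.1
    have hz2 : z.re ≤ 2 := hzS.2.1
    refine (hz z (by nlinarith) (by linarith)).2.trans ?_
    gcongr
    have ht : tau z ≤ 4 := by
      unfold tau
      have : |z.im| ≤ 1 := abs_le.2 ⟨hzS.2.2.2, hzS.2.2.1⟩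
      linarith
    calc tau z ^ et ≤ tau z ^ (1:ℝ) :=
          Real.rpow_le_rpow_of_exponent_le (by linarith [tau_ge z]) et_le
      _ ≤ 4 := by rwa [Real.rpow_one]
  have hsS : s ∈ S := ⟨h1, h2, (abs_le.1 h3).2, (abs_le.1 h3).1⟩
  have key : ∀ᶠ σ : ℝ in 𝓝[>] (1:ℝ), ‖MM s - MM σ‖ ≤ C * 4 * ‖s - σ‖ := by
    have : Set.Ioo (1:ℝ) 2 ∈ 𝓝[>] (1:ℝ) := Ioo_mem_nhdsGT (by norm_num)
    filter_upwards [this] with σ hσ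
    refine hconv.norm_image_sub_le_of_norm_hasDerivWithin_le
      (fun w hw => (MM_deriv hw.1).hasDerivWithinAt) hb ?_ hsS
    exact ⟨by simpa using hσ.1, by simpa using hσ.2.le, by simp, by simp⟩
  have l1 : Tendsto (fun σ : ℝ => ‖MM s - MM σ‖) (𝓝[>] (1:ℝ)) (𝓝 ‖MM s - 0‖) :=
    (tendsto_const_nhds.sub MM_tendsto).norm
  have l2 : Tendsto (fun σ : ℝ => C * 4 * ‖s - σ‖) (𝓝[>] (1:ℝ)) (𝓝 (C * 4 * ‖s - (1:ℝ)‖)) := by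
    apply Tendsto.mono_left _ nhdsWithin_le_nhds
    apply Continuous.tendsto
    fun_prop
  have := le_of_tendsto_of_tendsto l1 l2 key
  simpa using this

lemma H_near {c C : ℝ} (hc : 0 < c) (hc1 : c ≤ 1) (hC : 1 ≤ C) : ∃ K, 1 ≤ K ∧
    ∀ H, Good et c C H → ∀ z : ℂ, 1 - c * tau z ^ (-et) < z.re → |z.im| ≤ 2 →
      ‖H z - H 1‖ ≤ K * ‖z - 1‖ ∧ ‖H z‖ ≤ K ∧ ‖H 1‖ ≤ K := by
  refine ⟨40 * C / c, ?_, ?_⟩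
  · rw [le_div_iff₀ hc]; linarith
  intro H hH z hz him
  have hbig : ∀ w : ℂ, |w.im| ≤ 2 → 1 - c * tau w ^ (-et) < w.re → ‖H w‖ ≤ C * 5 := by
    intro w hw hwr
    refine (hH w hwr).2.trans ?_
    gcongr
    have ht : tau w ≤ 5 := by unfold tau; linarith
    calc tau w ^ et ≤ tau w ^ (1:ℝ) :=
          Real.rpow_le_rpow_of_exponent_le (by linarith [tau_ge w]) et_le
      _ ≤ 5 := by rwa [Real.rpow_one]
  have hr1 : ∀ w ∈ Metric.ball (1:ℂ) (c / 4), |w.im| ≤ 2 ∧ 1 - c * tau w ^ (-et) < w.re := by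
    intro w hw
    rw [Metric.mem_ball, dist_eq_norm] at hw
    have h1 := abs_im_le_norm (w - 1)
    have h2 := abs_re_le_norm (w - 1)
    simp only [sub_im, one_im, sub_zero, sub_re, one_re] at h1 h2
    have h3 : |w.im| ≤ 1 := by linarith
    refine ⟨by linarith, ?_⟩
    have ht : tau w ≤ 4 := by unfold tau; linarith
    have h4 : (4:ℝ)⁻¹ ≤ tau w ^ (-et) := by
      rw [Real.rpow_neg (tau_pos w).le]
      have : tau w ^ et ≤ 4 := by
        calc tau w ^ et ≤ tau w ^ (1:ℝ) :=
              Real.rpow_le_rpow_of_exponent_le (by linarith [tau_ge w]) et_le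
          _ ≤ 4 := by rwa [Real.rpow_one]
      exact inv_anti₀ (Real.rpow_pos_of_pos (tau_pos w) _) this
    have := (abs_le.1 h2).1
    nlinarith
  have h11 := hr1 1 (Metric.mem_ball_self (by positivity))
  have hH1 := hbig 1 h11.1 h11.2
  have hHz := hbig z him hz
  have hK : C * 5 ≤ 40 * C / c := by
    rw [le_div_iff₀ hc]; nlinarith
  refine ⟨?_, hHz.trans hK, hH1.trans hK⟩
  rcases lt_or_ge ‖z - 1‖ (c / 4) with h | h
  · have := Complex.dist_le_div_mul_dist_of_mapsTo_ball (f := H) (c := 1) (R₁ := c / 4)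
      (R₂ := C * 10) (z := z)
      (fun w hw => (hH w (hr1 w hw).2).1.differentiableWithinAt) ?_
      (by rwa [Metric.mem_ball, dist_eq_norm])
    · rw [dist_eq_norm, dist_eq_norm] at this
      refine this.trans (le_of_eq ?_)
      field_simp; ring
    · intro w hw
      rw [Metric.mem_closedBall, dist_eq_norm]
      have := hbig w (hr1 w hw).1 (hr1 w hw).2
      exact (norm_sub_le _ _).trans (by linarith)
  · calc ‖H z - H 1‖ ≤ C * 5 + C * 5 := (norm_sub_le _ _).trans (by linarith)
      _ = 40 * C / c * (c / 4) := by field_simp; ring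
      _ ≤ _ := by gcongr

lemma zeta1_differentiable : Differentiable ℂ riemannZeta₁ := by
  exact differentiable_riemannZeta₁

lemma logderiv_diffOn {c C : ℝ} (hz : ∀ s : ℂ, 1 - c * tau s ^ (-et) ≤ s.re →
    s.re ≤ 3 → riemannZeta₁ s ≠ 0 ∧
      ‖deriv riemannZeta₁ s / riemannZeta₁ s‖ ≤ C * tau s ^ et) {U : Set ℂ}
    (hU : ∀ z ∈ U, 1 - c * tau z ^ (-et) ≤ z.re ∧ z.re ≤ 3) :
    DifferentiableOn ℂ (fun z => deriv riemannZeta₁ z / riemannZeta₁ z) U := by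
  intro z hzU
  apply DifferentiableAt.differentiableWithinAt
  refine DifferentiableAt.div ?_ (zeta1_differentiable z) (hz z (hU z hzU).1 (hU z hzU).2).1
  exact (zeta1_differentiable.deriv) z

end CSD

namespace CSD
open Complex Set Filter Topology

lemma near_ext {c C : ℝ} (hc : 0 < c) (hc1 : c ≤ 1) (hC : 1 ≤ C) : ∃ r, 0 < r ∧ r ≤ 1 / 32 ∧
    ∃ K, 1 ≤ K ∧ ∀ H, Good et c C H → ∀ α : ℂ, ‖α‖ ≤ 1 → ∀ s0 : ℂ, 1 < s0.re → s0.re ≤ 2 →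
      |s0.im| ≤ 1 → ∃ E : ℂ → ℂ, DifferentiableOn ℂ E (Metric.ball s0 (r * ‖s0 - 1‖)) ∧
        (∀ z ∈ Metric.ball s0 (r * ‖s0 - 1‖), ‖E z‖ ≤ K * ‖s0 - 1‖ ^ (1 - α.re)) ∧
        ∀ z ∈ Metric.ball s0 (r * ‖s0 - 1‖), 1 < z.re →
          E z = exp (α * logZetaSeries z) * H z - H 1 * (z - 1) ^ (-α) := by
  obtain ⟨cz, hcz, hcz1, Cz, hCz, hz⟩ := zfr_tau
  obtain ⟨K1, hK1, hMM⟩ := MM_near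
  obtain ⟨K2, hK2, hHn⟩ := H_near hc hc1 hC
  set c0 := min c cz with hc0
  have hc0p : 0 < c0 := lt_min hc hcz
  have hc0c : c0 ≤ c := min_le_left _ _
  have hc0z : c0 ≤ cz := min_le_right _ _
  set K3 := K1 + Cz * 5 with hK3
  have hK3p : 1 ≤ K3 := by nlinarith
  set K := 8 * Real.exp (3 * Real.pi) * (K3 * Real.exp (2 * K3) * K2 + K2 * 2) with hK
  have hKge : 1 ≤ K := by
    have e1 : 1 ≤ Real.exp (3 * Real.pi) := Real.one_le_exp (by positivity)
    have e2 : 1 ≤ Real.exp (2 * K3) := Real.one_le_exp (by positivity)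
    have : 1 ≤ K3 * Real.exp (2 * K3) * K2 + K2 * 2 := by
      have : 0 ≤ K3 * Real.exp (2 * K3) * K2 := by positivity
      linarith
    nlinarith
  refine ⟨c0 / 32, by positivity, by linarith, K, hKge, ?_⟩
  intro H hH α hα s0 h1 h2 h3
  set d := ‖s0 - 1‖ with hd
  have hs0ne : s0 - 1 ≠ 0 := by
    intro h; rw [sub_eq_zero] at h; rw [h] at h1; simp at h1
  have hdpos : 0 < d := norm_pos_iff.2 hs0ne
  have hd2 : d ≤ 2 := by
    have := norm_le_abs_re_add_abs_im (s0 - 1)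
    simp only [sub_re, one_re, sub_im, one_im, sub_zero] at this
    rw [abs_of_pos (by linarith)] at this
    linarith
  have htau : tau s0 ≤ 4 := by unfold tau; linarith
  have hρ : c0 / 32 * d ≤ c0 / 2 * tau s0 ^ (-et) := by
    have h4 : (4:ℝ)⁻¹ ≤ tau s0 ^ (-et) := by
      rw [Real.rpow_neg (tau_pos s0).le]
      have : tau s0 ^ et ≤ 4 := by
        calc tau s0 ^ et ≤ tau s0 ^ (1:ℝ) :=
              Real.rpow_le_rpow_of_exponent_le (by linarith [tau_ge s0]) et_le
          _ ≤ 4 := by rwa [Real.rpow_one]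
      exact inv_anti₀ (Real.rpow_pos_of_pos (tau_pos s0) _) this
    nlinarith
  set U := Metric.ball s0 (c0 / 32 * d) with hU
  have hreg : ∀ z ∈ U, ‖z - s0‖ < 1 / 2 ∧ ‖z - s0‖ < c0 / 32 * d ∧
      1 - c * tau z ^ (-et) < z.re ∧ 1 - cz * tau z ^ (-et) < z.re ∧ z.re ≤ 3 ∧ |z.im| ≤ 2 := by
    intro z hzU
    obtain ⟨a1, a2⟩ := ball_region (hc0c.trans hc1) h1 hρ hzU
    have hp : 0 < tau z ^ (-et) := Real.rpow_pos_of_pos (tau_pos z) _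
    have b1 := abs_re_le_norm (z - s0)
    have b2 := abs_im_le_norm (z - s0)
    simp only [sub_re, sub_im] at b1 b2
    refine ⟨a1, by rwa [hU, Metric.mem_ball, dist_eq_norm] at hzU, by nlinarith, by nlinarith, ?_, ?_⟩
    · linarith [(abs_le.1 b1).2]
    · rw [abs_le] at b2 h3 ⊢
      constructor <;> linarith [b2.1, b2.2, h3.1, h3.2]
  have hhalf : ∀ z ∈ U, ‖(z - 1) - (s0 - 1)‖ ≤ d / 2 := by
    intro z hzU
    rw [sub_sub_sub_cancel_right]
    have := (hreg z hzU).2.1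
    nlinarith
  have hslit : ∀ z ∈ U, z - 1 ∈ slitPlane := by
    intro z hzU
    refine slit_near (w := s0 - 1) (by simp; linarith) ((hhalf z hzU).trans_lt ?_)
    linarith
  have hB : ∀ z ∈ U, ‖deriv riemannZeta₁ z / riemannZeta₁ z‖ ≤ Cz * 5 := by
    intro z hzU
    obtain ⟨_, _, _, a4, a5, a6⟩ := hreg z hzU
    refine (hz z a4.le a5).2.trans ?_
    gcongr
    have ht : tau z ≤ 5 := by unfold tau; linarith
    calc tau z ^ et ≤ tau z ^ (1:ℝ) :=
          Real.rpow_le_rpow_of_exponent_le (by linarith [tau_ge z]) et_le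
      _ ≤ 5 := by rwa [Real.rpow_one]
  obtain ⟨P, hP1, hP2, hP3⟩ := local_prim (L := MM) (by positivity : 0 < c0 / 32 * d) h1
    (fun z hz => MM_deriv hz)
    (logderiv_diffOn hz (fun z hzU => ⟨(hreg z hzU).2.2.2.1.le, (hreg z hzU).2.2.2.2.1⟩)) hB
  have hPb : ∀ z ∈ U, ‖P z‖ ≤ K3 * d := by
    intro z hzU
    have e1 := hP3 z hzU
    have e2 := hMM s0 h1 h2 h3
    have e3 := (hreg z hzU).2.1
    have e4 : ‖z - s0‖ ≤ d := by nlinarith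
    have e5 : ‖P z‖ ≤ ‖P z - MM s0‖ + ‖MM s0‖ := by
      have := norm_add_le (P z - MM s0) (MM s0); simpa using this
    have e6 : Cz * 5 * ‖z - s0‖ ≤ Cz * 5 * d := by gcongr
    rw [hK3]; linarith
  refine ⟨fun z => (z - 1) ^ (-α) * (exp (α * P z) * H z - H 1), ?_, ?_, ?_⟩
  · intro z hzU
    apply DifferentiableAt.differentiableWithinAt
    have := hslit z hzU
    have hHd := (hH z (hreg z hzU).2.2.1).1
    have hPd := (hP1 z hzU).differentiableAt
    exact ((differentiableAt_id.sub_const 1).cpow (differentiableAt_const _) this).mul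
      ((((hPd.const_mul α).cexp).mul hHd).sub_const _)
  · intro z hzU
    obtain ⟨g1, g2, g3⟩ := hHn H hH z (hreg z hzU).2.2.1 (hreg z hzU).2.2.2.2.2
    have hz1 : ‖z - 1‖ ≤ 2 * d := by
      have := norm_add_le ((z - 1) - (s0 - 1)) (s0 - 1)
      rw [sub_add_cancel] at this
      linarith [hhalf z hzU]
    have hαP : ‖α * P z‖ ≤ K3 * d := by
      rw [norm_mul]
      calc ‖α‖ * ‖P z‖ ≤ 1 * (K3 * d) := by gcongr; exact hPb z hzU
        _ = _ := one_mul _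
    have hex : ‖exp (α * P z) - 1‖ ≤ K3 * d * Real.exp (2 * K3) := by
      refine (norm_exp_sub_one_le' _).trans ?_
      gcongr
      nlinarith
    have hbr : ‖exp (α * P z) * H z - H 1‖ ≤ (K3 * Real.exp (2 * K3) * K2 + K2 * 2) * d := by
      have : exp (α * P z) * H z - H 1 = (exp (α * P z) - 1) * H z + (H z - H 1) := by ring
      rw [this]
      calc _ ≤ ‖exp (α * P z) - 1‖ * ‖H z‖ + ‖H z - H 1‖ := by
            refine (norm_add_le _ _).trans ?_; rw [norm_mul]
        _ ≤ (K3 * d * Real.exp (2 * K3)) * K2 + K2 * (2 * d) := by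
            gcongr
            exact g1.trans (by gcongr)
        _ = _ := by ring
    have hcp := cpow_bound (β := -α) hs0ne (hhalf z hzU) (by rw [norm_neg]; linarith)
    rw [norm_mul]
    calc _ ≤ (8 * Real.exp (3 * Real.pi) * d ^ (-α).re) *
          ((K3 * Real.exp (2 * K3) * K2 + K2 * 2) * d) := by gcongr
      _ = K * (d ^ (-α.re) * d ^ (1:ℝ)) := by rw [Real.rpow_one, hK, neg_re]; ring
      _ = K * d ^ (1 - α.re) := by rw [← Real.rpow_add hdpos]; congr 2; ring
  · intro z hzU hz1
    show (z - 1) ^ (-α) * (exp (α * P z) * H z - H 1) = _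
    have hzne : z - 1 ≠ 0 := slitPlane_ne_zero (hslit z hzU)
    rw [hP2 z hzU hz1, mul_sub, MM, mul_add, exp_add, mul_comm _ (H 1), cpow_neg,
      cpow_def_of_ne_zero hzne, mul_comm (log (z - 1)) α]
    have := exp_ne_zero (α * log (z - 1))
    field_simp

lemma far_ext {c C : ℝ} (hc : 0 < c) (hc1 : c ≤ 1) (hC : 1 ≤ C) : ∃ r, 0 < r ∧ r ≤ 1 / 2 ∧
    ∃ K, 1 ≤ K ∧ ∀ H, Good et c C H → ∀ α : ℂ, ‖α‖ ≤ 1 → ∀ s0 : ℂ, 1 < s0.re → s0.re ≤ 2 →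
      1 ≤ |s0.im| → ∃ E : ℂ → ℂ, DifferentiableOn ℂ E (Metric.ball s0 (r * tau s0 ^ (-et))) ∧
        (∀ z ∈ Metric.ball s0 (r * tau s0 ^ (-et)),
          ‖E z‖ ≤ K * (s0.re - 1)⁻¹ * tau s0 ^ et) ∧
        ∀ z ∈ Metric.ball s0 (r * tau s0 ^ (-et)), 1 < z.re →
          E z = exp (α * logZetaSeries z) * H z := by
  obtain ⟨cz, hcz, hcz1, Cz, hCz, hz⟩ := zfr_tau
  obtain ⟨CL, hCL, hLZ⟩ := norm_exp_logZeta_le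
  set c0 := min c cz with hc0
  have hc0p : 0 < c0 := lt_min hc hcz
  have hc0c : c0 ≤ c := min_le_left _ _
  have hc0z : c0 ≤ cz := min_le_right _ _
  set K := CL * Real.exp (Cz * 2 + 2) * (C * 2) with hK
  have hKge : 1 ≤ K := by
    have e1 : 1 ≤ Real.exp (Cz * 2 + 2) := Real.one_le_exp (by positivity)
    have : 1 ≤ CL * Real.exp (Cz * 2 + 2) := by nlinarith
    nlinarith
  refine ⟨c0 / 2, by positivity, by linarith, K, hKge, ?_⟩
  intro H hH α hα s0 h1 h2 h3
  have hd1 : 1 ≤ ‖s0 - 1‖ := by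
    have := abs_im_le_norm (s0 - 1)
    simp only [sub_im, one_im, sub_zero] at this
    linarith
  have htp : 0 < tau s0 ^ (-et) := Real.rpow_pos_of_pos (tau_pos s0) _
  have htp2 : 0 < tau s0 ^ et := Real.rpow_pos_of_pos (tau_pos s0) _
  have htm : tau s0 ^ et * tau s0 ^ (-et) = 1 := by
    rw [Real.rpow_neg (tau_pos s0).le]; field_simp
  set U := Metric.ball s0 (c0 / 2 * tau s0 ^ (-et)) with hU
  have hreg : ∀ z ∈ U, ‖z - s0‖ < 1 / 2 ∧ ‖z - s0‖ < c0 / 2 * tau s0 ^ (-et) ∧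
      1 - c * tau z ^ (-et) < z.re ∧ 1 - cz * tau z ^ (-et) < z.re ∧ z.re ≤ 3 ∧ 1 / 2 ≤ ‖z - 1‖ := by
    intro z hzU
    obtain ⟨a1, a2⟩ := ball_region (hc0c.trans hc1) h1 le_rfl hzU
    have hp : 0 < tau z ^ (-et) := Real.rpow_pos_of_pos (tau_pos z) _
    have b1 := abs_re_le_norm (z - s0)
    simp only [sub_re] at b1
    refine ⟨a1, by rwa [hU, Metric.mem_ball, dist_eq_norm] at hzU, by nlinarith, by nlinarith, ?_, ?_⟩
    · linarith [(abs_le.1 b1).2]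
    · have := norm_add_le (z - 1) (s0 - z)
      rw [norm_sub_rev s0 z] at this
      have e : z - 1 + (s0 - z) = s0 - 1 := by ring
      rw [e] at this
      linarith
  have hne : ∀ z ∈ U, z - 1 ≠ 0 := fun z hzU h => by
    have := (hreg z hzU).2.2.2.2.2
    rw [h, norm_zero] at this; linarith
  have hB : ∀ z ∈ U, ‖deriv riemannZeta₁ z / riemannZeta₁ z - (z - 1)⁻¹‖ ≤
      (Cz * 2 + 2) * tau s0 ^ et := by
    intro z hzU
    obtain ⟨a1, _, _, a4, a5, a6⟩ := hreg z hzU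
    have e1 := (hz z a4.le a5).2
    have e2 := tau_rpow_le (by linarith : ‖z - s0‖ ≤ 1) et_pos.le et_le
    have e3 : ‖(z - 1)⁻¹‖ ≤ 2 := by
      rw [norm_inv]; exact (inv_anti₀ (by norm_num) a6).trans (by norm_num)
    have e4 := one_le_tau_rpow s0 et_pos.le
    calc _ ≤ Cz * tau z ^ et + 2 := (norm_sub_le _ _).trans (by linarith)
      _ ≤ Cz * (2 * tau s0 ^ et) + 2 * tau s0 ^ et := by gcongr; linarith
      _ = _ := by ring
  obtain ⟨P, hP1, hP2, hP3⟩ := local_prim (L := logZetaSeries)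
    (L' := fun z => deriv riemannZeta₁ z / riemannZeta₁ z - (z - 1)⁻¹)
    (by positivity : 0 < c0 / 2 * tau s0 ^ (-et)) h1
    (fun z hz => by
      have e1 := MM_deriv hz
      have e2 : HasDerivAt (fun z : ℂ => log (z - 1)) ((z - 1)⁻¹) z := by
        have := ((hasDerivAt_id z).sub_const 1).clog (slit_of_re hz)
        simpa using this
      have e3 := e1.sub e2
      refine e3.congr_of_eventuallyEq (Filter.Eventually.of_forall fun w => ?_)
      simp [MM])
    ((logderiv_diffOn hz (fun z hzU => ⟨(hreg z hzU).2.2.2.1.le, (hreg z hzU).2.2.2.2.1⟩)).sub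
      (fun z hzU => by
        have hn := hne z hzU
        have : DifferentiableAt ℂ (fun z : ℂ => (z - 1)⁻¹) z := by fun_prop (disch := exact hn)
        exact this.differentiableWithinAt)) hB
  refine ⟨fun z => exp (α * P z) * H z, ?_, ?_, ?_⟩
  · intro z hzU
    apply DifferentiableAt.differentiableWithinAt
    have hHd := (hH z (hreg z hzU).2.2.1).1
    have hPd := (hP1 z hzU).differentiableAt
    exact ((hPd.const_mul α).cexp).mul hHd
  · intro z hzU
    have hPP : ‖P z - logZetaSeries s0‖ ≤ Cz * 2 + 2 := by
      refine (hP3 z hzU).trans ?_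
      have := (hreg z hzU).2.1
      have e : ‖z - s0‖ ≤ tau s0 ^ (-et) := by nlinarith
      calc _ ≤ (Cz * 2 + 2) * tau s0 ^ et * tau s0 ^ (-et) := by gcongr
        _ = _ := by rw [mul_assoc, htm, mul_one]
    have hexp : ‖exp (α * P z)‖ ≤ CL / (s0.re - 1) * Real.exp (Cz * 2 + 2) := by
      have : α * P z = α * logZetaSeries s0 + α * (P z - logZetaSeries s0) := by ring
      rw [this, exp_add, norm_mul]
      have p : 0 ≤ CL / (s0.re - 1) := div_nonneg (by linarith) (by linarith)
      gcongr
      · exact hLZ s0 α h1 (by linarith) hα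
      · refine (norm_exp_le_exp_norm _).trans ?_
        gcongr
        rw [norm_mul]
        calc _ ≤ 1 * (Cz * 2 + 2) := by gcongr
          _ = _ := one_mul _
    have hHz : ‖H z‖ ≤ C * (2 * tau s0 ^ et) := by
      refine (hH z (hreg z hzU).2.2.1).2.trans ?_
      gcongr
      exact tau_rpow_le (by linarith [(hreg z hzU).1]) et_pos.le et_le
    rw [norm_mul]
    have p : 0 ≤ CL / (s0.re - 1) := div_nonneg (by linarith) (by linarith)
    calc _ ≤ (CL / (s0.re - 1) * Real.exp (Cz * 2 + 2)) * (C * (2 * tau s0 ^ et)) := by gcongr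
      _ = _ := by rw [hK]; ring
  · intro z hzU hz1
    show exp (α * P z) * H z = _
    rw [hP2 z hzU hz1]

end CSD

namespace CSD
open Complex Set Filter Topology

lemma iteratedDeriv_diffOn {E : ℂ → ℂ} {s0 : ℂ} {ρ : ℝ}
    (hE : DifferentiableOn ℂ E (Metric.ball s0 ρ)) (k : ℕ) :
    DifferentiableOn ℂ (iteratedDeriv k E) (Metric.ball s0 ρ) := by
  have h := (hE.analyticOnNhd Metric.isOpen_ball).iterated_deriv k
  rw [← iteratedDeriv_eq_iterate] at h
  exact h.differentiableOn

lemma cauchy_ball {E : ℂ → ℂ} {s0 : ℂ} {ρ B : ℝ} (hρ : 0 < ρ)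
    (hE : DifferentiableOn ℂ E (Metric.ball s0 ρ)) (hB : ∀ z ∈ Metric.ball s0 ρ, ‖E z‖ ≤ B)
    (k : ℕ) {z : ℂ} (hz : z ∈ Metric.ball s0 (ρ / 2)) :
    ‖iteratedDeriv k E z‖ ≤ k.factorial * B / (ρ / 4) ^ k := by
  have hsub : Metric.closedBall z (ρ / 4) ⊆ Metric.ball s0 ρ := by
    intro w hw
    rw [Metric.mem_ball] at *
    rw [Metric.mem_closedBall] at hw
    linarith [dist_triangle w z s0]
  refine Complex.norm_iteratedDeriv_le_of_forall_mem_sphere_norm_le k (by positivity)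
    (hE.diffContOnCl_ball hsub) ?_
  intro w hw
  exact hB w (hsub (Metric.sphere_subset_closedBall hw))

/-- The twice differentiated error series. -/
noncomputable def GG (f : ℕ → ℂ) (α h : ℂ) (s : ℂ) : ℂ :=
  LSeries (LSeries.logMul^[2] f) s - h * (α * (α + 1)) * (s - 1) ^ (-α - 2)

lemma absc_lt {f : ℕ → ℂ} (hf : ∀ n, ‖f n‖ ≤ 1) {s : ℂ} (hs : 1 < s.re) :
    LSeries.abscissaOfAbsConv f < s.re := by
  have h1 : LSeries.abscissaOfAbsConv f ≤ 1 :=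
    LSeries.abscissaOfAbsConv_le_of_le_const ⟨1, fun n _ => hf n⟩
  exact h1.trans_lt (by exact_mod_cast hs)

lemma cpow_sub_deriv {z : ℂ} (hz : z - 1 ∈ slitPlane) (β : ℂ) :
    HasDerivAt (fun w : ℂ => (w - 1) ^ β) (β * (z - 1) ^ (β - 1)) z := by
  have := ((hasDerivAt_id z).sub_const 1).cpow_const (c := β) hz
  simpa using this

lemma cpow_iter_two {z : ℂ} (hz : 1 < z.re) (α : ℂ) :
    iteratedDeriv 2 (fun w : ℂ => (w - 1) ^ (-α)) z = α * (α + 1) * (z - 1) ^ (-α - 2) := by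
  rw [iteratedDeriv_succ, iteratedDeriv_one]
  have hev : deriv (fun w : ℂ => (w - 1) ^ (-α)) =ᶠ[𝓝 z] fun w => (-α) * (w - 1) ^ (-α - 1) := by
    filter_upwards [(isOpen_lt continuous_const continuous_re).mem_nhds hz] with w hw
    exact (cpow_sub_deriv (slit_of_re hw) _).deriv
  rw [hev.deriv_eq, ((cpow_sub_deriv (slit_of_re hz) (-α - 1)).const_mul (-α)).deriv]
  have : -α - 1 - 1 = -α - 2 := by ring
  rw [this]; ring

lemma LS_iter_two {f : ℕ → ℂ} (hf : ∀ n, ‖f n‖ ≤ 1) {z : ℂ} (hz : 1 < z.re) :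
    iteratedDeriv 2 (LSeries f) z = LSeries (LSeries.logMul^[2] f) z := by
  rw [LSeries_iteratedDeriv 2 (absc_lt hf hz)]; simp

lemma LS_analytic {f : ℕ → ℂ} (hf : ∀ n, ‖f n‖ ≤ 1) {z : ℂ} (hz : 1 < z.re) :
    AnalyticAt ℂ (LSeries f) z :=
  LSeries_analyticOnNhd f z (absc_lt hf hz)

lemma GG_eq {f : ℕ → ℂ} (hf : ∀ n, ‖f n‖ ≤ 1) {z : ℂ} (hz : 1 < z.re) (α h : ℂ) :
    iteratedDeriv 2 (fun w => LSeries f w - h * (w - 1) ^ (-α)) z = GG f α h z := by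
  have h1 : ContDiffAt ℂ 2 (LSeries f) z := (LS_analytic hf hz).contDiffAt
  have hd : DifferentiableOn ℂ (fun w : ℂ => (w - 1) ^ (-α)) {w : ℂ | 1 < w.re} := fun w hw =>
    (cpow_sub_deriv (slit_of_re hw) _).differentiableAt.differentiableWithinAt
  have h2 : ContDiffAt ℂ 2 (fun w : ℂ => (w - 1) ^ (-α)) z :=
    ((hd.analyticOnNhd (isOpen_lt continuous_const continuous_re)) z hz).contDiffAt
  have h3 : ContDiffAt ℂ 2 (fun w : ℂ => h * (w - 1) ^ (-α)) z := contDiffAt_const.mul h2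
  have := iteratedDeriv_sub (n := 2) (x := z) (f := LSeries f)
    (g := fun w : ℂ => h * (w - 1) ^ (-α)) h1 h3
  have e : (fun w => LSeries f w - h * (w - 1) ^ (-α)) =
    LSeries f - fun w : ℂ => h * (w - 1) ^ (-α) := rfl
  rw [e, this, LS_iter_two hf hz, iteratedDeriv_const_mul_field, cpow_iter_two hz, GG]
  ring

lemma isOpen_re : IsOpen {w : ℂ | 1 < w.re} := isOpen_lt continuous_const continuous_re

lemma near_deriv {c C : ℝ} (hc : 0 < c) (hc1 : c ≤ 1) (hC : 1 ≤ C) : ∃ q, 1 ≤ q ∧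
    ∃ K, 1 ≤ K ∧ ∀ H, Good et c C H → ∀ α : ℂ, ‖α‖ ≤ 1 → ∀ f : ℕ → ℂ, (∀ n, ‖f n‖ ≤ 1) →
      (∀ s : ℂ, 1 < s.re → LSeries f s = exp (α * logZetaSeries s) * H s) →
      ∀ s0 : ℂ, 1 < s0.re → s0.re ≤ 2 → |s0.im| ≤ 1 →
      ∀ (W : ℂ → ℂ) (M : ℝ), DifferentiableOn ℂ W (Metric.ball s0 (‖s0 - 1‖ / 32)) →
      (∀ z ∈ Metric.ball s0 (‖s0 - 1‖ / 32), ‖W z‖ ≤ M) → ∀ k : ℕ,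
      ‖iteratedDeriv k (fun z => W z * GG f α (H 1) z) s0‖ ≤
        k.factorial * (M * (K * ‖s0 - 1‖ ^ (-1 - α.re))) * (q / ‖s0 - 1‖) ^ k := by
  obtain ⟨r, hr, hr1, K, hK, hext⟩ := near_ext hc hc1 hC
  refine ⟨8 / r, ?_, 32 * K / r ^ 2, ?_, ?_⟩
  · rw [le_div_iff₀ hr]; linarith
  · rw [le_div_iff₀ (by positivity)]; nlinarith
  intro H hH α hα f hf hF s0 h1 h2 h3 W M hW hM k
  obtain ⟨E, hE1, hE2, hE3⟩ := hext H hH α hα s0 h1 h2 h3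
  set d := ‖s0 - 1‖ with hd
  have hs0ne : s0 - 1 ≠ 0 := by
    intro h; rw [sub_eq_zero] at h; rw [h] at h1; simp at h1
  have hdpos : 0 < d := norm_pos_iff.2 hs0ne
  set ρ := r * d with hρ
  have hρpos : 0 < ρ := by positivity
  have hsub : Metric.ball s0 (ρ / 2) ⊆ Metric.ball s0 ρ := Metric.ball_subset_ball (by linarith)
  have hsub2 : Metric.ball s0 (ρ / 2) ⊆ Metric.ball s0 (d / 32) :=
    Metric.ball_subset_ball (by rw [hρ]; nlinarith)
  have hB2 : ∀ z ∈ Metric.ball s0 (ρ / 2), ‖iteratedDeriv 2 E z‖ ≤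
      32 * K / r ^ 2 * d ^ (-1 - α.re) := by
    intro z hz
    refine (cauchy_ball hρpos hE1 hE2 2 hz).trans (le_of_eq ?_)
    have : d ^ (1 - α.re) = d ^ (-1 - α.re) * d ^ 2 := by
      rw [← Real.rpow_natCast, ← Real.rpow_add hdpos]; congr 1; push_cast; ring
    rw [this, hρ]
    simp only [Nat.factorial]
    field_simp
    norm_num
  have heq : ∀ z ∈ Metric.ball s0 (ρ / 2), 1 < z.re → GG f α (H 1) z = iteratedDeriv 2 E z := by
    intro z hz hz1
    rw [← GG_eq hf hz1]
    apply Filter.EventuallyEq.iteratedDeriv_eq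
    filter_upwards [Metric.isOpen_ball.mem_nhds (hsub hz), isOpen_re.mem_nhds hz1] with w hw1 hw2
    rw [hE3 w hw1 hw2, hF w hw2]
  have hev : (fun z => W z * GG f α (H 1) z) =ᶠ[𝓝 s0] fun z => W z * iteratedDeriv 2 E z := by
    filter_upwards [Metric.ball_mem_nhds s0 (by positivity : 0 < ρ / 2), isOpen_re.mem_nhds h1]
      with w hw1 hw2
    rw [heq w hw1 hw2]
  rw [hev.iteratedDeriv_eq k]
  have hMnn : 0 ≤ M := (norm_nonneg _).trans (hM s0 (Metric.mem_ball_self (by positivity)))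
  have := cauchy_ball (E := fun z => W z * iteratedDeriv 2 E z) (s0 := s0) (ρ := ρ / 2)
    (B := M * (32 * K / r ^ 2 * d ^ (-1 - α.re))) (by positivity)
    ((hW.mono hsub2).mul ((iteratedDeriv_diffOn hE1 2).mono hsub))
    (fun z hz => by
      rw [norm_mul]
      exact mul_le_mul (hM z (hsub2 hz)) (hB2 z hz) (norm_nonneg _) hMnn)
    k (Metric.mem_ball_self (by positivity))
  refine this.trans (le_of_eq ?_)
  rw [hρ, div_eq_mul_inv, ← inv_pow]
  congr 2
  field_simp; norm_num

lemma far_deriv {c C : ℝ} (hc : 0 < c) (hc1 : c ≤ 1) (hC : 1 ≤ C) : ∃ q, 1 ≤ q ∧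
    ∃ K, 1 ≤ K ∧ ∀ H, Good et c C H → ∀ α : ℂ, ‖α‖ ≤ 1 → ∀ f : ℕ → ℂ, (∀ n, ‖f n‖ ≤ 1) →
      (∀ s : ℂ, 1 < s.re → LSeries f s = exp (α * logZetaSeries s) * H s) →
      ∀ s0 : ℂ, 1 < s0.re → s0.re ≤ 2 → 1 ≤ |s0.im| →
      ∀ (W : ℂ → ℂ) (M : ℝ), DifferentiableOn ℂ W (Metric.ball s0 (1 / 2)) →
      (∀ z ∈ Metric.ball s0 (1 / 2), ‖W z‖ ≤ M) → ∀ k : ℕ,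
      ‖iteratedDeriv k (fun z => W z * GG f α (H 1) z) s0‖ ≤
        k.factorial * (M * (K * (s0.re - 1)⁻¹ * tau s0 ^ (3 * et))) * (q * tau s0 ^ et) ^ k := by
  obtain ⟨r, hr, hr1, K, hK, hext⟩ := far_ext hc hc1 hC
  obtain ⟨K2, hK2, hHn⟩ := H_near hc hc1 hC
  set A := 8 * Real.exp (3 * Real.pi) with hA
  have hApos : 0 < A := by positivity
  refine ⟨8 / r, ?_, 32 * K / r ^ 2 + K2 * 2 * A, ?_, ?_⟩
  · rw [le_div_iff₀ hr]; linarith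
  · have : 1 ≤ 32 * K / r ^ 2 := by rw [le_div_iff₀ (by positivity)]; nlinarith
    have : 0 ≤ K2 * 2 * A := by positivity
    linarith
  intro H hH α hα f hf hF s0 h1 h2 h3 W M hW hM k
  obtain ⟨E, hE1, hE2, hE3⟩ := hext H hH α hα s0 h1 h2 h3
  have hH1 : ‖H 1‖ ≤ K2 := by
    have hp : 0 < tau 1 ^ (-et) := Real.rpow_pos_of_pos (tau_pos 1) _
    exact (hHn H hH 1 (by simp; positivity) (by simp)).2.2
  have hd1 : 1 ≤ ‖s0 - 1‖ := by
    have := abs_im_le_norm (s0 - 1)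
    simp only [sub_im, one_im, sub_zero] at this
    linarith
  have htp : 0 < tau s0 ^ (-et) := Real.rpow_pos_of_pos (tau_pos s0) _
  have htp1 := tau_rpow_neg_le_one s0 et_pos.le
  set ρ := r * tau s0 ^ (-et) with hρ
  have hρpos : 0 < ρ := by positivity
  have hρ2 : ρ ≤ 1 / 2 := by nlinarith
  have hsub : Metric.ball s0 (ρ / 2) ⊆ Metric.ball s0 ρ := Metric.ball_subset_ball (by linarith)
  have hsub2 : Metric.ball s0 (ρ / 2) ⊆ Metric.ball s0 (1 / 2) :=
    Metric.ball_subset_ball (by linarith)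
  have hhalf : ∀ z ∈ Metric.ball s0 (ρ / 2), ‖(z - 1) - (s0 - 1)‖ ≤ ‖s0 - 1‖ / 2 := by
    intro z hz
    rw [sub_sub_sub_cancel_right]
    have := hsub2 hz
    rw [Metric.mem_ball, dist_eq_norm] at this
    linarith
  have hslit : ∀ z ∈ Metric.ball s0 (ρ / 2), z - 1 ∈ slitPlane := by
    intro z hzU
    refine slit_near (w := s0 - 1) (by simp; linarith) ((hhalf z hzU).trans_lt ?_)
    linarith
  have hs1 : 1 ≤ (s0.re - 1)⁻¹ := (one_le_inv₀ (by linarith)).2 (by linarith)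
  have ht3 : 1 ≤ tau s0 ^ (3 * et) := one_le_tau_rpow s0 (by have := et_pos; linarith)
  have hbig : 1 ≤ (s0.re - 1)⁻¹ * tau s0 ^ (3 * et) := one_le_mul_of_one_le_of_one_le hs1 ht3
  have hα1 : ‖α * (α + 1)‖ ≤ 2 := by
    rw [norm_mul]
    have : ‖α + 1‖ ≤ 2 := (norm_add_le _ _).trans (by rw [norm_one]; linarith)
    nlinarith [norm_nonneg α, norm_nonneg (α + 1)]
  have hB2 : ∀ z ∈ Metric.ball s0 (ρ / 2),
      ‖iteratedDeriv 2 E z - H 1 * (α * (α + 1)) * (z - 1) ^ (-α - 2)‖ ≤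
      (32 * K / r ^ 2 + K2 * 2 * A) * (s0.re - 1)⁻¹ * tau s0 ^ (3 * et) := by
    intro z hz
    have e1 : ‖iteratedDeriv 2 E z‖ ≤ 32 * K / r ^ 2 * ((s0.re - 1)⁻¹ * tau s0 ^ (3 * et)) := by
      refine (cauchy_ball hρpos hE1 hE2 2 hz).trans (le_of_eq ?_)
      have e3 : tau s0 ^ (3 * et) = tau s0 ^ et * (tau s0 ^ et) ^ 2 := by
        rw [← Real.rpow_natCast, ← Real.rpow_mul (tau_pos s0).le, ← Real.rpow_add (tau_pos s0)]
        congr 1; push_cast; ring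
      have ht : 0 < tau s0 ^ et := Real.rpow_pos_of_pos (tau_pos s0) _
      rw [e3, hρ, Real.rpow_neg (tau_pos s0).le]
      simp only [Nat.factorial]
      field_simp
      norm_num
    have e2 : ‖(z - 1) ^ (-α - 2)‖ ≤ A := by
      have hs0ne : s0 - 1 ≠ 0 := norm_pos_iff.1 (by linarith)
      have hβ : ‖-α - 2‖ ≤ 3 := by
        refine (norm_sub_le _ _).trans ?_
        rw [norm_neg, Complex.norm_ofNat]; linarith
      refine (cpow_bound hs0ne (hhalf z hz) hβ).trans ?_
      have hre : (-α - 2).re ≤ 0 := by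
        have := (abs_le.1 ((abs_re_le_norm α).trans hα)).1
        simp only [sub_re, neg_re, re_ofNat]; linarith
      have := Real.rpow_le_one_of_one_le_of_nonpos hd1 hre
      exact mul_le_of_le_one_right hApos.le this
    have e4 : ‖H 1 * (α * (α + 1)) * (z - 1) ^ (-α - 2)‖ ≤ K2 * 2 * A := by
      rw [norm_mul, norm_mul]
      gcongr
    have e5 : K2 * 2 * A ≤ K2 * 2 * A * ((s0.re - 1)⁻¹ * tau s0 ^ (3 * et)) :=
      le_mul_of_one_le_right (by positivity) hbig
    refine (norm_sub_le _ _).trans ?_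
    calc _ ≤ 32 * K / r ^ 2 * ((s0.re - 1)⁻¹ * tau s0 ^ (3 * et)) +
          K2 * 2 * A * ((s0.re - 1)⁻¹ * tau s0 ^ (3 * et)) := by linarith
      _ = _ := by ring
  have heq : ∀ z ∈ Metric.ball s0 (ρ / 2), 1 < z.re → GG f α (H 1) z =
      iteratedDeriv 2 E z - H 1 * (α * (α + 1)) * (z - 1) ^ (-α - 2) := by
    intro z hz hz1
    rw [GG, ← LS_iter_two hf hz1]
    congr 1
    apply Filter.EventuallyEq.iteratedDeriv_eq
    filter_upwards [Metric.isOpen_ball.mem_nhds (hsub hz), isOpen_re.mem_nhds hz1] with w hw1 hw2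
    rw [hE3 w hw1 hw2, hF w hw2]
  have hev : (fun z => W z * GG f α (H 1) z) =ᶠ[𝓝 s0] fun z => W z *
      (iteratedDeriv 2 E z - H 1 * (α * (α + 1)) * (z - 1) ^ (-α - 2)) := by
    filter_upwards [Metric.ball_mem_nhds s0 (by positivity : 0 < ρ / 2), isOpen_re.mem_nhds h1]
      with w hw1 hw2
    rw [heq w hw1 hw2]
  rw [hev.iteratedDeriv_eq k]
  have hMnn : 0 ≤ M := (norm_nonneg _).trans (hM s0 (Metric.mem_ball_self (by positivity)))
  have := cauchy_ball (E := fun z => W z *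
      (iteratedDeriv 2 E z - H 1 * (α * (α + 1)) * (z - 1) ^ (-α - 2))) (s0 := s0) (ρ := ρ / 2)
    (B := M * ((32 * K / r ^ 2 + K2 * 2 * A) * (s0.re - 1)⁻¹ * tau s0 ^ (3 * et))) (by positivity)
    ((hW.mono hsub2).mul (((iteratedDeriv_diffOn hE1 2).mono hsub).sub
      (fun z hz => ((cpow_sub_deriv (hslit z hz) _).differentiableAt.const_mul
        _).differentiableWithinAt)))
    (fun z hz => by
      rw [norm_mul]
      exact mul_le_mul (hM z (hsub2 hz)) (hB2 z hz) (norm_nonneg _) hMnn)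
    k (Metric.mem_ball_self (by positivity))
  refine this.trans (le_of_eq ?_)
  have ht : 0 < tau s0 ^ et := Real.rpow_pos_of_pos (tau_pos s0) _
  rw [hρ, div_eq_mul_inv, ← inv_pow, Real.rpow_neg (tau_pos s0).le]
  congr 2
  field_simp; norm_num

end CSD

namespace CSD
open Complex Set Filter Topology

/-- Smoothing kernel. -/
noncomputable def ww (δ : ℝ) (s : ℂ) : ℂ :=
  (((1 + δ : ℝ) : ℂ) ^ (s + 1) - 1) / (δ * s * (s + 1))

lemma ww_num_bound {δ : ℝ} (hδ : 0 < δ) (hδ1 : δ ≤ 1) {s : ℂ} (_h1 : 1 / 2 ≤ s.re) (h2 : s.re ≤ 3) :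
    ‖((1 + δ : ℝ) : ℂ) ^ (s + 1) - 1‖ ≤ ‖s + 1‖ * 8 * δ := by
  have hconv : Convex ℝ (Icc (1:ℝ) (1 + δ)) := convex_Icc _ _
  have := hconv.norm_image_sub_le_of_norm_hasDerivWithin_le (f := fun v : ℝ => (v : ℂ) ^ (s + 1))
    (f' := fun v : ℝ => (s + 1) * (v : ℂ) ^ (s + 1 - 1)) (C := ‖s + 1‖ * 8)
    (fun v hv => (hasDerivAt_cpow_real (by linarith [hv.1]) _).hasDerivWithinAt)
    (fun v hv => by
      rw [norm_mul]
      have hv0 : 0 < v := by linarith [hv.1]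
      rw [add_sub_cancel_right, norm_cpow_eq_rpow_re_of_pos hv0]
      gcongr
      calc v ^ s.re ≤ v ^ (3:ℝ) := Real.rpow_le_rpow_of_exponent_le hv.1 h2
        _ ≤ 2 ^ (3:ℝ) := Real.rpow_le_rpow hv0.le (by linarith [hv.2]) (by norm_num)
        _ = 8 := by norm_num)
    (x := 1) (y := 1 + δ) ⟨le_rfl, by linarith⟩ ⟨by linarith, le_rfl⟩
  have e : ‖(1 + δ : ℝ) - 1‖ = δ := by
    rw [add_sub_cancel_left, Real.norm_of_nonneg hδ.le]
  rw [e] at this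
  simpa using this

lemma ww_bound {δ : ℝ} (hδ : 0 < δ) (hδ1 : δ ≤ 1) {s : ℂ} (h1 : 1 / 2 ≤ s.re) (h2 : s.re ≤ 3) :
    ‖ww δ s‖ ≤ 16 := by
  have hn := ww_num_bound hδ hδ1 h1 h2
  have hs : 1 / 2 ≤ ‖s‖ := h1.trans (re_le_norm s)
  have hs1 : 0 < ‖s + 1‖ := by
    have := re_le_norm (s + 1)
    simp only [add_re, one_re] at this
    linarith
  rw [ww, norm_div, norm_mul, norm_mul, norm_real, Real.norm_of_nonneg hδ.le,
    div_le_iff₀ (by positivity)]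
  refine hn.trans ?_
  nlinarith [mul_pos hs1 hδ]

lemma ww_bound_far {δ : ℝ} (hδ : 0 < δ) (hδ1 : δ ≤ 1) {s : ℂ} (_h1 : 1 / 2 ≤ s.re)
    (h2 : s.re ≤ 3) (h3 : 1 / 2 ≤ |s.im|) : ‖ww δ s‖ ≤ 833 / (δ * tau s ^ 2) := by
  have hn : ‖((1 + δ : ℝ) : ℂ) ^ (s + 1) - 1‖ ≤ 17 := by
    refine (norm_sub_le _ _).trans ?_
    rw [norm_cpow_eq_rpow_re_of_pos (by linarith), norm_one]
    have : (1 + δ) ^ (s + 1).re ≤ 16 := by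
      calc (1 + δ) ^ (s + 1).re ≤ (1 + δ) ^ (4:ℝ) :=
            Real.rpow_le_rpow_of_exponent_le (by linarith) (by simp; linarith)
        _ ≤ 2 ^ (4:ℝ) := Real.rpow_le_rpow (by linarith) (by linarith) (by norm_num)
        _ = 16 := by norm_num
    linarith
  have hts : tau s ≤ 7 * |s.im| := by unfold tau; linarith
  have a1 := abs_im_le_norm s
  have a2 := abs_im_le_norm (s + 1)
  simp only [add_im, one_im, add_zero] at a2
  have hτ := tau_pos s
  rw [ww, norm_div, norm_mul, norm_mul, norm_real, Real.norm_of_nonneg hδ.le,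
    div_le_div_iff₀ (by nlinarith [mul_pos hδ (by linarith : 0 < ‖s‖)]) (by positivity)]
  have e1 : tau s ^ 2 ≤ 49 * (‖s‖ * ‖s + 1‖) := by
    calc tau s ^ 2 ≤ (7 * |s.im|) ^ 2 := by gcongr
      _ = 49 * (|s.im| * |s.im|) := by ring
      _ ≤ _ := by gcongr
  calc _ ≤ 17 * (δ * (49 * (‖s‖ * ‖s + 1‖))) := by gcongr
    _ = _ := by ring

lemma ww_diff {δ : ℝ} (hδ : 0 < δ) {s : ℂ} (h1 : 0 < s.re) : DifferentiableAt ℂ (ww δ) s := by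
  have hs : s ≠ 0 := by rintro rfl; simp at h1
  have hs1 : s + 1 ≠ 0 := by
    intro h; have := congrArg re h; simp at this; linarith
  have hb : ((1 + δ : ℝ) : ℂ) ≠ 0 := by
    have : (1 + δ : ℝ) ≠ 0 := by linarith
    exact_mod_cast this
  have hden : (δ : ℂ) * s * (s + 1) ≠ 0 := by
    have : (δ : ℂ) ≠ 0 := by exact_mod_cast hδ.ne'
    positivity
  unfold ww
  refine DifferentiableAt.div ?_ (by fun_prop) hden
  exact ((differentiableAt_id.add_const 1).const_cpow (Or.inl hb)).sub_const 1

/-- Point on the line of integration. -/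
noncomputable def lin (σ ξ : ℝ) : ℂ := σ + 2 * Real.pi * ξ * I

lemma lin_re (σ ξ : ℝ) : (lin σ ξ).re = σ := by simp [lin]
lemma lin_im (σ ξ : ℝ) : (lin σ ξ).im = 2 * Real.pi * ξ := by simp [lin]

lemma lin_deriv (σ ξ : ℝ) : HasDerivAt (lin σ) (2 * Real.pi * I) ξ := by
  have h : HasDerivAt (fun ξ : ℝ => (ξ : ℂ)) 1 ξ := hasDerivAt_id ξ |>.ofReal_comp
  have := ((h.const_mul (2 * Real.pi : ℂ)).mul_const I).const_add (σ : ℂ)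
  exact this.congr_deriv (by ring)

lemma line_hasDeriv {Φ : ℂ → ℂ} (hΦ : AnalyticOnNhd ℂ Φ {s : ℂ | 1 < s.re}) {σ : ℝ} (hσ : 1 < σ)
    (ξ : ℝ) : HasDerivAt (fun ξ : ℝ => Φ (lin σ ξ))
      (2 * Real.pi * I * deriv Φ (lin σ ξ)) ξ := by
  have h1 := (hΦ (lin σ ξ) (by simpa [lin_re] using hσ)).differentiableAt.hasDerivAt
  have := h1.comp ξ (lin_deriv σ ξ)
  rw [mul_comm]; exact this

lemma iter_analytic {Φ : ℂ → ℂ} (hΦ : AnalyticOnNhd ℂ Φ {s : ℂ | 1 < s.re}) (k : ℕ) :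
    AnalyticOnNhd ℂ (iteratedDeriv k Φ) {s : ℂ | 1 < s.re} := by
  rw [iteratedDeriv_eq_iterate]; exact hΦ.iterated_deriv k

lemma line_iter {Φ : ℂ → ℂ} (hΦ : AnalyticOnNhd ℂ Φ {s : ℂ | 1 < s.re}) {σ : ℝ} (hσ : 1 < σ)
    (k : ℕ) : iteratedDeriv k (fun ξ : ℝ => Φ (lin σ ξ)) =
      fun ξ : ℝ => (2 * Real.pi * I) ^ k * iteratedDeriv k Φ (lin σ ξ) := by
  induction k with
  | zero => ext ξ; simp
  | succ k ih =>
    ext ξ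
    rw [iteratedDeriv_succ, ih]
    rw [((line_hasDeriv (iter_analytic hΦ k) hσ ξ).const_mul _).deriv, iteratedDeriv_succ]
    ring

lemma line_contDiff {Φ : ℂ → ℂ} (hΦ : AnalyticOnNhd ℂ Φ {s : ℂ | 1 < s.re}) {σ : ℝ} (hσ : 1 < σ)
    (n : ℕ) : ContDiff ℝ n (fun ξ : ℝ => Φ (lin σ ξ)) := by
  apply contDiff_of_differentiable_iteratedDeriv
  intro m _
  rw [line_iter hΦ hσ]
  intro ξ
  exact ((line_hasDeriv (iter_analytic hΦ m) hσ ξ).const_mul _).differentiableAt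

lemma GG_analytic {f : ℕ → ℂ} (hf : ∀ n, ‖f n‖ ≤ 1) (α h : ℂ) :
    AnalyticOnNhd ℂ (GG f α h) {s : ℂ | 1 < s.re} := by
  have hd : DifferentiableOn ℂ (fun w : ℂ => (w - 1) ^ (-α - 2)) {w : ℂ | 1 < w.re} := fun w hw =>
    (cpow_sub_deriv (slit_of_re hw) _).differentiableAt.differentiableWithinAt
  have h2 := hd.analyticOnNhd isOpen_re
  intro s hs
  have h1 : AnalyticAt ℂ (LSeries (LSeries.logMul^[2] f)) s := by
    refine LSeries_analyticOnNhd _ s ?_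
    show LSeries.abscissaOfAbsConv _ < _
    rw [LSeries.absicssaOfAbsConv_logPowMul]
    exact absc_lt hf hs
  exact h1.sub ((analyticAt_const).mul (h2 s hs))

lemma Phi_analytic {f : ℕ → ℂ} (hf : ∀ n, ‖f n‖ ≤ 1) (α h : ℂ) {δ : ℝ} (hδ : 0 < δ) :
    AnalyticOnNhd ℂ (fun s => ww δ s * GG f α h s) {s : ℂ | 1 < s.re} := by
  have hd : DifferentiableOn ℂ (ww δ) {w : ℂ | 1 < w.re} := fun w hw =>
    (ww_diff hδ (by have : 1 < w.re := hw; linarith)).differentiableWithinAt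
  exact (hd.analyticOnNhd isOpen_re).mul (GG_analytic hf α h)

/-- Everything known about the problem data, packaged. -/
structure Dat (c C : ℝ) (f : ℕ → ℂ) (α : ℂ) (H : ℂ → ℂ) : Prop where
  good : Good et c C H
  hα : ‖α‖ ≤ 1
  hf : ∀ n, ‖f n‖ ≤ 1
  hF : ∀ s : ℂ, 1 < s.re → LSeries f s = exp (α * logZetaSeries s) * H s

lemma near_line {c C : ℝ} (hc : 0 < c) (hc1 : c ≤ 1) (hC : 1 ≤ C) (k : ℕ) : ∃ K, 1 ≤ K ∧
    ∀ f α H, Dat c C f α H → ∀ δ : ℝ, 0 < δ → δ ≤ 1 → ∀ s0 : ℂ, 1 < s0.re → s0.re ≤ 2 →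
      |s0.im| ≤ 1 → ‖iteratedDeriv k (fun z => ww δ z * GG f α (H 1) z) s0‖ ≤
        K * ‖s0 - 1‖ ^ (-1 - α.re - k) := by
  obtain ⟨q, hq, K, hK, h⟩ := near_deriv hc hc1 hC
  have hq' : 1 ≤ q ^ k := one_le_pow₀ hq
  have hk : (1:ℝ) ≤ k.factorial := by exact_mod_cast k.factorial_pos
  refine ⟨k.factorial * (16 * K) * q ^ k, ?_, ?_⟩
  · have : 1 ≤ k.factorial * (16 * K) := by nlinarith
    nlinarith
  intro f α H hD δ hδ hδ1 s0 h1 h2 h3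
  have hs0ne : s0 - 1 ≠ 0 := by
    intro h; rw [sub_eq_zero] at h; rw [h] at h1; simp at h1
  have hdpos : 0 < ‖s0 - 1‖ := norm_pos_iff.2 hs0ne
  have hd2 : ‖s0 - 1‖ ≤ 2 := by
    have := norm_le_abs_re_add_abs_im (s0 - 1)
    simp only [sub_re, one_re, sub_im, one_im, sub_zero] at this
    rw [abs_of_pos (by linarith)] at this
    linarith
  have hb : ∀ z ∈ Metric.ball s0 (‖s0 - 1‖ / 32), 1 / 2 ≤ z.re ∧ z.re ≤ 3 := by
    intro z hz
    rw [Metric.mem_ball, dist_eq_norm] at hz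
    have b1 := abs_le.1 (abs_re_le_norm (z - s0))
    simp only [sub_re] at b1
    constructor <;> linarith [b1.1, b1.2]
  have := h H hD.good α hD.hα f hD.hf hD.hF s0 h1 h2 h3 (ww δ) 16
    (fun z hz => (ww_diff hδ (by linarith [(hb z hz).1])).differentiableWithinAt)
    (fun z hz => ww_bound hδ hδ1 (hb z hz).1 (hb z hz).2) k
  refine this.trans (le_of_eq ?_)
  rw [Real.rpow_sub hdpos _ (k:ℝ), Real.rpow_natCast, div_pow]
  ring

lemma far_line {c C : ℝ} (hc : 0 < c) (hc1 : c ≤ 1) (hC : 1 ≤ C) (k : ℕ) : ∃ K, 1 ≤ K ∧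
    ∀ f α H, Dat c C f α H → ∀ δ : ℝ, 0 < δ → δ ≤ 1 → ∀ s0 : ℂ, 1 < s0.re → s0.re ≤ 2 →
      1 ≤ |s0.im| → ‖iteratedDeriv k (fun z => ww δ z * GG f α (H 1) z) s0‖ ≤
        K * δ⁻¹ * (s0.re - 1)⁻¹ * tau s0 ^ ((3 + k) * et - 2) := by
  obtain ⟨q, hq, K, hK, h⟩ := far_deriv hc hc1 hC
  have hq' : 1 ≤ q ^ k := one_le_pow₀ hq
  have hk : (1:ℝ) ≤ k.factorial := by exact_mod_cast k.factorial_pos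
  refine ⟨k.factorial * (3332 * K) * q ^ k, ?_, ?_⟩
  · have : 1 ≤ k.factorial * (3332 * K) := by nlinarith
    nlinarith
  intro f α H hD δ hδ hδ1 s0 h1 h2 h3
  have hb : ∀ z ∈ Metric.ball s0 (1 / 2), 1 / 2 ≤ z.re ∧ z.re ≤ 3 ∧ 1 / 2 ≤ |z.im| ∧
      tau s0 ≤ 2 * tau z := by
    intro z hz
    rw [Metric.mem_ball, dist_eq_norm] at hz
    have b1 := abs_le.1 (abs_re_le_norm (z - s0))
    have b2 := abs_im_le_norm (s0 - z)
    rw [norm_sub_rev] at b2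
    simp only [sub_re] at b1
    simp only [sub_im] at b2
    have b3 := abs_sub_abs_le_abs_sub s0.im z.im
    refine ⟨by linarith [b1.1], by linarith [b1.2], by linarith, tau_le ?_⟩
    rw [norm_sub_rev]; linarith
  have hτ := tau_pos s0
  have := h H hD.good α hD.hα f hD.hf hD.hF s0 h1 h2 h3 (ww δ) (3332 / (δ * tau s0 ^ 2))
    (fun z hz => (ww_diff hδ (by linarith [(hb z hz).1])).differentiableWithinAt)
    (fun z hz => by
      obtain ⟨a1, a2, a3, a4⟩ := hb z hz
      refine (ww_bound_far hδ hδ1 a1 a2 a3).trans ?_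
      have hτz := tau_pos z
      rw [div_le_div_iff₀ (by positivity) (by positivity)]
      have : tau s0 ^ 2 ≤ (2 * tau z) ^ 2 := by gcongr
      calc 833 * (δ * tau s0 ^ 2) ≤ 833 * (δ * (2 * tau z) ^ 2) := by gcongr
        _ = _ := by ring) k
  refine this.trans (le_of_eq ?_)
  have e : tau s0 ^ ((3 + k) * et - 2) = tau s0 ^ (3 * et) * (tau s0 ^ et) ^ k / tau s0 ^ 2 := by
    rw [← Real.rpow_natCast (tau s0 ^ et), ← Real.rpow_mul hτ.le, ← Real.rpow_add hτ,
      ← Real.rpow_natCast (tau s0) 2, ← Real.rpow_sub hτ]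
    congr 1; push_cast; ring
  rw [e, mul_pow]
  field_simp

end CSD

namespace CSD
open Complex Set Filter Topology MeasureTheory
open scoped FourierTransform

lemma lin_sub_one_norm {ε ξ : ℝ} :
    ‖lin (1 + ε) ξ - 1‖ ^ 2 = ε ^ 2 + (2 * Real.pi * ξ) ^ 2 := by
  rw [← normSq_eq_norm_sq, normSq_apply]
  simp only [sub_re, lin_re, one_re, sub_im, lin_im, one_im]
  ring

lemma integrable_g {c C : ℝ} (hc : 0 < c) (hc1 : c ≤ 1) (hC : 1 ≤ C) {f : ℕ → ℂ} {α : ℂ}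
    {H : ℂ → ℂ} (hD : Dat c C f α H) {δ : ℝ} (hδ : 0 < δ) (hδ1 : δ ≤ 1) {σ : ℝ} (hσ : 1 < σ)
    (hσ2 : σ ≤ 2) {k : ℕ} (hk : k ≤ 5) :
    Integrable (iteratedDeriv k (fun ξ : ℝ => ww δ (lin σ ξ) * GG f α (H 1) (lin σ ξ))) := by
  obtain ⟨K, hK, hfar⟩ := far_line hc hc1 hC k
  have hΦ := Phi_analytic hD.hf α (H 1) hδ
  have hcd := line_contDiff hΦ hσ k
  have hcont : Continuous (iteratedDeriv k
      (fun ξ : ℝ => ww δ (lin σ ξ) * GG f α (H 1) (lin σ ξ))) :=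
    hcd.continuous_iteratedDeriv k le_rfl
  obtain ⟨M, hM⟩ := (isCompact_Icc (a := (-1:ℝ)) (b := 1)).exists_bound_of_continuousOn
    hcont.continuousOn
  have hMnn : 0 ≤ M := (norm_nonneg _).trans (hM 0 (by simp))
  set A := (2 * Real.pi) ^ k * (K * δ⁻¹ * (σ - 1)⁻¹) with hA
  have hσ' : 0 < σ - 1 := by linarith
  have hApos : 0 ≤ A := by positivity
  have hmaj : Integrable (fun ξ : ℝ => (4 * M + A) * (1 + ‖ξ‖) ^ (-(3 / 2 : ℝ))) :=
    (integrable_one_add_norm (by simp; norm_num)).const_mul _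
  refine hmaj.mono' hcont.aestronglyMeasurable (Filter.Eventually.of_forall fun ξ => ?_)
  have hp : 0 < (1 + ‖ξ‖) ^ (-(3 / 2 : ℝ)) := by positivity
  rcases le_or_gt |ξ| 1 with h | h
  · have h1 := hM ξ (abs_le.1 h)
    have h2 : 1 / 4 ≤ (1 + ‖ξ‖) ^ (-(3 / 2 : ℝ)) := by
      rw [Real.norm_eq_abs, Real.rpow_neg (by positivity), ← one_div]
      apply one_div_le_one_div_of_le (by positivity)
      calc (1 + |ξ|) ^ (3 / 2 : ℝ) ≤ 2 ^ (3 / 2 : ℝ) := by gcongr; linarith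
        _ ≤ 2 ^ (2:ℝ) := Real.rpow_le_rpow_of_exponent_le (by norm_num) (by norm_num)
        _ = 4 := by norm_num
    nlinarith
  · have hpi := Real.pi_gt_three
    have him : |(lin σ ξ).im| = 2 * Real.pi * |ξ| := by
      rw [lin_im, abs_mul, abs_of_pos (by positivity)]
    have h1 := hfar f α H hD δ hδ hδ1 (lin σ ξ) (by rwa [lin_re]) (by rwa [lin_re])
      (by rw [him]; nlinarith)
    rw [line_iter hΦ hσ, norm_mul, norm_pow]
    have e1 : ‖(2 * Real.pi * I : ℂ)‖ = 2 * Real.pi := by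
      simp [abs_of_pos Real.pi_pos]
    rw [e1]
    have e2 : tau (lin σ ξ) ^ ((3 + k) * et - 2) ≤ (1 + ‖ξ‖) ^ (-(3 / 2 : ℝ)) := by
      have hτ : 1 + |ξ| ≤ tau (lin σ ξ) := by unfold tau; rw [him]; nlinarith
      have hk' : (k:ℝ) ≤ 5 := by exact_mod_cast hk
      calc _ ≤ tau (lin σ ξ) ^ (-(3 / 2 : ℝ)) :=
            Real.rpow_le_rpow_of_exponent_le (by linarith [tau_ge (lin σ ξ)])
              (by unfold et; linarith)
        _ ≤ _ := Real.rpow_le_rpow_of_nonpos (by positivity) hτ (by norm_num)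
    rw [lin_re] at h1
    calc _ ≤ (2 * Real.pi) ^ k * (K * δ⁻¹ * (σ - 1)⁻¹ * (1 + ‖ξ‖) ^ (-(3 / 2 : ℝ))) := by
          gcongr; exact h1.trans (by gcongr)
      _ = A * (1 + ‖ξ‖) ^ (-(3 / 2 : ℝ)) := by rw [hA]; ring
      _ ≤ _ := by gcongr; linarith

lemma fourier_g {c C : ℝ} (hc : 0 < c) (hc1 : c ≤ 1) (hC : 1 ≤ C) : ∃ K, 1 ≤ K ∧
    ∀ f α H, Dat c C f α H → ∀ L : ℝ, 1 ≤ L →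
      ‖𝓕 (fun ξ : ℝ => ww (L ^ 3)⁻¹ (lin (1 + L⁻¹) ξ) * GG f α (H 1) (lin (1 + L⁻¹) ξ)) (-L)‖ ≤
        K * L ^ α.re := by
  obtain ⟨K1, hK1, hnear⟩ := near_line hc hc1 hC 5
  obtain ⟨K2, hK2, hfar⟩ := far_line hc hc1 hC 5
  set J := ∫ ξ : ℝ, (1 + ‖ξ‖) ^ (-(3 / 2 : ℝ)) with hJ
  have hJi : Integrable (fun ξ : ℝ => (1 + ‖ξ‖) ^ (-(3 / 2 : ℝ))) :=
    integrable_one_add_norm (by simp; norm_num)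
  have hJnn : 0 ≤ J := integral_nonneg fun ξ => by positivity
  refine ⟨K1 + K2 * J, by nlinarith, ?_⟩
  intro f α H hD L hL
  have hLp : 0 < L := by linarith
  have hαre := abs_le.1 ((abs_re_le_norm α).trans hD.hα)
  set ε := L⁻¹ with hε
  set δ := (L ^ 3)⁻¹ with hδd
  have hεp : 0 < ε := by positivity
  have hε1 : ε ≤ 1 := inv_le_one_of_one_le₀ hL
  have hδ : 0 < δ := by positivity
  have hδ1 : δ ≤ 1 := inv_le_one_of_one_le₀ (one_le_pow₀ hL)
  have hσ : 1 < 1 + ε := by linarith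
  have hσ2 : 1 + ε ≤ 2 := by linarith
  have hΦ := Phi_analytic hD.hf α (H 1) hδ
  set g := fun ξ : ℝ => ww δ (lin (1 + ε) ξ) * GG f α (H 1) (lin (1 + ε) ξ) with hg
  have hpi := Real.pi_gt_three
  set q := 2 * Real.pi * L with hq
  have hqp : 0 < q := by positivity
  -- pointwise bound
  have hpt : ∀ ξ : ℝ, ‖iteratedDeriv 5 g ξ‖ ≤ (2 * Real.pi) ^ 5 *
      (K1 * L ^ (4 + α.re) * L ^ 2 * (1 + (q * ξ) ^ 2)⁻¹ +
        K2 * L ^ 4 * (1 + ‖ξ‖) ^ (-(3 / 2 : ℝ))) := by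
    intro ξ
    have him : |(lin (1 + ε) ξ).im| = 2 * Real.pi * |ξ| := by
      rw [lin_im, abs_mul, abs_of_pos (by positivity)]
    have e1 : ‖(2 * Real.pi * I : ℂ)‖ = 2 * Real.pi := by
      simp [abs_of_pos Real.pi_pos]
    have : iteratedDeriv 5 g ξ = (2 * Real.pi * I) ^ 5 *
        iteratedDeriv 5 (fun z => ww δ z * GG f α (H 1) z) (lin (1 + ε) ξ) := by
      rw [hg, line_iter hΦ hσ]
    rw [this, norm_mul, norm_pow, e1]
    apply mul_le_mul_of_nonneg_left _ (by positivity)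
    have t1 : 0 ≤ K1 * L ^ (4 + α.re) * L ^ 2 * (1 + (q * ξ) ^ 2)⁻¹ := by positivity
    have t2 : 0 ≤ K2 * L ^ 4 * (1 + ‖ξ‖) ^ (-(3 / 2 : ℝ)) := by positivity
    rcases le_total |(lin (1 + ε) ξ).im| 1 with h | h
    · have h1 := hnear f α H hD δ hδ hδ1 (lin (1 + ε) ξ) (by rwa [lin_re]) (by rwa [lin_re]) h
      set d := ‖lin (1 + ε) ξ - 1‖ with hd
      have hd2 : d ^ 2 = ε ^ 2 + (2 * Real.pi * ξ) ^ 2 := lin_sub_one_norm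
      have hdε : ε ≤ d := by
        have : ε ^ 2 ≤ d ^ 2 := by rw [hd2]; nlinarith [sq_nonneg (2 * Real.pi * ξ)]
        exact (pow_le_pow_iff_left₀ hεp.le (norm_nonneg _) (by norm_num)).1 this
      have hdp : 0 < d := hεp.trans_le hdε
      have e3 : d ^ (-1 - α.re - ((5:ℕ):ℝ)) = d ^ (-(4 + α.re)) * (d ^ 2)⁻¹ := by
        rw [← Real.rpow_natCast d 2, ← Real.rpow_neg hdp.le, ← Real.rpow_add hdp]
        congr 1; push_cast; ring
      have e4 : d ^ (-(4 + α.re)) ≤ L ^ (4 + α.re) := by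
        calc d ^ (-(4 + α.re)) ≤ ε ^ (-(4 + α.re)) :=
              Real.rpow_le_rpow_of_nonpos hεp hdε (by linarith [hαre.1])
          _ = L ^ (4 + α.re) := by
              rw [hε, Real.inv_rpow hLp.le, Real.rpow_neg hLp.le, inv_inv]
      have e5 : (d ^ 2)⁻¹ = L ^ 2 * (1 + (q * ξ) ^ 2)⁻¹ := by
        rw [hd2, hε, hq]
        have : (L⁻¹) ^ 2 + (2 * Real.pi * ξ) ^ 2 = (L ^ 2)⁻¹ * (1 + (2 * Real.pi * L * ξ) ^ 2) := by
          field_simp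
        rw [this, mul_inv, inv_inv]
      rw [e3, e5] at h1
      calc _ ≤ K1 * (L ^ (4 + α.re) * (L ^ 2 * (1 + (q * ξ) ^ 2)⁻¹)) := h1.trans (by gcongr)
        _ = K1 * L ^ (4 + α.re) * L ^ 2 * (1 + (q * ξ) ^ 2)⁻¹ := by ring
        _ ≤ _ := by linarith
    · have h1 := hfar f α H hD δ hδ hδ1 (lin (1 + ε) ξ) (by rwa [lin_re]) (by rwa [lin_re]) h
      have e2 : tau (lin (1 + ε) ξ) ^ ((3 + ((5:ℕ):ℝ)) * et - 2) ≤ (1 + ‖ξ‖) ^ (-(3 / 2 : ℝ)) := by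
        have hτ : 1 + |ξ| ≤ tau (lin (1 + ε) ξ) := by
          unfold tau; rw [him]; nlinarith [abs_nonneg ξ]
        calc _ ≤ tau (lin (1 + ε) ξ) ^ (-(3 / 2 : ℝ)) :=
              Real.rpow_le_rpow_of_exponent_le (by linarith [tau_ge (lin (1 + ε) ξ)])
                (by unfold et; norm_num)
          _ ≤ _ := Real.rpow_le_rpow_of_nonpos (by positivity) hτ (by norm_num)
      rw [lin_re] at h1
      have e6 : K2 * δ⁻¹ * (1 + ε - 1)⁻¹ = K2 * L ^ 4 := by
        rw [add_sub_cancel_left, hδd, hε, inv_inv, inv_inv]; ring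
      rw [e6] at h1
      calc _ ≤ K2 * L ^ 4 * (1 + ‖ξ‖) ^ (-(3 / 2 : ℝ)) := h1.trans (by gcongr)
        _ ≤ _ := by linarith
  have hI1 : Integrable (fun ξ : ℝ => (1 + (q * ξ) ^ 2)⁻¹) :=
    integrable_inv_one_add_sq.comp_mul_left' hqp.ne'
  have hI1v : ∫ ξ : ℝ, (1 + (q * ξ) ^ 2)⁻¹ = q⁻¹ * Real.pi := by
    have := Measure.integral_comp_mul_left (fun x : ℝ => (1 + x ^ 2)⁻¹) q
    rw [this, integral_univ_inv_one_add_sq, abs_of_pos (by positivity), smul_eq_mul]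
  have hinteg : ∫ ξ, ‖iteratedDeriv 5 g ξ‖ ≤ (2 * Real.pi) ^ 5 *
      (K1 * L ^ (4 + α.re) * L ^ 2 * (q⁻¹ * Real.pi) + K2 * L ^ 4 * J) := by
    rw [← hI1v, hJ, ← integral_const_mul, ← integral_const_mul, ← integral_add
      (hI1.const_mul _) (hJi.const_mul _), ← integral_const_mul]
    exact integral_mono (integrable_g hc hc1 hC hD hδ hδ1 hσ hσ2 le_rfl).norm
      (((hI1.const_mul _).add (hJi.const_mul _)).const_mul _) hpt
  have hF := congrFun (Real.fourier_iteratedDeriv (f := g) (N := 5) (n := 5)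
    (line_contDiff hΦ hσ 5)
    (fun n hn => integrable_g hc hc1 hC hD hδ hδ1 hσ hσ2 (by exact_mod_cast hn)) le_rfl) (-L)
  have hn1 : ‖𝓕 (iteratedDeriv 5 g) (-L)‖ ≤ ∫ ξ, ‖iteratedDeriv 5 g ξ‖ := by
    rw [Real.fourier_eq]
    refine (norm_integral_le_integral_norm _).trans (le_of_eq ?_)
    congr 1; ext ξ; simp
  have hn2 : ‖𝓕 (iteratedDeriv 5 g) (-L)‖ = q ^ 5 * ‖𝓕 g (-L)‖ := by
    rw [hF, norm_smul, norm_pow]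
    congr 2
    rw [hq]; simp [abs_of_pos Real.pi_pos, abs_of_pos hLp]
  have hfin : q ^ 5 * ‖𝓕 g (-L)‖ ≤ q ^ 5 * ((K1 + K2 * J) * L ^ α.re) := by
    rw [← hn2]
    refine (hn1.trans hinteg).trans ?_
    have e7 : L ^ (4 + α.re) = L ^ 4 * L ^ α.re := by
      rw [Real.rpow_add hLp]; congr 1; norm_cast
    have e8 : 1 ≤ L * L ^ α.re := by
      have : L * L ^ α.re = L ^ (1 + α.re) := by rw [Real.rpow_add hLp, Real.rpow_one]
      rw [this]; exact Real.one_le_rpow hL (by linarith [hαre.1])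
    have hLa : 0 < L ^ α.re := by positivity
    have e9 : L ^ 2 * (q⁻¹ * Real.pi) = L / 2 := by rw [hq]; field_simp
    rw [e7, mul_assoc (K1 * _), e9, hq, mul_pow (2 * Real.pi) L, mul_assoc ((2 * Real.pi) ^ 5)]
    apply mul_le_mul_of_nonneg_left _ (by positivity)
    have e10 : K2 * L ^ 4 * J ≤ K2 * J * (L ^ 5 * L ^ α.re) := by
      have : K2 * J * L ^ 4 * 1 ≤ K2 * J * L ^ 4 * (L * L ^ α.re) := by gcongr
      nlinarith
    have e11 : 0 ≤ K1 * (L ^ 5 * L ^ α.re) := by positivity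
    nlinarith
  exact le_of_mul_le_mul_left hfin (by positivity)

end CSD

namespace CSD
open Complex Set Filter Topology MeasureTheory
open scoped FourierTransform

lemma lin_cont (σ : ℝ) : Continuous (lin σ) := by unfold lin; fun_prop

lemma kern_ne {σ : ℝ} (hσ : 1 < σ) (ξ : ℝ) : lin σ ξ ≠ 0 ∧ lin σ ξ + 1 ≠ 0 := by
  constructor
  · intro h; have := congrArg re h; simp [lin_re] at this; linarith
  · intro h; have := congrArg re h; simp [lin_re] at this; linarith

lemma kern_int {σ : ℝ} (hσ : 1 < σ) : Integrable (fun ξ : ℝ => (lin σ ξ * (lin σ ξ + 1))⁻¹) := by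
  have h0 : Integrable (fun ξ : ℝ => (1 + (2 * Real.pi * ξ) ^ 2)⁻¹) :=
    integrable_inv_one_add_sq.comp_mul_left' (by positivity)
  refine h0.mono' ?_ (Eventually.of_forall fun ξ => ?_)
  · refine Continuous.aestronglyMeasurable ?_
    have := lin_cont σ
    exact Continuous.inv₀ (by fun_prop) fun ξ => mul_ne_zero (kern_ne hσ ξ).1 (kern_ne hσ ξ).2
  · rw [norm_inv, norm_mul]
    have h1 : 1 + (2 * Real.pi * ξ) ^ 2 ≤ ‖lin σ ξ‖ ^ 2 := by
      rw [← normSq_eq_norm_sq, normSq_apply, lin_re, lin_im]; nlinarith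
    have h2 : ‖lin σ ξ‖ ^ 2 ≤ ‖lin σ ξ + 1‖ ^ 2 := by
      rw [← normSq_eq_norm_sq, normSq_apply, ← normSq_eq_norm_sq, normSq_apply]
      simp only [add_re, add_im, one_re, one_im, lin_re, lin_im]; nlinarith
    have h3 : ‖lin σ ξ‖ ≤ ‖lin σ ξ + 1‖ := by
      exact (pow_le_pow_iff_left₀ (norm_nonneg _) (norm_nonneg _) two_ne_zero).1 h2
    refine inv_anti₀ (by positivity) (h1.trans ?_)
    nlinarith [norm_nonneg (lin σ ξ)]

lemma kern_base {σ : ℝ} (hσ : 1 < σ) (v : ℝ) :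
    ∫ ξ : ℝ, exp (v * lin σ ξ) * (lin σ ξ * (lin σ ξ + 1))⁻¹ = ((max 0 (1 - Real.exp (-v)) : ℝ) : ℂ) := by
  set φ : ℝ → ℂ := fun v => ((Real.exp (-σ * v) * max 0 (1 - Real.exp (-v)) : ℝ) : ℂ) with hφ
  have hcont : Continuous φ := by rw [hφ]; fun_prop
  have hz : ∀ v, v ∉ Ioi (0:ℝ) → φ v = 0 := by
    intro v hv
    simp only [mem_Ioi, not_lt] at hv
    have : 1 ≤ Real.exp (-v) := Real.one_le_exp (by linarith)
    simp only [hφ, max_eq_left (by linarith : 1 - Real.exp (-v) ≤ 0)]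
    simp
  have hp : ∀ v, v ∈ Ioi (0:ℝ) → ∀ w : ℂ,  exp (w * v) * φ v = exp ((w - σ) * v) - exp ((w - σ - 1) * v) := by
    intro v hv w
    have hv' : 0 < v := hv
    have : Real.exp (-v) ≤ 1 := Real.exp_le_one_iff.2 (by linarith)
    simp only [hφ, max_eq_right (by linarith : 0 ≤ 1 - Real.exp (-v))]
    push_cast
    rw [mul_sub, mul_one, mul_sub, ← Complex.exp_add, ← Complex.exp_add, ← Complex.exp_add]
    congr 2 <;> ring
  have hinteg : Integrable φ := by
    rw [← integrableOn_iff_integrable_of_support_subset (s := Ioi 0)]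
    · have h1 := integrableOn_exp_mul_complex_Ioi (a := 0 - σ) (by simp; linarith) 0
      have h2 := integrableOn_exp_mul_complex_Ioi (a := 0 - σ - 1) (by simp; linarith) 0
      refine (h1.sub h2).congr_fun ?_ measurableSet_Ioi
      intro v hv
      have := hp v hv 0
      simp only [zero_mul, Complex.exp_zero, one_mul] at this
      exact this.symm
    · intro v hv
      by_contra h
      exact hv (hz v h)
  have hF : 𝓕 φ = fun ξ => (lin σ ξ * (lin σ ξ + 1))⁻¹ := by
    ext ξ
    rw [Real.fourier_eq']
    rw [← setIntegral_eq_integral_of_forall_compl_eq_zero (s := Ioi 0) (fun v hv => by rw [hz v hv, smul_zero])]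
    have e : ∀ v ∈ Ioi (0:ℝ), exp (↑(-2 * Real.pi * inner ℝ v ξ) * I) • φ v =
        exp (-lin σ ξ * v) - exp (-(lin σ ξ + 1) * v) := by
      intro v hv
      have := hp v hv (-2 * Real.pi * ξ * I)
      rw [smul_eq_mul]
      convert this using 2
      · congr 1
        simp; ring
      · congr 1; simp only [lin]; ring
      · congr 1; simp only [lin]; ring
    rw [setIntegral_congr_fun measurableSet_Ioi e, integral_sub, integral_exp_mul_complex_Ioi,
      integral_exp_mul_complex_Ioi]
    · have := kern_ne hσ ξ
      simp only [ofReal_zero, mul_zero, Complex.exp_zero]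
      field_simp [this.1, this.2]
      ring
    · simp [lin_re]; linarith
    · simp [lin_re]; linarith
    · exact integrableOn_exp_mul_complex_Ioi (by simp [lin_re]; linarith) 0
    · exact integrableOn_exp_mul_complex_Ioi (by simp [lin_re]; linarith) 0
  have key := MeasureTheory.Integrable.fourierInv_fourier_eq hinteg (by rw [hF]; exact kern_int hσ)
    (hcont.continuousAt (x := v))
  rw [hF, Real.fourierInv_eq'] at key
  have e2 : ∀ ξ : ℝ, exp (v * lin σ ξ) * (lin σ ξ * (lin σ ξ + 1))⁻¹ =
      exp (σ * v) * (exp (↑(2 * Real.pi * inner ℝ ξ v) * I) • (lin σ ξ * (lin σ ξ + 1))⁻¹) := by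
    intro ξ
    rw [smul_eq_mul, ← mul_assoc, ← Complex.exp_add]
    congr 2
    simp [lin]; ring
  simp_rw [e2]
  rw [integral_const_mul, key, hφ]
  simp only
  push_cast
  rw [← mul_assoc, ← Complex.exp_add]
  simp

/-- Trapezoidal cutoff. -/
noncomputable def tz (δ y : ℝ) : ℝ := (max 0 (1 + δ - y) - max 0 (1 - y)) / δ

lemma tz_cont (δ : ℝ) : Continuous (tz δ) := by unfold tz; fun_prop

lemma tz_nonneg {δ : ℝ} (hδ : 0 < δ) (y : ℝ) : 0 ≤ tz δ y := by
  unfold tz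
  apply div_nonneg _ hδ.le
  have : max 0 (1 - y) ≤ max 0 (1 + δ - y) := max_le_max le_rfl (by linarith)
  linarith

lemma tz_le_one {δ : ℝ} (hδ : 0 < δ) (y : ℝ) : tz δ y ≤ 1 := by
  unfold tz
  rw [div_le_one hδ]
  have : max 0 (1 + δ - y) ≤ max 0 (1 - y) + δ :=
    max_le (by positivity) (by linarith [le_max_right 0 (1 - y)])
  linarith

lemma tz_eq_one {δ : ℝ} (hδ : 0 < δ) {y : ℝ} (hy : y ≤ 1) : tz δ y = 1 := by
  unfold tz
  rw [max_eq_right (by linarith), max_eq_right (by linarith)]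
  field_simp; ring

lemma tz_eq_zero {δ : ℝ} (hδ : 0 < δ) {y : ℝ} (hy : 1 + δ ≤ y) : tz δ y = 0 := by
  unfold tz
  rw [max_eq_left (by linarith), max_eq_left (by linarith)]
  simp

lemma exp_lin_norm (σ v ξ : ℝ) : ‖exp (v * lin σ ξ)‖ = Real.exp (v * σ) := by
  rw [Complex.norm_exp]; simp [lin_re]

lemma exp_lin_int {σ : ℝ} (hσ : 1 < σ) (v : ℝ) :
    Integrable fun ξ : ℝ => exp (v * lin σ ξ) * (lin σ ξ * (lin σ ξ + 1))⁻¹ := by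
  refine (kern_int hσ).bdd_mul (c := Real.exp (v * σ)) ?_ ?_
  · have := lin_cont σ
    exact Continuous.aestronglyMeasurable (by fun_prop)
  · exact Eventually.of_forall fun ξ => (exp_lin_norm σ v ξ).le

lemma ww_eq {δ : ℝ} (hδ : 0 < δ) {σ : ℝ} (v ξ : ℝ) :
    exp (v * lin σ ξ) * ww δ (lin σ ξ) =
      ((1 + δ) / δ) * (exp ((v + Real.log (1 + δ) : ℝ) * lin σ ξ) * (lin σ ξ * (lin σ ξ + 1))⁻¹)
       - (1 / δ) * (exp (v * lin σ ξ) * (lin σ ξ * (lin σ ξ + 1))⁻¹) := by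
  have hb : ((1 + δ : ℝ) : ℂ) ≠ 0 := by
    have : (1 + δ : ℝ) ≠ 0 := by linarith
    exact_mod_cast this
  have e : ((1 + δ : ℝ) : ℂ) ^ (lin σ ξ + 1) = (1 + δ) * exp (Real.log (1 + δ) * lin σ ξ) := by
    rw [cpow_add _ _ hb, cpow_one, cpow_def_of_ne_zero hb, ← ofReal_log (by linarith)]
    push_cast; ring
  rw [ww, e]
  push_cast
  rw [add_mul (v:ℂ), Complex.exp_add]
  simp only [div_eq_mul_inv, mul_inv]
  ring

lemma ww_int {δ : ℝ} (hδ : 0 < δ) {σ : ℝ} (hσ : 1 < σ) (v : ℝ) :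
    Integrable fun ξ : ℝ => exp (v * lin σ ξ) * ww δ (lin σ ξ) := by
  simp_rw [ww_eq hδ]
  exact ((exp_lin_int hσ _).const_mul _).sub ((exp_lin_int hσ _).const_mul _)

lemma ww_int' {δ : ℝ} (hδ : 0 < δ) {σ : ℝ} (hσ : 1 < σ) :
    Integrable fun ξ : ℝ => ww δ (lin σ ξ) := by
  simpa using ww_int hδ hσ 0

lemma kern {δ : ℝ} (hδ : 0 < δ) {σ : ℝ} (hσ : 1 < σ) (v : ℝ) :
    ∫ ξ : ℝ, exp (v * lin σ ξ) * ww δ (lin σ ξ) = ((tz δ (Real.exp (-v)) : ℝ) : ℂ) := by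
  simp_rw [ww_eq hδ]
  rw [integral_sub ((exp_lin_int hσ _).const_mul _) ((exp_lin_int hσ _).const_mul _),
    integral_const_mul, integral_const_mul, kern_base hσ, kern_base hσ]
  have h1 : (0:ℝ) < 1 + δ := by linarith
  have e : (1 + δ) * max 0 (1 - Real.exp (-(v + Real.log (1 + δ)))) = max 0 (1 + δ - Real.exp (-v)) := by
    rw [mul_max_of_nonneg _ _ h1.le, mul_zero, neg_add, Real.exp_add, Real.exp_neg (Real.log _),
      Real.exp_log h1]
    congr 1; field_simp
  have : tz δ (Real.exp (-v)) = (1 + δ) / δ * max 0 (1 - Real.exp (-(v + Real.log (1 + δ)))) -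
      1 / δ * max 0 (1 - Real.exp (-v)) := by
    rw [tz, ← e]; ring
  rw [this]; push_cast; rfl

end CSD

namespace CSD
open Complex Set Filter Topology MeasureTheory
open scoped FourierTransform

lemma gint_meas (b r : ℂ) :
    AEStronglyMeasurable (fun u : ℝ => (u : ℂ) ^ b * exp (-(r * u))) (volume.restrict (Ioi 0)) := by
  refine ContinuousOn.aestronglyMeasurable ?_ measurableSet_Ioi
  refine ContinuousOn.mul ?_ (by fun_prop)
  intro u hu
  exact (continuousAt_ofReal_cpow_const u b (Or.inr (ne_of_gt hu))).continuousWithinAt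

lemma gint_norm {b r : ℂ} {u : ℝ} (hu : 0 < u) :
    ‖(u : ℂ) ^ b * exp (-(r * u))‖ = u ^ b.re * Real.exp (-r.re * u) := by
  rw [norm_mul, norm_cpow_eq_rpow_re_of_pos hu, Complex.norm_exp]; simp

lemma gint_real {b r : ℝ} (hb : -1 < b) (hr : 0 < r) :
    IntegrableOn (fun u : ℝ => u ^ b * Real.exp (-r * u)) (Ioi 0) := by
  have := integrableOn_rpow_mul_exp_neg_mul_rpow (p := 1) (s := b) (b := r) hb one_pos hr
  simpa using this

lemma gint_int {b r : ℂ} (hb : -1 < b.re) (hr : 0 < r.re) :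
    IntegrableOn (fun u : ℝ => (u : ℂ) ^ b * exp (-(r * u))) (Ioi 0) := by
  refine (gint_real hb hr).mono' (gint_meas b r) ?_
  refine (ae_restrict_iff' measurableSet_Ioi).2 (Eventually.of_forall fun u hu => ?_)
  rw [gint_norm hu]

lemma gint_deriv {b r : ℂ} (hb : -1 < b.re) (hr : 0 < r.re) :
    DifferentiableAt ℂ (fun r : ℂ => ∫ u : ℝ in Ioi 0, (u : ℂ) ^ b * exp (-(r * u))) r := by
  have h := hasDerivAt_integral_of_dominated_loc_of_deriv_le (μ := volume.restrict (Ioi (0:ℝ)))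
    (F := fun (r : ℂ) (u : ℝ) => (u : ℂ) ^ b * exp (-(r * u)))
    (F' := fun (r : ℂ) (u : ℝ) => -((u : ℂ) ^ (b + 1) * exp (-(r * u))))
    (bound := fun u => u ^ (b.re + 1) * Real.exp (-(r.re / 2) * u)) (x₀ := r)
    (s := {z : ℂ | r.re / 2 < z.re}) ?_ ?_ (gint_int hb hr) ?_ ?_ ?_ ?_
  · exact h.2.differentiableAt
  · exact (isOpen_lt continuous_const continuous_re).mem_nhds (by simp; linarith)
  · exact Eventually.of_forall fun z => gint_meas b z
  · exact (gint_meas (b + 1) r).neg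
  · refine (ae_restrict_iff' measurableSet_Ioi).2 (Eventually.of_forall fun u hu z hz => ?_)
    have hu' : 0 < u := hu
    have hz' : r.re / 2 < z.re := hz
    rw [norm_neg, gint_norm hu]
    simp only [add_re, one_re]
    gcongr
  · exact gint_real (by linarith) (by linarith)
  · refine (ae_restrict_iff' measurableSet_Ioi).2 (Eventually.of_forall fun u hu z hz => ?_)
    have hu' : (u : ℂ) ≠ 0 := by exact_mod_cast (ne_of_gt hu)
    have h1 : HasDerivAt (fun z : ℂ => exp (-(z * u))) (exp (-(z * u)) * (-(1 * u))) z :=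
      (((hasDerivAt_id z).mul_const (u : ℂ)).neg).cexp
    refine (h1.const_mul ((u:ℂ) ^ b)).congr_deriv ?_
    rw [cpow_add _ _ hu', cpow_one]; ring

lemma gint_eq {β r : ℂ} (hβ : 0 < β.re) (hr : 0 < r.re) :
    ∫ u : ℝ in Ioi 0, (u : ℂ) ^ (β - 1) * exp (-(r * u)) = r ^ (-β) * Gamma β := by
  have hU : IsOpen {z : ℂ | 0 < z.re} := isOpen_lt continuous_const continuous_re
  have h1 : AnalyticOnNhd ℂ (fun r : ℂ => ∫ u : ℝ in Ioi 0, (u : ℂ) ^ (β - 1) * exp (-(r * u)))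
      {z : ℂ | 0 < z.re} := by
    refine DifferentiableOn.analyticOnNhd (fun z hz => ?_) hU
    exact (gint_deriv (by simp; linarith) hz).differentiableWithinAt
  have h2 : AnalyticOnNhd ℂ (fun r : ℂ => r ^ (-β) * Gamma β) {z : ℂ | 0 < z.re} := by
    refine DifferentiableOn.analyticOnNhd (fun z hz => ?_) hU
    have : DifferentiableAt ℂ (fun r : ℂ => r ^ (-β)) z :=
      (hasDerivAt_id z |>.cpow_const (Or.inl hz)).differentiableAt
    exact (this.mul_const _).differentiableWithinAt
  have hpre : IsPreconnected {z : ℂ | 0 < z.re} := (convex_halfSpace_re_gt 0).isPreconnected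
  have := h1.eqOn_of_preconnected_of_frequently_eq h2 hpre (z₀ := 1) (by simp) ?_
  · exact this hr
  · have ht : Tendsto (fun x : ℝ => (x : ℂ)) (𝓝[>] 1) (𝓝[≠] 1) := by
      refine tendsto_nhdsWithin_iff.2 ⟨?_, ?_⟩
      · exact (continuous_ofReal.tendsto' 1 1 (by simp)).mono_left nhdsWithin_le_nhds
      · filter_upwards [self_mem_nhdsWithin] with x hx
        have : (1:ℝ) < x := hx
        simp only [mem_compl_iff, mem_singleton_iff]
        exact_mod_cast this.ne'
    refine ht.frequently (Eventually.frequently ?_)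
    filter_upwards [self_mem_nhdsWithin] with x hx
    have hx : (1:ℝ) < x := hx
    rw [Complex.integral_cpow_mul_exp_neg_mul_Ioi hβ (by linarith), one_div, cpow_neg,
      inv_cpow]
    rw [Complex.arg_ofReal_of_nonneg (by linarith)]
    exact Real.pi_pos.ne

lemma A_part {f : ℕ → ℂ} (hf : ∀ n, ‖f n‖ ≤ 1) {δ : ℝ} (hδ : 0 < δ) {σ : ℝ} (hσ : 1 < σ) (L : ℝ) :
    HasSum (fun n : ℕ => LSeries.logMul^[2] f n * ((tz δ (n * Real.exp (-L)) : ℝ) : ℂ))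
      (∫ ξ : ℝ, exp (L * lin σ ξ) * ww δ (lin σ ξ) * LSeries (LSeries.logMul^[2] f) (lin σ ξ)) := by
  set a := LSeries.logMul^[2] f with ha
  have ha0 : a 0 = 0 := by simp [ha, LSeries.logMul]
  have hs : LSeriesSummable a σ := by
    apply LSeriesSummable_of_abscissaOfAbsConv_lt_re
    rw [ha, LSeries.absicssaOfAbsConv_logPowMul]
    exact absc_lt hf (by simpa using hσ)
  have hF : ∀ n : ℕ, (fun ξ : ℝ => exp (L * lin σ ξ) * ww δ (lin σ ξ) * LSeries.term a (lin σ ξ) n) =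
      fun ξ : ℝ => a n * (exp ((L - Real.log n : ℝ) * lin σ ξ) * ww δ (lin σ ξ)) := by
    intro n; ext ξ
    rcases Nat.eq_zero_or_pos n with rfl | hn
    · simp [ha0]
    · have hn' : (n : ℂ) ≠ 0 := by exact_mod_cast hn.ne'
      rw [LSeries.term_of_ne_zero hn.ne', cpow_def_of_ne_zero hn', ← natCast_log, ofReal_sub, sub_mul,
        Complex.exp_sub]
      ring
  have hnorm : ∀ (n : ℕ) (ξ : ℝ), ‖exp (L * lin σ ξ) * ww δ (lin σ ξ) * LSeries.term a (lin σ ξ) n‖ =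
      Real.exp (L * σ) * ‖LSeries.term a σ n‖ * ‖ww δ (lin σ ξ)‖ := by
    intro n ξ
    rw [norm_mul, norm_mul, exp_lin_norm, LSeries.norm_term_eq, LSeries.norm_term_eq, lin_re, ofReal_re]
    ring
  have hh := hasSum_integral_of_summable_integral_norm (μ := (volume : Measure ℝ))
    (F := fun n ξ => exp (L * lin σ ξ) * ww δ (lin σ ξ) * LSeries.term a (lin σ ξ) n) ?_ ?_
  · have e1 : (fun n : ℕ => a n * ((tz δ (n * Real.exp (-L)) : ℝ) : ℂ)) = fun n : ℕ =>
        ∫ ξ : ℝ, exp (L * lin σ ξ) * ww δ (lin σ ξ) * LSeries.term a (lin σ ξ) n := by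
      ext n
      rw [hF, integral_const_mul, kern hδ hσ]
      rcases Nat.eq_zero_or_pos n with rfl | hn
      · simp [ha0]
      · rw [neg_sub, Real.exp_sub, Real.exp_log (by exact_mod_cast hn), Real.exp_neg]; rfl
    have e2 : (∫ ξ : ℝ, exp (L * lin σ ξ) * ww δ (lin σ ξ) * LSeries a (lin σ ξ)) =
        ∫ ξ : ℝ, ∑' n : ℕ, exp (L * lin σ ξ) * ww δ (lin σ ξ) * LSeries.term a (lin σ ξ) n := by
      congr 1
      ext ξ
      rw [tsum_mul_left]; rfl
    rw [e1, e2]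
    exact hh
  · intro n
    rw [hF]
    exact (ww_int hδ hσ _).const_mul _
  · simp_rw [hnorm, integral_const_mul]
    exact (hs.norm.mul_left _).mul_right _

lemma B_part {β : ℂ} (hβ : 0 < β.re) {δ : ℝ} (hδ : 0 < δ) {σ : ℝ} (hσ : 1 < σ) (L : ℝ) :
    (∫ ξ : ℝ, exp (L * lin σ ξ) * ww δ (lin σ ξ) * (lin σ ξ - 1) ^ (-β)) * Gamma β =
      ∫ u : ℝ in Ioi 0, (u : ℂ) ^ (β - 1) * exp u * ((tz δ (Real.exp (u - L)) : ℝ) : ℂ) := by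
  have hswap := integral_integral_swap (μ := (volume : Measure ℝ)) (ν := volume.restrict (Ioi (0:ℝ)))
    (f := fun ξ u => exp (L * lin σ ξ) * ww δ (lin σ ξ) *
      ((u : ℂ) ^ (β - 1) * exp (-((lin σ ξ - 1) * u)))) ?_
  · have e1 : (∫ ξ : ℝ, exp (L * lin σ ξ) * ww δ (lin σ ξ) * (lin σ ξ - 1) ^ (-β)) * Gamma β =
       ∫ ξ : ℝ, ∫ u : ℝ in Ioi 0, exp (L * lin σ ξ) * ww δ (lin σ ξ) *
          ((u : ℂ) ^ (β - 1) * exp (-((lin σ ξ - 1) * u))) := by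
      rw [← integral_mul_const]
      congr 1
      ext ξ
      rw [integral_const_mul, gint_eq hβ (by simp [lin_re]; linarith)]
      ring
    rw [e1, hswap]
    congr 1
    ext u
    have e2 : ∀ ξ : ℝ, exp (L * lin σ ξ) * ww δ (lin σ ξ) *
          ((u : ℂ) ^ (β - 1) * exp (-((lin σ ξ - 1) * u))) =
        ((u : ℂ) ^ (β - 1) * exp u) * (exp ((L - u : ℝ) * lin σ ξ) * ww δ (lin σ ξ)) := by
      intro ξ
      have : exp (-((lin σ ξ - 1) * u)) * exp (L * lin σ ξ) = exp u * exp ((L - u : ℝ) * lin σ ξ) := by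
        rw [← Complex.exp_add, ← Complex.exp_add]
        congr 1; push_cast; ring
      linear_combination ((u : ℂ) ^ (β - 1) * ww δ (lin σ ξ)) * this
    simp_rw [e2]
    rw [integral_const_mul, kern hδ hσ, neg_sub]
  · have h1 := (ww_int hδ hσ L).mul_prod (gint_int (b := β - 1) (r := ((σ - 1 : ℝ) : ℂ))
      (by simp; linarith) (by simp; linarith))
    have h2 := h1.bdd_mul (f := fun z : ℝ × ℝ => exp (-(2 * Real.pi * z.1 * I * z.2))) (c := 1) ?_ ?_
    · refine h2.congr (Eventually.of_forall fun z => ?_)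
      simp only [Function.uncurry]
      have : exp (-((lin σ z.1 - 1) * z.2)) =
        exp (-(2 * Real.pi * z.1 * I * z.2)) * exp (-(((σ - 1 : ℝ) : ℂ) * z.2)) := by
        rw [← Complex.exp_add]; congr 1; push_cast; rw [lin]; ring
      rw [this]; ring
    · exact Continuous.aestronglyMeasurable (by fun_prop)
    · refine Eventually.of_forall fun z => ?_
      rw [Complex.norm_exp]; simp

end CSD

namespace CSD
open Complex Set Filter Topology MeasureTheory
open scoped FourierTransform

lemma re_bds {α : ℂ} (hα : ‖α‖ ≤ 1) : -1 ≤ α.re ∧ α.re ≤ 1 :=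
  abs_le.1 ((abs_re_le_norm α).trans hα)

lemma B_int {α : ℂ} (hα : ‖α‖ ≤ 1) {δ : ℝ} (hδ : 0 < δ) {σ : ℝ} (hσ : 1 < σ) (L : ℝ) :
    Integrable fun ξ : ℝ => exp (L * lin σ ξ) * ww δ (lin σ ξ) * (lin σ ξ - 1) ^ (-α - 2) := by
  simp_rw [mul_comm _ ((_ : ℂ) ^ (-α - 2))]
  have hr := re_bds hα
  have hre : ∀ ξ, σ - 1 ≤ ‖lin σ ξ - 1‖ := fun ξ => by
    have := re_le_norm (lin σ ξ - 1)
    simpa [lin_re] using this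
  refine (ww_int hδ hσ L).bdd_mul (c := 8 * Real.exp (3 * Real.pi) * (σ - 1) ^ (-α - 2).re) ?_ ?_
  · refine Continuous.aestronglyMeasurable ?_
    have := lin_cont σ
    refine Continuous.cpow (by fun_prop) (by fun_prop) fun ξ => ?_
    exact slit_of_re (by rw [lin_re]; exact hσ)
  · refine Eventually.of_forall fun ξ => ?_
    have hw : lin σ ξ - 1 ≠ 0 := by
      intro h; have := hre ξ; rw [h, norm_zero] at this; linarith
    refine (cpow_bound hw (by rw [sub_self, norm_zero]; positivity) ?_).trans ?_
    · calc ‖-α - 2‖ ≤ ‖-α‖ + ‖(2:ℂ)‖ := norm_sub_le _ _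
        _ ≤ 3 := by rw [norm_neg]; norm_num; linarith
    · gcongr ?_ * ?_
      refine Real.rpow_le_rpow_of_nonpos (by linarith) (hre ξ) ?_
      simp; linarith

lemma smooth {c C : ℝ} (hc : 0 < c) (hc1 : c ≤ 1) (hC : 1 ≤ C) : ∃ K, 1 ≤ K ∧
    ∀ f α H, Dat c C f α H → ∀ L : ℝ, 1 ≤ L →
      ‖(∑' n : ℕ, LSeries.logMul^[2] f n * ((tz (L ^ 3)⁻¹ (n * Real.exp (-L)) : ℝ) : ℂ)) -
        H 1 * (Gamma α)⁻¹ * ∫ u : ℝ in Ioi 0, (u : ℂ) ^ (α + 1) * exp u *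
          ((tz (L ^ 3)⁻¹ (Real.exp (u - L)) : ℝ) : ℂ)‖ ≤ K * Real.exp L * L ^ α.re := by
  obtain ⟨K, hK, hfg⟩ := fourier_g hc hc1 hC
  refine ⟨Real.exp 1 * K, ?_, ?_⟩
  · nlinarith [Real.add_one_le_exp 1]
  intro f α H hD L hL
  have hL0 : 0 < L := by linarith
  set δ := (L ^ 3)⁻¹ with hδd
  set σ := 1 + L⁻¹ with hσd
  have hδ : 0 < δ := by positivity
  have hδ1 : δ ≤ 1 := inv_le_one_of_one_le₀ (one_le_pow₀ hL)
  have hLi : 0 < L⁻¹ := by positivity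
  have hLi1 : L⁻¹ ≤ 1 := inv_le_one_of_one_le₀ hL
  have hσ : 1 < σ := by linarith
  have hσ2 : σ ≤ 2 := by linarith
  have hr := re_bds hD.hα
  have hβ : 0 < (α + 2).re := by simp; linarith
  rw [(A_part hD.hf hδ hσ L).tsum_eq]
  have hB := B_part hβ hδ hσ L
  rw [show α + 2 - 1 = α + 1 by ring] at hB
  rw [← hB]
  have hG : (Gamma α)⁻¹ = α * (α + 1) * (Gamma (α + 2))⁻¹ := by
    rw [one_div_Gamma_eq_self_mul_one_div_Gamma_add_one, one_div_Gamma_eq_self_mul_one_div_Gamma_add_one (α + 1),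
      show α + 1 + 1 = α + 2 by ring]
    ring
  have hGne : Gamma (α + 2) ≠ 0 := Gamma_ne_zero_of_re_pos hβ
  have hg0 := integrable_g hc hc1 hC hD hδ hδ1 hσ hσ2 (k := 0) (by norm_num)
  rw [iteratedDeriv_zero] at hg0
  have hg : Integrable fun ξ : ℝ => exp (L * lin σ ξ) * (ww δ (lin σ ξ) * GG f α (H 1) (lin σ ξ)) := by
    refine hg0.bdd_mul (c := Real.exp (L * σ)) ?_ ?_
    · have := lin_cont σ
      exact Continuous.aestronglyMeasurable (by fun_prop)
    · exact Eventually.of_forall fun ξ => (exp_lin_norm σ L ξ).le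
  have hBi := (B_int hD.hα hδ hσ L).const_mul (H 1 * (α * (α + 1)))
  have hsum : (∫ ξ : ℝ, exp (L * lin σ ξ) * ww δ (lin σ ξ) * LSeries (LSeries.logMul^[2] f) (lin σ ξ)) =
      (∫ ξ : ℝ, exp (L * lin σ ξ) * (ww δ (lin σ ξ) * GG f α (H 1) (lin σ ξ))) +
      H 1 * (α * (α + 1)) * ∫ ξ : ℝ, exp (L * lin σ ξ) * ww δ (lin σ ξ) * (lin σ ξ - 1) ^ (-α - 2) := by
    rw [← integral_const_mul, ← integral_add hg hBi]
    congr 1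
    ext ξ
    rw [GG]; ring
  rw [hsum, hG, show -(α + 2) = -α - 2 by ring]
  have hfin : (∫ ξ : ℝ, exp (L * lin σ ξ) * (ww δ (lin σ ξ) * GG f α (H 1) (lin σ ξ))) =
      exp (L * σ) * 𝓕 (fun ξ : ℝ => ww δ (lin σ ξ) * GG f α (H 1) (lin σ ξ)) (-L) := by
    rw [Real.fourier_eq', ← integral_const_mul]
    congr 1
    ext ξ
    rw [smul_eq_mul, ← mul_assoc (exp (L * σ)), ← Complex.exp_add]
    congr 2
    simp [lin]; ring
  have hfinal : ∀ X Y : ℂ, X + H 1 * (α * (α + 1)) * Y -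
      H 1 * (α * (α + 1) * (Gamma (α + 2))⁻¹) * (Y * Gamma (α + 2)) = X := by
    intro X Y; field_simp; ring
  rw [hfinal, hfin, norm_mul, Complex.norm_exp]
  have e : Real.exp ((L * σ : ℂ).re) = Real.exp 1 * Real.exp L := by
    rw [← Real.exp_add]
    congr 1
    rw [← ofReal_mul, ofReal_re, hσd]; field_simp; ring
  rw [e]
  calc _ ≤ Real.exp 1 * Real.exp L * (K * L ^ α.re) := by
        gcongr; exact hfg f α H hD L hL
    _ = _ := by ring

lemma A_desmooth {f : ℕ → ℂ} (hf : ∀ n, ‖f n‖ ≤ 1) {L : ℝ} (hL : 1 ≤ L) :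
    ‖(∑' n : ℕ, LSeries.logMul^[2] f n * ((tz (L ^ 3)⁻¹ (n * Real.exp (-L)) : ℝ) : ℂ)) -
      ∑ n ∈ Finset.Icc 1 ⌊Real.exp L⌋₊, LSeries.logMul^[2] f n‖ ≤ 28 * Real.exp L * L⁻¹ := by
  have hL0 : 0 < L := by linarith
  set δ := (L ^ 3)⁻¹ with hδd
  have hδ : 0 < δ := by positivity
  have hδ1 : δ ≤ 1 := inv_le_one_of_one_le₀ (one_le_pow₀ hL)
  set x := Real.exp L with hx
  have hx0 : 0 < x := Real.exp_pos _
  set a := LSeries.logMul^[2] f with ha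
  have han : ∀ n, a n = (Real.log n : ℂ) ^ 2 * f n := by
    intro n; simp [ha, LSeries.logMul]; ring
  have hxl : x ≤ x * (1 + δ) := by nlinarith
  have hfl : ⌊x⌋₊ ≤ ⌊x * (1 + δ)⌋₊ := Nat.floor_mono hxl
  have h1 : (∑' n : ℕ, a n * ((tz δ (n * Real.exp (-L)) : ℝ) : ℂ)) =
      ∑ n ∈ Finset.Icc 1 ⌊x * (1 + δ)⌋₊, a n * ((tz δ (n * Real.exp (-L)) : ℝ) : ℂ) := by
    refine tsum_eq_sum fun n hn => ?_
    simp only [Finset.mem_Icc, not_and, not_le] at hn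
    rcases Nat.eq_zero_or_pos n with rfl | h
    · simp [han]
    · have := Nat.lt_of_floor_lt (hn h)
      rw [tz_eq_zero hδ]; · simp
      rw [Real.exp_neg, ← hx, ← div_eq_mul_inv, le_div_iff₀ hx0]; linarith
  have h2 : Finset.Icc 1 ⌊x * (1 + δ)⌋₊ = Finset.Icc 1 ⌊x⌋₊ ∪ Finset.Ioc ⌊x⌋₊ ⌊x * (1 + δ)⌋₊ := by
    ext n; simp only [Finset.mem_Icc, Finset.mem_union, Finset.mem_Ioc]; omega
  have h3 : Disjoint (Finset.Icc 1 ⌊x⌋₊) (Finset.Ioc ⌊x⌋₊ ⌊x * (1 + δ)⌋₊) := by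
    rw [Finset.disjoint_left]; intro n; simp only [Finset.mem_Icc, Finset.mem_Ioc]; omega
  have h4 : ∑ n ∈ Finset.Icc 1 ⌊x⌋₊, a n * ((tz δ (n * Real.exp (-L)) : ℝ) : ℂ) =
      ∑ n ∈ Finset.Icc 1 ⌊x⌋₊, a n := by
    refine Finset.sum_congr rfl fun n hn => ?_
    have : (n : ℝ) ≤ x := (Nat.le_floor_iff hx0.le).1 (Finset.mem_Icc.1 hn).2
    rw [tz_eq_one hδ]; · simp
    rw [Real.exp_neg, ← hx, ← div_eq_mul_inv, div_le_one hx0]; exact this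
  rw [h1, h2, Finset.sum_union h3, h4, add_sub_cancel_left]
  refine (norm_sum_le _ _).trans ?_
  have hterm : ∀ n ∈ Finset.Ioc ⌊x⌋₊ ⌊x * (1 + δ)⌋₊, ‖a n * ((tz δ (n * Real.exp (-L)) : ℝ) : ℂ)‖ ≤ 4 * L ^ 2 := by
    intro n hn
    have hn2 : (n : ℝ) ≤ x * (1 + δ) := (Nat.le_floor_iff (by positivity)).1 (Finset.mem_Ioc.1 hn).2
    have hn1 : 0 < n := by have := (Finset.mem_Ioc.1 hn).1; omega
    have hn1' : (1:ℝ) ≤ n := by exact_mod_cast hn1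
    have hlog : Real.log n ≤ 2 * L := by
      rw [Real.log_le_iff_le_exp (by linarith)]
      refine hn2.trans ?_
      rw [two_mul, Real.exp_add]
      have := Real.add_one_le_exp L
      rw [← hx] at *
      nlinarith
    have hlog0 := Real.log_nonneg hn1'
    rw [norm_mul, han, norm_mul, norm_pow, norm_real, norm_real, Real.norm_of_nonneg hlog0,
      Real.norm_of_nonneg (tz_nonneg hδ _)]
    calc _ ≤ (2 * L) ^ 2 * 1 * 1 := by
          gcongr
          · exact tz_nonneg hδ _
          · exact hf n
          · exact tz_le_one hδ _
      _ = _ := by ring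
  refine (Finset.sum_le_card_nsmul _ _ _ hterm).trans ?_
  rw [Nat.card_Ioc, nsmul_eq_mul, Nat.cast_sub hfl]
  have g1 : (⌊x * (1 + δ)⌋₊ : ℝ) ≤ x * (1 + δ) := Nat.floor_le (by positivity)
  have g2 : x < ⌊x⌋₊ + 1 := Nat.lt_floor_add_one x
  have g3 : L ^ 3 ≤ 6 * x := by
    have := Real.pow_div_factorial_le_exp L hL0.le 3
    simp [Nat.factorial] at this
    rw [div_le_iff₀ (by norm_num)] at this
    linarith
  calc _ ≤ (x * δ + 1) * (4 * L ^ 2) := by gcongr; linarith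
    _ ≤ _ := by
      rw [hδd]
      have : (x * (L ^ 3)⁻¹ + 1) * (4 * L ^ 2) = (4 * x + 4 * L ^ 3) * L⁻¹ := by field_simp
      rw [this]
      gcongr
      linarith

lemma cpow_lip {β : ℂ} (hβ : ‖β - 1‖ ≤ 1) {L u : ℝ} (hL : 1 ≤ L) (hu : 0 < u) (huL : u ≤ L) :
    ‖(u : ℂ) ^ β - (L : ℂ) ^ β‖ ≤ 4 * L ^ (β.re - 1) * (L - u) := by
  have hL0 : 0 < L := by linarith
  have hr := re_bds hβ
  simp only [sub_re, one_re] at hr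
  have hβn : ‖β‖ ≤ 2 := by
    calc ‖β‖ = ‖(β - 1) + 1‖ := by simp
      _ ≤ ‖β - 1‖ + ‖(1:ℂ)‖ := norm_add_le _ _
      _ ≤ 2 := by rw [norm_one]; linarith
  have hLp : 0 < L ^ (β.re - 1) := Real.rpow_pos_of_pos hL0 _
  by_cases hh : L / 2 ≤ u
  · have := Convex.norm_image_sub_le_of_norm_hasDerivWithin_le (s := Icc (L / 2) L)
      (f := fun v : ℝ => (v : ℂ) ^ β)
      (f' := fun v : ℝ => β * (v : ℂ) ^ (β - 1)) (C := 4 * L ^ (β.re - 1))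
      (fun v hv => (hasDerivAt_cpow_real (by linarith [hv.1]) _).hasDerivWithinAt)
      (fun v hv => by
        have hv0 : 0 < v := by linarith [hv.1]
        rw [norm_mul, norm_cpow_eq_rpow_re_of_pos hv0, sub_re, one_re]
        have : v ^ (β.re - 1) ≤ 2 * L ^ (β.re - 1) := by
          rcases le_total 0 (β.re - 1) with h | h
          · have := Real.rpow_le_rpow hv0.le hv.2 h
            linarith
          · have h1 := Real.rpow_le_rpow_of_nonpos (by linarith) hv.1 h
            refine h1.trans ?_
            rw [Real.div_rpow hL0.le (by norm_num), div_eq_mul_inv, ← Real.rpow_neg (by norm_num), mul_comm]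
            gcongr
            calc (2:ℝ) ^ (-(β.re - 1)) ≤ 2 ^ (1:ℝ) :=
                  Real.rpow_le_rpow_of_exponent_le (by norm_num) (by linarith)
              _ = 2 := by norm_num
        calc ‖β‖ * v ^ (β.re - 1) ≤ 2 * (2 * L ^ (β.re - 1)) := by gcongr
          _ = _ := by ring)
      (convex_Icc _ _) (x := L) (y := u) ⟨by linarith, le_rfl⟩ ⟨hh, huL⟩
    refine this.trans_eq ?_
    rw [Real.norm_of_nonpos (by linarith)]; ring
  · push Not at hh
    refine (norm_sub_le _ _).trans ?_
    rw [norm_cpow_eq_rpow_re_of_pos hu, norm_cpow_eq_rpow_re_of_pos hL0]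
    have h1 : u ^ β.re ≤ L ^ β.re := Real.rpow_le_rpow hu.le huL (by linarith)
    have h2 : L ^ β.re = L ^ (β.re - 1) * L := by
      rw [← Real.rpow_add_one hL0.ne']; simp
    rw [h2] at h1 ⊢
    nlinarith

lemma B_desmooth {α : ℂ} (hα : ‖α‖ ≤ 1) {L : ℝ} (hL : 1 ≤ L) :
    ‖(∫ u : ℝ in Ioi 0, (u : ℂ) ^ (α + 1) * exp u *
        ((tz (L ^ 3)⁻¹ (Real.exp (u - L)) : ℝ) : ℂ)) - Real.exp L * (L : ℂ) ^ (α + 1)‖ ≤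
      20 * Real.exp L * L ^ α.re := by
  have hL0 : 0 < L := by linarith
  set δ := (L ^ 3)⁻¹ with hδd
  have hδ : 0 < δ := by positivity
  have hδ1 : δ ≤ 1 := inv_le_one_of_one_le₀ (one_le_pow₀ hL)
  have hr := re_bds hα
  have hre : (α + 1).re - 1 = α.re := by simp
  have hre' : (α + 1).re = α.re + 1 := by simp
  have hLp : 0 < L ^ α.re := Real.rpow_pos_of_pos hL0 _
  have hLp1 : L ^ (α + 1).re = L ^ α.re * L := by rw [hre', Real.rpow_add_one hL0.ne']
  have hz : ∀ u : ℝ, L + δ < u → tz δ (Real.exp (u - L)) = 0 := by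
    intro u hu
    refine tz_eq_zero hδ ?_
    have := Real.add_one_le_exp (u - L)
    linarith
  have hI : IntegrableOn (fun u : ℝ => (u : ℂ) ^ (α + 1) * exp u * ((tz δ (Real.exp (u - L)) : ℝ) : ℂ)) (Ioi 0) := by
    have h0 := gint_int (b := α + 1) (r := 1) (by simp; linarith) (by simp)
    have h1 := Integrable.bdd_mul (f := fun u : ℝ => exp (2 * u) * ((tz δ (Real.exp (u - L)) : ℝ) : ℂ))
      (c := Real.exp (2 * (L + 1))) h0 ?_ ?_
    · refine h1.congr (Eventually.of_forall fun u => ?_)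
      simp only
      have : exp (2 * (u : ℂ)) * exp (-(1 * u)) = exp u := by
        rw [← Complex.exp_add]; congr 1; ring
      rw [← this]; ring
    · have := tz_cont δ
      exact Continuous.aestronglyMeasurable (by fun_prop)
    · refine Eventually.of_forall fun u => ?_
      rcases le_or_gt u (L + δ) with h | h
      · rw [norm_mul, Complex.norm_exp, norm_real, Real.norm_of_nonneg (tz_nonneg hδ _)]
        have e1 : Real.exp ((2 * (u:ℂ)).re) ≤ Real.exp (2 * (L + 1)) := by
          apply Real.exp_le_exp.2; simp; linarith
        have e2 := tz_le_one hδ (Real.exp (u - L))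
        have e3 := tz_nonneg hδ (Real.exp (u - L))
        calc _ ≤ Real.exp (2 * (L + 1)) * 1 := by gcongr
          _ = _ := mul_one _
      · rw [hz u h]; simp; positivity
  have hsplit : Ioi (0:ℝ) = Ioc 0 L ∪ Ioi L := (Ioc_union_Ioi_eq_Ioi hL0.le).symm
  have hI1 : IntegrableOn (fun u : ℝ => (u : ℂ) ^ (α + 1) * exp u * ((tz δ (Real.exp (u - L)) : ℝ) : ℂ)) (Ioc 0 L) :=
    hI.mono_set Ioc_subset_Ioi_self
  have hI2 : IntegrableOn (fun u : ℝ => (u : ℂ) ^ (α + 1) * exp u * ((tz δ (Real.exp (u - L)) : ℝ) : ℂ)) (Ioi L) :=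
    hI.mono_set (Ioi_subset_Ioi hL0.le)
  rw [hsplit, setIntegral_union (Ioc_disjoint_Ioi le_rfl) measurableSet_Ioi hI1 hI2]
  -- the part beyond `L`
  have hP2 : ‖∫ u : ℝ in Ioi L, (u : ℂ) ^ (α + 1) * exp u * ((tz δ (Real.exp (u - L)) : ℝ) : ℂ)‖ ≤
      12 * Real.exp L * L ^ α.re := by
    rw [setIntegral_eq_of_subset_of_forall_sdiff_eq_zero (s := Ioc L (L + δ))
      (f := fun u : ℝ => (u : ℂ) ^ (α + 1) * exp u * ((tz δ (Real.exp (u - L)) : ℝ) : ℂ))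
      measurableSet_Ioi Ioc_subset_Ioi_self (fun u hu => by
        rw [hz u (by
          by_contra h
          exact hu.2 ⟨hu.1, not_lt.1 h⟩)]
        simp)]
    have := norm_setIntegral_le_of_norm_le_const (μ := volume) (s := Ioc L (L + δ))
      (f := fun u : ℝ => (u : ℂ) ^ (α + 1) * exp u * ((tz δ (Real.exp (u - L)) : ℝ) : ℂ))
      (C := 4 * (L ^ α.re * L) * (3 * Real.exp L)) (by simp) (fun u hu => by
        have hu0 : 0 < u := by linarith [hu.1]
        rw [norm_mul, norm_mul, Complex.norm_exp, norm_real, Real.norm_of_nonneg (tz_nonneg hδ _),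
          norm_cpow_eq_rpow_re_of_pos hu0, ofReal_re]
        have e1 : u ^ (α + 1).re ≤ 4 * (L ^ α.re * L) := by
          rw [← hLp1]
          calc u ^ (α + 1).re ≤ (2 * L) ^ (α + 1).re :=
                Real.rpow_le_rpow hu0.le (by linarith [hu.2]) (by rw [hre']; linarith)
            _ = 2 ^ (α + 1).re * L ^ (α + 1).re := Real.mul_rpow (by norm_num) hL0.le
            _ ≤ 2 ^ (2:ℝ) * L ^ (α + 1).re := by
                gcongr
                · norm_num
                · rw [hre']; linarith
            _ = _ := by norm_num
        have e2 : Real.exp u ≤ 3 * Real.exp L := by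
          calc Real.exp u ≤ Real.exp (1 + L) := Real.exp_le_exp.2 (by linarith [hu.2])
            _ = Real.exp 1 * Real.exp L := Real.exp_add _ _
            _ ≤ _ := by gcongr; linarith [Real.exp_one_lt_d9]
        have e3 := tz_le_one hδ (Real.exp (u - L))
        have e4 := tz_nonneg hδ (Real.exp (u - L))
        calc _ ≤ 4 * (L ^ α.re * L) * (3 * Real.exp L) * 1 := by gcongr
          _ = _ := mul_one _)
    refine this.trans ?_
    rw [Measure.real, Real.volume_Ioc, add_sub_cancel_left, ENNReal.toReal_ofReal hδ.le]
    have hLδ : L * δ ≤ 1 := by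
      rw [hδd, ← div_eq_mul_inv, div_le_one (by positivity)]
      exact le_self_pow₀ hL (by norm_num)
    calc _ = 12 * Real.exp L * L ^ α.re * (L * δ) := by ring
      _ ≤ 12 * Real.exp L * L ^ α.re * 1 := by gcongr
      _ = _ := mul_one _
  -- the part up to `L`
  have hcongr : ∀ u ∈ Ioc 0 L, (u : ℂ) ^ (α + 1) * exp u * ((tz δ (Real.exp (u - L)) : ℝ) : ℂ) =
      (u : ℂ) ^ (α + 1) * exp u := by
    intro u hu
    rw [tz_eq_one hδ]; · simp
    exact Real.exp_le_one_iff.2 (by linarith [hu.2])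
  rw [setIntegral_congr_fun measurableSet_Ioc hcongr]
  have hI1' : IntegrableOn (fun u : ℝ => (u : ℂ) ^ (α + 1) * exp u) (Ioc 0 L) :=
    hI1.congr_fun hcongr measurableSet_Ioc
  have hexp : IntegrableOn (fun u : ℝ => (L : ℂ) ^ (α + 1) * exp (u : ℂ)) (Ioc 0 L) :=
    (Continuous.integrableOn_Ioc (by fun_prop))
  have hexpv : ∫ u : ℝ in Ioc 0 L, (L : ℂ) ^ (α + 1) * exp (u : ℂ) = (L : ℂ) ^ (α + 1) * (Real.exp L - 1) := by
    rw [integral_const_mul, ← intervalIntegral.integral_of_le hL0.le]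
    have : ∫ u : ℝ in (0:ℝ)..L, exp (u : ℂ) = ((∫ u : ℝ in (0:ℝ)..L, Real.exp u : ℝ) : ℂ) := by
      rw [← intervalIntegral.integral_ofReal]; simp
    rw [this, integral_exp]; simp
  have hP1 : ‖∫ u : ℝ in Ioc 0 L, ((u : ℂ) ^ (α + 1) * exp u - (L : ℂ) ^ (α + 1) * exp (u : ℂ))‖ ≤
      4 * L ^ α.re * Real.exp L := by
    rw [← intervalIntegral.integral_of_le hL0.le]
    have hd : ∀ u ∈ uIcc 0 L, HasDerivAt (fun u : ℝ => 4 * L ^ α.re * ((L - u + 1) * Real.exp u))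
        (4 * L ^ α.re * ((L - u) * Real.exp u)) u := by
      intro u _
      have h1 : HasDerivAt (fun u : ℝ => L - u + 1) (-1) u := ((hasDerivAt_id u).const_sub L).add_const 1
      refine ((h1.mul (Real.hasDerivAt_exp u)).const_mul _).congr_deriv ?_
      ring
    have hfi : IntervalIntegrable (fun u : ℝ => 4 * L ^ α.re * ((L - u) * Real.exp u)) volume 0 L :=
      Continuous.intervalIntegrable (by fun_prop) _ _
    refine (intervalIntegral.norm_integral_le_of_norm_le hL0.le (Eventually.of_forall fun u hu => ?_) hfi).trans ?_
    · rw [← sub_mul, norm_mul, Complex.norm_exp, ofReal_re]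
      have := cpow_lip (β := α + 1) (by simpa using hα) hL hu.1 hu.2
      rw [hre] at this
      calc _ ≤ 4 * L ^ α.re * (L - u) * Real.exp u := by gcongr
        _ = _ := by ring
    · rw [intervalIntegral.integral_eq_sub_of_hasDerivAt hd hfi]
      simp only [sub_self, zero_add, one_mul, sub_zero, Real.exp_zero, mul_one]
      have : 0 ≤ 4 * L ^ α.re * (L + 1) := by positivity
      linarith
  rw [integral_sub hI1' hexp, hexpv] at hP1
  have hP3 : ‖(L : ℂ) ^ (α + 1)‖ ≤ Real.exp L * L ^ α.re := by
    rw [norm_cpow_eq_rpow_re_of_pos hL0, hLp1, mul_comm]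
    gcongr
    linarith [Real.add_one_le_exp L]
  set I1 := ∫ u : ℝ in Ioc 0 L, (u : ℂ) ^ (α + 1) * exp u
  set I2 := ∫ u : ℝ in Ioi L, (u : ℂ) ^ (α + 1) * exp u * ((tz δ (Real.exp (u - L)) : ℝ) : ℂ)
  have heq : I1 + I2 - Real.exp L * (L : ℂ) ^ (α + 1) =
      (I1 - (L : ℂ) ^ (α + 1) * (Real.exp L - 1)) + I2 - (L : ℂ) ^ (α + 1) := by ring
  rw [heq]
  have t1 := norm_sub_le ((I1 - (L : ℂ) ^ (α + 1) * (Real.exp L - 1)) + I2) ((L : ℂ) ^ (α + 1))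
  have t2 := norm_add_le (I1 - (L : ℂ) ^ (α + 1) * (Real.exp L - 1)) I2
  have t3 : 0 < Real.exp L * L ^ α.re := by positivity
  linarith

end CSD

namespace CSD
open Complex Set Filter Topology MeasureTheory

lemma gamma_bd : ∃ K, 1 ≤ K ∧ ∀ α : ℂ, ‖α‖ ≤ 1 → ‖(Gamma α)⁻¹‖ ≤ K := by
  obtain ⟨K, hK⟩ := (isCompact_closedBall (0:ℂ) 1).exists_bound_of_continuousOn
    (f := fun s : ℂ => (Gamma s)⁻¹) differentiable_one_div_Gamma.continuous.continuousOn
  exact ⟨max K 1, le_max_right _ _, fun α hα => (hK α (by simpa using hα)).trans (le_max_left _ _)⟩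

lemma A_asymp {c C : ℝ} (hc : 0 < c) (hc1 : c ≤ 1) (hC : 1 ≤ C) : ∃ K, 1 ≤ K ∧
    ∀ f α H, Dat c C f α H → ∀ L : ℝ, 1 ≤ L →
      ‖(∑ n ∈ Finset.Icc 1 ⌊Real.exp L⌋₊, LSeries.logMul^[2] f n) -
        H 1 * (Gamma α)⁻¹ * (Real.exp L * (L : ℂ) ^ (α + 1))‖ ≤ K * Real.exp L * L ^ α.re ∧
      ‖∑ n ∈ Finset.Icc 1 ⌊Real.exp L⌋₊, LSeries.logMul^[2] f n‖ ≤ K * Real.exp L * L ^ (α.re + 1) := by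
  obtain ⟨K1, hK1, h1⟩ := smooth hc hc1 hC
  obtain ⟨K2, hK2, h2⟩ := H_near hc hc1 hC
  obtain ⟨K3, hK3, h3⟩ := gamma_bd
  refine ⟨K1 + 28 + 21 * (K2 * K3), by nlinarith, ?_⟩
  intro f α H hD L hL
  have hL0 : 0 < L := by linarith
  have hr := re_bds hD.hα
  have hH1 : ‖H 1‖ ≤ K2 := (h2 H hD.good 1 (by
    have := Real.rpow_pos_of_pos (tau_pos 1) (-et)
    simp only [one_re]; nlinarith) (by simp)).2.2
  have hc1 : ‖H 1 * (Gamma α)⁻¹‖ ≤ K2 * K3 := by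
    rw [norm_mul]; gcongr; exact h3 α hD.hα
  have s1 := h1 f α H hD L hL
  have s2 := A_desmooth hD.hf hL
  have s3 := B_desmooth hD.hα hL
  set A := ∑ n ∈ Finset.Icc 1 ⌊Real.exp L⌋₊, LSeries.logMul^[2] f n
  set Aw := ∑' n : ℕ, LSeries.logMul^[2] f n * ((tz (L ^ 3)⁻¹ (n * Real.exp (-L)) : ℝ) : ℂ)
  set Bw := ∫ u : ℝ in Ioi 0, (u : ℂ) ^ (α + 1) * exp u * ((tz (L ^ 3)⁻¹ (Real.exp (u - L)) : ℝ) : ℂ)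
  set h := H 1 * (Gamma α)⁻¹
  have hLp : 0 < L ^ α.re := Real.rpow_pos_of_pos hL0 _
  have hinv : L⁻¹ ≤ L ^ α.re := by
    rw [← Real.rpow_neg_one]; exact Real.rpow_le_rpow_of_exponent_le hL hr.1
  have hE := Real.exp_pos L
  have s2' : 28 * Real.exp L * L⁻¹ ≤ 28 * (Real.exp L * L ^ α.re) := by
    rw [mul_assoc]; gcongr
  have s3' : ‖h * (Bw - Real.exp L * (L : ℂ) ^ (α + 1))‖ ≤ 20 * (K2 * K3) * (Real.exp L * L ^ α.re) := by
    rw [norm_mul]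
    calc _ ≤ (K2 * K3) * (20 * Real.exp L * L ^ α.re) := by gcongr
      _ = _ := by ring
  have heq : A - h * (Real.exp L * (L : ℂ) ^ (α + 1)) =
      (Aw - h * Bw) - (Aw - A) + h * (Bw - Real.exp L * (L : ℂ) ^ (α + 1)) := by ring
  have hP : 0 < Real.exp L * L ^ α.re := by positivity
  have hKK : 1 ≤ K2 * K3 := by nlinarith
  have main : ‖A - h * (Real.exp L * (L : ℂ) ^ (α + 1))‖ ≤
      (K1 + 28 + 20 * (K2 * K3)) * (Real.exp L * L ^ α.re) := by
    rw [heq]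
    have t1 := norm_add_le ((Aw - h * Bw) - (Aw - A)) (h * (Bw - Real.exp L * (L : ℂ) ^ (α + 1)))
    have t2 := norm_sub_le (Aw - h * Bw) (Aw - A)
    nlinarith
  constructor
  · nlinarith
  · have hLe : Real.exp L * L ^ α.re ≤ Real.exp L * L ^ (α.re + 1) := by
      gcongr
      linarith
    have hm : ‖h * (Real.exp L * (L : ℂ) ^ (α + 1))‖ ≤ (K2 * K3) * (Real.exp L * L ^ (α.re + 1)) := by
      rw [norm_mul h, norm_mul ((Real.exp L : ℝ) : ℂ), norm_real, Real.norm_of_nonneg hE.le, norm_cpow_eq_rpow_re_of_pos hL0]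
      simp only [add_re, one_re]
      gcongr
    have t := norm_add_le (A - h * (Real.exp L * (L : ℂ) ^ (α + 1))) (h * (Real.exp L * (L : ℂ) ^ (α + 1)))
    rw [sub_add_cancel] at t
    have : (K1 + 28 + 20 * (K2 * K3)) * (Real.exp L * L ^ α.re) ≤
        (K1 + 28 + 20 * (K2 * K3)) * (Real.exp L * L ^ (α.re + 1)) := by gcongr
    linarith

lemma g_deriv {t : ℝ} (ht : 1 < t) : HasDerivAt (fun t : ℝ => (((Real.log t ^ 2)⁻¹ : ℝ) : ℂ))
    ((-(2 / (t * Real.log t ^ 3)) : ℝ) : ℂ) t := by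
  have hl : 0 < Real.log t := Real.log_pos ht
  have h1 := ((Real.hasDerivAt_log (by linarith : t ≠ 0)).pow 2).inv (by show Real.log t ^ 2 ≠ 0; positivity)
  refine HasDerivAt.ofReal_comp (h1.congr_deriv ?_)
  simp
  field_simp

lemma sum_icc01 {a : ℕ → ℂ} (h : a 0 = 0) (N : ℕ) : ∑ n ∈ Finset.Icc 0 N, a n = ∑ n ∈ Finset.Icc 1 N, a n := by
  symm
  refine Finset.sum_subset (Finset.Icc_subset_Icc_left (by norm_num)) fun n hn hn' => ?_
  have : n = 0 := by
    simp only [Finset.mem_Icc] at hn hn'; omega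
  rw [this, h]

lemma triv_bd {b : ℕ → ℂ} {B y : ℝ} (hy : 0 ≤ y) (hb : ∀ n ∈ Finset.Icc 1 ⌊y⌋₊, ‖b n‖ ≤ B) (hB : 0 ≤ B) :
    ‖∑ n ∈ Finset.Icc 1 ⌊y⌋₊, b n‖ ≤ y * B := by
  refine (norm_sum_le _ _).trans ((Finset.sum_le_card_nsmul _ _ _ hb).trans ?_)
  rw [Nat.card_Icc, add_tsub_cancel_right, nsmul_eq_mul]
  gcongr
  exact Nat.floor_le hy

lemma S_asymp {c C : ℝ} (hc : 0 < c) (hc1 : c ≤ 1) (hC : 1 ≤ C) : ∃ K, 1 ≤ K ∧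
    ∀ f α H, Dat c C f α H → ∀ L : ℝ, 2 ≤ L →
      ‖(∑ n ∈ Finset.Icc 1 ⌊Real.exp L⌋₊, f n) -
        H 1 * (Gamma α)⁻¹ * Real.exp L * (L : ℂ) ^ (α - 1)‖ ≤ K * Real.exp L * L ^ (α.re - 2) := by
  obtain ⟨K, hK, hA⟩ := A_asymp hc hc1 hC
  refine ⟨K + 96 + 16 * K, by linarith, ?_⟩
  intro f α H hD L hL
  have hL0 : 0 < L := by linarith
  have hr := re_bds hD.hα
  set x := Real.exp L with hx
  set y := Real.exp (L / 2) with hy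
  have hx0 : 0 < x := Real.exp_pos _
  have hy0 : 0 < y := Real.exp_pos _
  have hyx : y ≤ x := Real.exp_le_exp.2 (by linarith)
  have hy2 : 2 ≤ y := by linarith [Real.add_one_le_exp (L / 2)]
  have hlogy : Real.log y = L / 2 := Real.log_exp _
  have hlogx : Real.log x = L := Real.log_exp _
  set a := LSeries.logMul^[2] f with ha
  have han : ∀ n, a n = (Real.log n : ℂ) ^ 2 * f n := by
    intro n; simp [ha, LSeries.logMul]; ring
  have ha0 : a 0 = 0 := by simp [han]
  set R := L ^ (α.re - 2) with hR
  have hR0 : 0 < R := Real.rpow_pos_of_pos hL0 _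
  have hyR : y ≤ 48 * (x * R) := by
    have h1 : (L ^ 3)⁻¹ ≤ R := by
      rw [hR, ← Real.rpow_natCast, ← Real.rpow_neg hL0.le]
      exact Real.rpow_le_rpow_of_exponent_le (by linarith) (by push_cast; linarith)
    have h2 : L ^ 3 ≤ 48 * y := by
      have := Real.pow_div_factorial_le_exp (L / 2) (by positivity) 3
      simp [Nat.factorial] at this
      rw [div_le_iff₀ (by norm_num)] at this
      nlinarith
    have h3 : x = y * y := by rw [hx, hy, ← Real.exp_add]; congr 1; ring
    calc y = y * L ^ 3 * (L ^ 3)⁻¹ := by field_simp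
      _ ≤ y * (48 * y) * R := by gcongr
      _ = _ := by rw [h3]; ring
  -- split off small terms
  have hfl : ⌊y⌋₊ ≤ ⌊x⌋₊ := Nat.floor_mono hyx
  have h2 : Finset.Icc 1 ⌊x⌋₊ = Finset.Icc 1 ⌊y⌋₊ ∪ Finset.Ioc ⌊y⌋₊ ⌊x⌋₊ := by
    ext n; simp only [Finset.mem_Icc, Finset.mem_union, Finset.mem_Ioc]; omega
  have h3 : Disjoint (Finset.Icc 1 ⌊y⌋₊) (Finset.Ioc ⌊y⌋₊ ⌊x⌋₊) := by
    rw [Finset.disjoint_left]; intro n; simp only [Finset.mem_Icc, Finset.mem_Ioc]; omega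
  set g : ℝ → ℂ := fun t => (((Real.log t ^ 2)⁻¹ : ℝ) : ℂ) with hg
  have h4 : ∑ n ∈ Finset.Ioc ⌊y⌋₊ ⌊x⌋₊, f n = ∑ n ∈ Finset.Ioc ⌊y⌋₊ ⌊x⌋₊, g n * a n := by
    refine Finset.sum_congr rfl fun n hn => ?_
    have : y < n := Nat.lt_of_floor_lt (Finset.mem_Ioc.1 hn).1
    have hl : Real.log n ≠ 0 := (Real.log_pos (by linarith)).ne'
    have hl' : (Real.log n : ℂ) ≠ 0 := by exact_mod_cast hl
    simp only [han, hg, ofReal_inv, ofReal_pow]; field_simp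
  have hder : ∀ t ∈ Icc y x, HasDerivAt g ((-(2 / (t * Real.log t ^ 3)) : ℝ) : ℂ) t := fun t ht =>
    g_deriv (by linarith [ht.1])
  have habel := sum_mul_eq_sub_sub_integral_mul a (f := g) hy0.le hyx
    (fun t ht => (hder t ht).differentiableAt) (by
      have hco : ContinuousOn (fun t : ℝ => ((-(2 / (t * Real.log t ^ 3)) : ℝ) : ℂ)) (Icc y x) := by
        intro t ht
        have h1 : 1 < t := by linarith [ht.1]
        have hl : 0 < Real.log t := Real.log_pos h1
        have hlc : ContinuousAt Real.log t := Real.continuousAt_log (by linarith)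
        refine ContinuousAt.continuousWithinAt ?_
        refine continuous_ofReal.continuousAt.comp ?_
        refine (ContinuousAt.div continuousAt_const (continuousAt_id.mul (hlc.pow 3)) ?_).neg
        exact (mul_pos (show (0:ℝ) < t by linarith) (pow_pos hl 3)).ne'
      exact (hco.integrableOn_Icc).congr_fun (fun t ht => (hder t ht).deriv.symm) measurableSet_Icc)
  simp_rw [sum_icc01 ha0] at habel
  have hS1 : ‖∑ n ∈ Finset.Icc 1 ⌊y⌋₊, f n‖ ≤ y * 1 := triv_bd hy0.le (fun n _ => hD.hf n) zero_le_one
  have hgy : g y = ((4 / L ^ 2 : ℝ) : ℂ) := by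
    simp only [hg, hlogy]; congr 1; field_simp; norm_num
  have hgx : g x = ((1 / L ^ 2 : ℝ) : ℂ) := by
    simp only [hg, hlogx]; congr 1; field_simp
  have hS2 : ‖g y * ∑ n ∈ Finset.Icc 1 ⌊y⌋₊, a n‖ ≤ y := by
    rw [norm_mul, hgy, norm_real, Real.norm_of_nonneg (by positivity)]
    have : ‖∑ n ∈ Finset.Icc 1 ⌊y⌋₊, a n‖ ≤ y * (L / 2) ^ 2 := by
      refine triv_bd hy0.le (fun n hn => ?_) (by positivity)
      have hn := Finset.mem_Icc.1 hn
      have hn1 : (1:ℝ) ≤ n := by exact_mod_cast hn.1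
      have hn2 : (n:ℝ) ≤ y := (Nat.le_floor_iff hy0.le).1 hn.2
      have hl0 := Real.log_nonneg hn1
      have hl : Real.log n ≤ L / 2 := hlogy ▸ Real.log_le_log (by linarith) hn2
      rw [han, norm_mul, norm_pow, norm_real, Real.norm_of_nonneg hl0]
      calc _ ≤ (L / 2) ^ 2 * 1 := by
            gcongr; exact hD.hf n
        _ = _ := mul_one _
    calc _ ≤ 4 / L ^ 2 * (y * (L / 2) ^ 2) := by gcongr
      _ = y := by field_simp; norm_num
  have hS3 : ‖∫ t in Ioc y x, deriv g t * ∑ n ∈ Finset.Icc 1 ⌊t⌋₊, a n‖ ≤ 16 * K * (x * R) := by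
    have := norm_setIntegral_le_of_norm_le_const (μ := volume) (s := Ioc y x)
      (f := fun t => deriv g t * ∑ n ∈ Finset.Icc 1 ⌊t⌋₊, a n) (C := 16 * K * R) (by simp) (fun t ht => by
        have ht1 : 1 < t := by linarith [ht.1]
        have ht0 : 0 < t := by linarith
        set l := Real.log t with hl
        have hl1 : L / 2 ≤ l := hlogy ▸ Real.log_le_log hy0 ht.1.le
        have hl2 : l ≤ L := hlogx ▸ Real.log_le_log ht0 ht.2
        have hl0 : 0 < l := by linarith
        have hb := (hA f α H hD l (by linarith)).2
        rw [hl, Real.exp_log ht0, ← hl] at hb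
        rw [(hder t ⟨ht.1.le, ht.2⟩).deriv, norm_mul, norm_real, norm_neg,
          Real.norm_of_nonneg (by positivity)]
        have hpow : l ^ (α.re - 2) ≤ 8 * R := by
          calc l ^ (α.re - 2) ≤ (L / 2) ^ (α.re - 2) :=
                Real.rpow_le_rpow_of_nonpos (by positivity) hl1 (by linarith)
            _ = R * 2 ^ (-(α.re - 2)) := by
                rw [Real.div_rpow hL0.le (by norm_num), div_eq_mul_inv, ← Real.rpow_neg (by norm_num)]
            _ ≤ R * 2 ^ (3:ℝ) := by
                gcongr
                · norm_num
                · linarith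
            _ = 8 * R := by norm_num; ring
        have hlp : l ^ (α.re + 1) = l ^ (α.re - 2) * l ^ 3 := by
          rw [← Real.rpow_natCast, ← Real.rpow_add hl0]; congr 1; push_cast; ring
        calc _ ≤ 2 / (t * l ^ 3) * (K * t * l ^ (α.re + 1)) := by gcongr
          _ = 2 * K * l ^ (α.re - 2) := by rw [hlp]; field_simp
          _ ≤ 2 * K * (8 * R) := by gcongr
          _ = _ := by ring)
    refine this.trans ?_
    rw [Measure.real, Real.volume_Ioc, ENNReal.toReal_ofReal (by linarith)]
    calc _ ≤ 16 * K * R * x := by gcongr; linarith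
      _ = _ := by ring
  have hAx := (hA f α H hD L (by linarith)).1
  have hLc : (L : ℂ) ≠ 0 := by exact_mod_cast hL0.ne'
  have hcp : (L : ℂ) ^ (α - 1) = (L : ℂ) ^ (α + 1) * g x := by
    rw [hgx, show α - 1 = (α + 1) - (2 : ℕ) by push_cast; ring, cpow_sub _ _ hLc, cpow_natCast]
    push_cast; field_simp
  have hS4 : ‖g x * ((∑ n ∈ Finset.Icc 1 ⌊x⌋₊, a n) - H 1 * (Gamma α)⁻¹ * (x * (L : ℂ) ^ (α + 1)))‖ ≤
      K * (x * R) := by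
    rw [norm_mul, hgx, norm_real, Real.norm_of_nonneg (by positivity)]
    have : L ^ α.re = R * L ^ 2 := by
      rw [hR, ← Real.rpow_natCast, ← Real.rpow_add hL0]; congr 1; push_cast; ring
    rw [this] at hAx
    calc _ ≤ 1 / L ^ 2 * (K * x * (R * L ^ 2)) := by gcongr
      _ = _ := by field_simp
  rw [h2, Finset.sum_union h3, h4, habel, hcp]
  set A1 := ∑ n ∈ Finset.Icc 1 ⌊x⌋₊, a n
  set A2 := ∑ n ∈ Finset.Icc 1 ⌊y⌋₊, a n
  set J := ∫ t in Ioc y x, deriv g t * ∑ n ∈ Finset.Icc 1 ⌊t⌋₊, a n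
  set S1 := ∑ n ∈ Finset.Icc 1 ⌊y⌋₊, f n
  have heq : S1 + (g x * A1 - g y * A2 - J) - H 1 * (Gamma α)⁻¹ * x * ((L : ℂ) ^ (α + 1) * g x) =
      S1 - g y * A2 - J + g x * (A1 - H 1 * (Gamma α)⁻¹ * (x * (L : ℂ) ^ (α + 1))) := by ring
  rw [heq]
  have t1 := norm_add_le (S1 - g y * A2 - J) (g x * (A1 - H 1 * (Gamma α)⁻¹ * (x * (L : ℂ) ^ (α + 1))))
  have t2 := norm_sub_le (S1 - g y * A2) J
  have t3 := norm_sub_le S1 (g y * A2)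
  linarith

end CSD

/-- Selberg–Delange type theorem (M. E. Changa): if `|f(n)| ≤ 1`, `|α| ≤ 1` and
`Σ f(n) n^{−s} = ζ(s)^α·H(s)` with `H` analytic in `{σ > 1 − c₁/log T, |t| ≤ T}` and bounded
there by `(log T)^{c₂}` for every `T ≥ T₀`, then
`Σ_{n ≤ x} f(n) = (H(1)/Γ(α))·x·(log x)^{α−1} + O(x·(log x)^{Re α − 2})`, the implied constant
depending only on `c₁, c₂` (and the threshold `T₀`). -/
theorem changa_selberg_delange (c₁ c₂ T₀ : ℝ) (hc₁ : 0 < c₁) (hc₂ : 0 < c₂) (hT₀ : 3 ≤ T₀) :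
    ∃ C : ℝ, 0 < C ∧ ∃ x₀ : ℝ, 3 ≤ x₀ ∧
      ∀ (f : ℕ → ℂ), (∀ n : ℕ, ‖f n‖ ≤ 1) →
      ∀ (α : ℂ), ‖α‖ ≤ 1 →
      ∀ (H : ℂ → ℂ),
        (∀ T : ℝ, T₀ ≤ T →
          DifferentiableOn ℂ H {s : ℂ | 1 - c₁ / Real.log T < s.re ∧ |s.im| ≤ T} ∧
          ∀ s : ℂ, 1 - c₁ / Real.log T < s.re → |s.im| ≤ T → ‖H s‖ ≤ (Real.log T) ^ c₂) →
        (∀ s : ℂ, 1 < s.re →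
          HasSum (fun n : ℕ => f (n + 1) / ((n : ℂ) + 1) ^ s)
            (Complex.exp (α * logZetaSeries s) * H s)) →
        ∀ x : ℝ, x₀ ≤ x →
          ‖(∑ n ∈ Finset.Icc 1 ⌊x⌋₊, f n) -
              H 1 * (Complex.Gamma α)⁻¹ * x * Complex.exp ((α - 1) * Real.log (Real.log x))‖ ≤
            C * x * Real.exp ((α.re - 2) * Real.log (Real.log x)) := by
  obtain ⟨c, hc, C, hC, hgood⟩ := CSD.good_of_hyp c₁ c₂ T₀ CSD.et hc₁ hc₂ hT₀ CSD.et_pos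
  have hc' : 0 < min c 1 := lt_min hc one_pos
  obtain ⟨K, hK, hS⟩ := CSD.S_asymp hc' (min_le_right c 1) hC
  refine ⟨K, by linarith, Real.exp 2, by linarith [Real.add_one_le_exp 2], ?_⟩
  intro f hf α hα H hH hsum x hx
  have hD : CSD.Dat (min c 1) C f α H := by
    refine ⟨(hgood H hH).mono (min_le_left c 1), hα, hf, fun s hs => ?_⟩
    have h1 := hsum s hs
    have h2 : HasSum (LSeries.term f s) (Complex.exp (α * logZetaSeries s) * H s) := by
      rw [← hasSum_nat_add_iff' 1]
      simpa [LSeries.term] using h1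
    exact h2.tsum_eq
  have hx0 : 0 < x := (Real.exp_pos 2).trans_le hx
  have hL : 2 ≤ Real.log x := (Real.le_log_iff_exp_le hx0).2 hx
  have hL0 : 0 < Real.log x := by linarith
  have h := hS f α H hD (Real.log x) hL
  rw [Real.exp_log hx0, Real.rpow_def_of_pos hL0, Complex.cpow_def_of_ne_zero (by exact_mod_cast hL0.ne'),
    ← Complex.ofReal_log hL0.le, mul_comm _ (α - 1), mul_comm _ (α.re - 2)] at h
  exact h
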